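/- Let $W:\mathbb{R}^2\to[0,\infty)$ be smooth, vanishing exactly at two distinct points $p_-,p_+$, with $D^2W(p_\pm)$ positive definite and $\liminf_{|p|\to\infty}W(p)>0$, and put $F:=\sqrt W$. *Curves.* A *locally Lipschitz curve* is a continuous map $\gamma=(\gamma^1,\gamma^2):[a,b]\to\mathbb{R}^2$ that is locally Lipschitz on $\{t\in[a,b]:\gamma(t)\notin\{p_-,p_+\}\}$. (No Lipschitz bound is required at the times at which $\gamma$ is at a well.) Its degenerate length is $E(\gamma):=\int_a^bF(\gamma)\,|\gamma'|\,dt\in[0,\infty]$, the integrand being $0$ where $\gamma\in\{p_-,p_+\}$. Its signed area is $\mathcal A(\gamma):=\int_\gamma p_1\,dp_2=\int_a^b\gamma^1(\gamma^2)'\,dt$, where the integral, which need not converge absolutely at the wells, is understood as $$\mathcal A(\gamma)=\varphi(\gamma(b))-\varphi(\gamma(a))+\int_a^b\big(\gamma^1(\gamma^2)'-d\varphi_{\gamma}(\gamma')\big)\,dt$$ for a fixed polynomial $\varphi$ on $\mathbb{R}^2$ with $d\varphi=p_1\,dp_2$ at $p_-$ and at $p_+$, provided the last integral converges absolutely (which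 it does if $E(\gamma)<\infty$); its integrand is $0$ where $\gamma\in\{p_-,p_+\}$. For $\gamma$ Lipschitz on $[a,b]$ this is the Lebesgue integral $\int_a^b\gamma^1(\gamma^2)'\,dt$, and for $\gamma$ locally Lipschitz on $(a,b)$ it is the improper integral. *Distance and length.* For $P=(p_1,p_2,p_3)$ and $Q=(q_1,q_2,q_3)$ in $\mathbb{R}^3$ let $\Pi(P):=(p_1,p_2)$ and let $d_F(P,Q)$ be the infimum of $E(\gamma)$ over all locally Lipschitz curves $\gamma$ from $\Pi(P)$ to $\Pi(Q)$ with $\mathcal A(\gamma)=q_3-p_3$. The length of $\Gamma:[a,b]\to\mathbb{R}^3$ is $L(\Gamma):=\sup\sum_{j=1}^N d_F(\Gamma(t_{j-1}),\Gamma(t_j))$ over all finite partitions $a=t_0\le t_1\le\dots\le t_N=b$. A curve $\Gamma=(\Gamma^1,\Gamma^2,\Gamma^3):[a,b]\to\mathbb{R}^3$ is *admissible* if $\Pi(\Gamma)$ is a locally Lipschitz curve and $(\Gamma^3)'=\Gamma^1(\Gamma^2)'$ in the integrated sense that $\Gamma^3(t)-\Gamma^3(s)=\mathcal A(\Pi(\Gamma)|_{[s,t]})$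 for all $a\le s\le t\le b$. *Geodesics.* $\Gamma:[0,1]\to\mathbb{R}^3$ is a *minimizing geodesic* from $P$ to $Q$ if $\Gamma(0)=P$, $\Gamma(1)=Q$, $L(\Gamma|_{[s,t]})=d_F(\Gamma(s),\Gamma(t))$ for all $0\le s\le t\le1$, and $\Gamma$ is the uniform limit with respect to $d_F$ of admissible curves $\Gamma_j:[0,1]\to\mathbb{R}^3$ from $P$ to $Q$ such that $\gamma_j:=\Pi(\Gamma_j)$ has constant degenerate speed, $F(\gamma_j)|\gamma_j'|=E(\gamma_j)$ a.e., and $E(\gamma_j)\to d_F(P,Q)$. **Statement.** Let $P,Q\in\mathbb{R}^3$ and let $\Gamma:[0,1]\to\mathbb{R}^3$ be a minimizing geodesic from $P$ to $Q$. If the closed set $\{t\in[0,1]:\Pi(\Gamma(t))\in\{p_-,p_+\}\}$ contains no nondegenerate interval, then $\gamma:=\Pi(\Gamma)$ is a locally Lipschitz curve from $\Pi(P)$ to $\Pi(Q)$ with $\mathcal A(\gamma)=q_3-p_3$, and it minimizes $E$ among all locally Lipschitz curves $\zeta$ from $\Pi(P)$ to $\Pi(Q)$ with $\mathcal A(\zeta)=q_3-p_3$.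 In particular, suppose that no nondegenerate vertical segment over a well is length minimizing, that is, for $w\in\{p_-,p_+\}$ and all $s<t$ the $L$-length of $u\mapsto(w,u)$, $u\in[s,t]$, strictly exceeds $d_F((w,s),(w,t))$. Then for every $A\in\mathbb{R}$ there is a locally Lipschitz curve from $p_-$ to $p_+$ with signed area $A$ that minimizes $E$ among all such curves. -/

import Mathlib

open MeasureTheory Set Filter Topology
open scoped ENNReal NNReal

noncomputable section

/-- The standing hypotheses on the potential `W`: smooth, nonnegative, vanishing exactly at the
two distinct wells `pm` and `pp`, with positive definite Hessians there, and bounded away from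
zero near infinity (`liminf_{|p|→∞} W(p) > 0`). -/
structure TwoWell (W : ℝ × ℝ → ℝ) (pm pp : ℝ × ℝ) : Prop where
  smooth : ContDiff ℝ (⊤ : ℕ∞) W
  nonneg : ∀ p, 0 ≤ W p
  wells_ne : pm ≠ pp
  zeroSet : ∀ p, W p = 0 ↔ p = pm ∨ p = pp
  hess_m : ∀ v : ℝ × ℝ, v ≠ 0 → 0 < iteratedFDeriv ℝ 2 W pm ![v, v]
  hess_p : ∀ v : ℝ × ℝ, v ≠ 0 → 0 < iteratedFDeriv ℝ 2 W pp ![v, v]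
  coercive : ∃ c > 0, ∃ R : ℝ, ∀ p : ℝ × ℝ, R ≤ ‖p‖ → c ≤ W p

/-- The conformal factor `F = √W`. -/
def confFactor (W : ℝ × ℝ → ℝ) (p : ℝ × ℝ) : ℝ := Real.sqrt (W p)

/-- The Euclidean norm of a vector in `ℝ × ℝ`. -/
def enorm2 (v : ℝ × ℝ) : ℝ := Real.sqrt (v.1 ^ 2 + v.2 ^ 2)

/-- The planar projection `Π(P) = (p₁,p₂)` of a point of `ℝ³`. -/
def proj (P : ℝ × ℝ × ℝ) : ℝ × ℝ := (P.1, P.2.1)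

/-- The planar projection `Π(Γ) = (Γ¹,Γ²)` of a curve in `ℝ³`. -/
def projCurve (Γ : ℝ → ℝ × ℝ × ℝ) : ℝ → ℝ × ℝ := fun t => proj (Γ t)

/-- A locally Lipschitz curve on `[a,b]` joining `p` to `q`. Only the restriction of `γ` to
`[a,b]` matters. The curve is continuous on `[a,b]` and locally Lipschitz wherever it is not at
a well. No Lipschitz bound can be required at the times when the curve is at a well: there `F`
vanishes, so that a curve of constant degenerate speed has unbounded Euclidean speed, and an
optimal curve may spiral into a well with infinite Euclidean length. -/
def IsCurve (pm pp : ℝ × ℝ) (a b : ℝ) (γ : ℝ → ℝ × ℝ) (p q : ℝ × ℝ) : Prop :=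
  a ≤ b ∧ ContinuousOn γ (Icc a b) ∧
  LocallyLipschitzOn {t | t ∈ Icc a b ∧ γ t ≠ pm ∧ γ t ≠ pp} γ ∧ γ a = p ∧ γ b = q

/-- The degenerate length `E(γ) = ∫ₐᵇ F(γ(t)) |γ'(t)| dt` of a planar curve, in `[0,∞]`.
Where `γ` is at a well the integrand is `0`. -/
def degLen (F : ℝ × ℝ → ℝ) (a b : ℝ) (γ : ℝ → ℝ × ℝ) : ℝ≥0∞ :=
  ∫⁻ t in Icc a b, ENNReal.ofReal (F (γ t) * enorm2 (deriv γ t))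

/-- An affine function that is `0` at `pm` and `1` at `pp`. -/
def wellCoord (pm pp p : ℝ × ℝ) : ℝ :=
  ((p.1 - pm.1) * (pp.1 - pm.1) + (p.2 - pm.2) * (pp.2 - pm.2)) /
    ((pp.1 - pm.1) ^ 2 + (pp.2 - pm.2) ^ 2)

/-- A polynomial `φ` on the plane with `dφ = p₁ dp₂` at both wells
(see `fderiv_wellPot_left` and `fderiv_wellPot_right`). -/
def wellPot (pm pp p : ℝ × ℝ) : ℝ :=
  (pm.1 + (pp.1 - pm.1) * (wellCoord pm pp p ^ 2 * (3 - 2 * wellCoord pm pp p))) * p.2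

/-- `A` is the signed area `𝒜(γ) = ∫_γ p₁ dp₂ = ∫ₐᵇ γ¹ (γ²)' dt` of the planar curve `γ` on `[a,b]`.
Since a curve may reach a well with infinite Euclidean length, this integral may converge only
conditionally at a well. It is therefore evaluated by splitting `p₁ dp₂ = dφ + (p₁ dp₂ - dφ)`:
the exact part contributes `φ(γ(b)) - φ(γ(a))`, and the coefficients of the other part vanish at
the wells, so that it is absolutely integrable along curves of finite degenerate length. On curves
that are Lipschitz on `[a,b]` the value is the integral of `γ¹ (γ²)'` (`hasArea_iff_of_lipschitz`),
and if `γ` is locally Lipschitz in the open interval it is the improper integral of `γ¹ (γ²)'`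
(`HasArea.tendsto_integral`). -/
def HasArea (pm pp : ℝ × ℝ) (a b : ℝ) (γ : ℝ → ℝ × ℝ) (A : ℝ) : Prop :=
  IntervalIntegrable
    (fun t => (γ t).1 * (deriv γ t).2 - fderiv ℝ (wellPot pm pp) (γ t) (deriv γ t)) volume a b ∧
  A = wellPot pm pp (γ b) - wellPot pm pp (γ a) +
    ∫ t in a..b, ((γ t).1 * (deriv γ t).2 - fderiv ℝ (wellPot pm pp) (γ t) (deriv γ t))

/-- The singular Carnot–Carathéodory distance `d_F` on `ℝ³`: the infimum of the degenerate lengths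
of the planar curves joining the projections of `P` and `Q` whose signed area is the difference
of the third coordinates. -/
def dCC (F : ℝ × ℝ → ℝ) (pm pp : ℝ × ℝ) (P Q : ℝ × ℝ × ℝ) : ℝ≥0∞ :=
  sInf { x | ∃ a b γ, IsCurve pm pp a b γ (proj P) (proj Q) ∧
      HasArea pm pp a b γ (Q.2.2 - P.2.2) ∧ degLen F a b γ = x }

/-- The length of a curve in `ℝ³` on `[a,b]` with respect to `d_F`: the supremum over finite
partitions of the sums of distances of consecutive sample points. -/
def pathLen (F : ℝ × ℝ → ℝ) (pm pp : ℝ × ℝ) (a b : ℝ) (Γ : ℝ → ℝ × ℝ × ℝ) : ℝ≥0∞ :=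
  sSup { x | ∃ (n : ℕ) (t : Fin (n + 1) → ℝ), Monotone t ∧ t 0 = a ∧ t (Fin.last n) = b ∧
      x = ∑ i : Fin n, dCC F pm pp (Γ (t i.castSucc)) (Γ (t i.succ)) }

/-- `Γ` is an admissible locally Lipschitz curve on `[a,b]` from `P` to `Q`: its projection is a
locally Lipschitz planar curve, and `(Γ³)' = Γ¹ (Γ²)'`, which is required in integrated form, that
is, the increment of `Γ³` over each subinterval is the signed area of the projection there. -/
def IsAdmissible (pm pp : ℝ × ℝ) (a b : ℝ) (Γ : ℝ → ℝ × ℝ × ℝ) (P Q : ℝ × ℝ × ℝ) : Prop :=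
  IsCurve pm pp a b (projCurve Γ) (proj P) (proj Q) ∧ Γ a = P ∧ Γ b = Q ∧
  ∀ s t : ℝ, a ≤ s → s ≤ t → t ≤ b →
    HasArea pm pp s t (projCurve Γ) ((Γ t).2.2 - (Γ s).2.2)

/-- `Γ : [0,1] → ℝ³` is a minimizing geodesic from `P` to `Q`: it joins `P` to `Q`, each of its
sub-arcs is length minimizing, and it is the uniform limit (in the metric `d_F`) of admissible
locally Lipschitz curves joining `P` to `Q`, parametrized with constant degenerate speed, whose
degenerate lengths converge to `d_F(P,Q)`. -/
def IsMinGeodesic (F : ℝ × ℝ → ℝ) (pm pp : ℝ × ℝ) (P Q : ℝ × ℝ × ℝ) (Γ : ℝ → ℝ × ℝ × ℝ) : Prop :=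
  Γ 0 = P ∧ Γ 1 = Q ∧
  (∀ s t : ℝ, 0 ≤ s → s ≤ t → t ≤ 1 → pathLen F pm pp s t Γ = dCC F pm pp (Γ s) (Γ t)) ∧
  ∃ Γseq : ℕ → ℝ → ℝ × ℝ × ℝ,
    (∀ j, IsAdmissible pm pp 0 1 (Γseq j) P Q ∧
      (∀ᵐ t : ℝ ∂volume, t ∈ Ioo (0 : ℝ) 1 →
        ENNReal.ofReal (F (projCurve (Γseq j) t) * enorm2 (deriv (projCurve (Γseq j)) t))
          = degLen F 0 1 (projCurve (Γseq j)))) ∧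
    Tendsto (fun j => degLen F 0 1 (projCurve (Γseq j))) atTop (𝓝 (dCC F pm pp P Q)) ∧
    (∀ ε : ℝ≥0∞, 0 < ε → ∃ N : ℕ, ∀ j ≥ N, ∀ t ∈ Icc (0 : ℝ) 1,
      dCC F pm pp (Γseq j t) (Γ t) < ε)

/-- On `[a,b]`, `γ` minimizes the degenerate length `E` among all locally Lipschitz curves
joining `p` to `q` with signed area `A`; in particular `γ` is itself such a curve. -/
def IsConstrainedMin (F : ℝ × ℝ → ℝ) (pm pp p q : ℝ × ℝ) (A a b : ℝ) (γ : ℝ → ℝ × ℝ) : Prop :=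
  IsCurve pm pp a b γ p q ∧ HasArea pm pp a b γ A ∧
  ∀ a' b' ζ, IsCurve pm pp a' b' ζ p q → HasArea pm pp a' b' ζ A →
    degLen F a b γ ≤ degLen F a' b' ζ

theorem contDiff_wellPot (pm pp : ℝ × ℝ) : ContDiff ℝ 1 (wellPot pm pp) := by
  unfold wellPot wellCoord
  fun_prop

theorem fderiv_wellPot_apply (pm pp p v : ℝ × ℝ) :
    fderiv ℝ (wellPot pm pp) p v =
      (pm.1 + (pp.1 - pm.1) * (wellCoord pm pp p ^ 2 * (3 - 2 * wellCoord pm pp p))) * v.2 +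
      (pp.1 - pm.1) * (6 * wellCoord pm pp p * (1 - wellCoord pm pp p)) *
        ((v.1 * (pp.1 - pm.1) + v.2 * (pp.2 - pm.2)) /
          ((pp.1 - pm.1) ^ 2 + (pp.2 - pm.2) ^ 2)) * p.2 := by
  have hd : DifferentiableAt ℝ (wellPot pm pp) p :=
    (contDiff_wellPot pm pp).differentiable one_ne_zero p
  have h1 : HasDerivAt (fun t : ℝ => p.1 + t * v.1) v.1 0 := by
    simpa using ((hasDerivAt_id (0 : ℝ)).mul_const v.1).const_add p.1
  have h2 : HasDerivAt (fun t : ℝ => p.2 + t * v.2) v.2 0 := by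
    simpa using ((hasDerivAt_id (0 : ℝ)).mul_const v.2).const_add p.2
  have hl : HasDerivAt (fun t : ℝ => (p.1 + t * v.1, p.2 + t * v.2)) v 0 := h1.prodMk h2
  have hc : HasDerivAt (fun t : ℝ => wellPot pm pp (p.1 + t * v.1, p.2 + t * v.2))
      (fderiv ℝ (wellPot pm pp) p v) 0 := by
    have := HasFDerivAt.comp_hasDerivAt (0 : ℝ) (f := fun t : ℝ => (p.1 + t * v.1, p.2 + t * v.2))
      (l := wellPot pm pp) (l' := fderiv ℝ (wellPot pm pp) p) (by simpa using hd.hasFDerivAt) hl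
    exact this
  have hψ : HasDerivAt (fun t : ℝ => wellCoord pm pp (p.1 + t * v.1, p.2 + t * v.2))
      ((v.1 * (pp.1 - pm.1) + v.2 * (pp.2 - pm.2)) /
          ((pp.1 - pm.1) ^ 2 + (pp.2 - pm.2) ^ 2)) 0 :=
    (((h1.sub_const _).mul_const _).add ((h2.sub_const _).mul_const _)).div_const _
  have h3 := (((((hψ.pow 2).mul ((hψ.const_mul 2).const_sub 3)).const_mul
    (pp.1 - pm.1)).const_add pm.1).mul h2)
  have h4 := hc.unique h3
  rw [h4]
  simp
  ring

theorem fderiv_wellPot_left (pm pp v : ℝ × ℝ) :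
    fderiv ℝ (wellPot pm pp) pm v = pm.1 * v.2 := by
  simp [fderiv_wellPot_apply, wellCoord]

theorem fderiv_wellPot_right (pm pp v : ℝ × ℝ) (h : pm ≠ pp) :
    fderiv ℝ (wellPot pm pp) pp v = pp.1 * v.2 := by
  have hne : (pp.1 - pm.1) ^ 2 + (pp.2 - pm.2) ^ 2 ≠ 0 := by
    intro h0
    apply h
    ext
    · nlinarith [sq_nonneg (pp.1 - pm.1), sq_nonneg (pp.2 - pm.2)]
    · nlinarith [sq_nonneg (pp.1 - pm.1), sq_nonneg (pp.2 - pm.2)]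
  have h1 : wellCoord pm pp pp = 1 := by
    unfold wellCoord
    rw [div_eq_one_iff_eq hne]
    ring
  rw [fderiv_wellPot_apply, h1]
  ring

theorem area_aux (pm pp : ℝ × ℝ) {a b : ℝ} (hab : a ≤ b) {γ : ℝ → ℝ × ℝ}
    {K : ℝ≥0} (hγ : LipschitzOnWith K γ (Icc a b)) :
    IntervalIntegrable
      (fun t => (γ t).1 * (deriv γ t).2 - fderiv ℝ (wellPot pm pp) (γ t) (deriv γ t)) volume a b ∧
    ∫ t in a..b, ((γ t).1 * (deriv γ t).2 - fderiv ℝ (wellPot pm pp) (γ t) (deriv γ t)) =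
      (∫ t in a..b, (γ t).1 * deriv (fun s => (γ s).2) t) -
        (wellPot pm pp (γ b) - wellPot pm pp (γ a)) := by
  have hu : uIcc a b = Icc a b := uIcc_of_le hab
  have hac1 : AbsolutelyContinuousOnInterval (fun t => (γ t).1) a b := by
    apply LipschitzOnWith.absolutelyContinuousOnInterval (K := 1 * K)
    rw [hu]
    exact LipschitzWith.prod_fst.comp_lipschitzOnWith hγ
  have hac2 : AbsolutelyContinuousOnInterval (fun t => (γ t).2) a b := by
    apply LipschitzOnWith.absolutelyContinuousOnInterval (K := 1 * K)
    rw [hu]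
    exact LipschitzWith.prod_snd.comp_lipschitzOnWith hγ
  have hac3 : AbsolutelyContinuousOnInterval (fun t => wellPot pm pp (γ t)) a b := by
    have hcomp : IsCompact (γ '' Icc a b) := isCompact_Icc.image_of_continuousOn hγ.continuousOn
    obtain ⟨K', hK'⟩ := LocallyLipschitzOn.exists_lipschitzOnWith_of_compact hcomp
      ((contDiff_wellPot pm pp).locallyLipschitz.locallyLipschitzOn (s := γ '' Icc a b))
    apply LipschitzOnWith.absolutelyContinuousOnInterval (K := K' * K)
    rw [hu]
    exact hK'.comp hγ (mapsTo_image _ _)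
  have hi2 : IntervalIntegrable (fun t => (γ t).1 * deriv (fun s => (γ s).2) t) volume a b :=
    hac2.intervalIntegrable_deriv.continuousOn_mul hac1.continuousOn
  have hi3 := hac3.intervalIntegrable_deriv
  have hae : ∀ᵐ t : ℝ, t ∈ uIoc a b →
      (γ t).1 * deriv (fun s => (γ s).2) t - deriv (fun s => wellPot pm pp (γ s)) t =
        (γ t).1 * (deriv γ t).2 - fderiv ℝ (wellPot pm pp) (γ t) (deriv γ t) := by
    filter_upwards [hac1.ae_differentiableAt, hac2.ae_differentiableAt] with t h1 h2 ht
    have ht' := uIoc_subset_uIcc ht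
    have hd : HasDerivAt γ (deriv (fun s => (γ s).1) t, deriv (fun s => (γ s).2) t) t :=
      (h1 ht').hasDerivAt.prodMk (h2 ht').hasDerivAt
    have hφ : HasDerivAt (fun s => wellPot pm pp (γ s))
        (fderiv ℝ (wellPot pm pp) (γ t) (deriv γ t)) t := by
      have h0 := ((contDiff_wellPot pm pp).differentiable one_ne_zero (γ t)).hasFDerivAt
      exact h0.comp_hasDerivAt t hd.differentiableAt.hasDerivAt
    rw [hφ.deriv, hd.deriv]
  refine ⟨(hi2.sub hi3).congr_ae ((ae_restrict_iff' measurableSet_uIoc).2 hae), ?_⟩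
  rw [← intervalIntegral.integral_congr_ae hae, intervalIntegral.integral_sub hi2 hi3,
    hac3.integral_deriv_eq_sub]

/-- On a curve that is Lipschitz on `[a,b]` the signed area is the integral of `γ¹ (γ²)'`. -/
theorem hasArea_iff_of_lipschitz (pm pp : ℝ × ℝ) {a b : ℝ} (hab : a ≤ b) {γ : ℝ → ℝ × ℝ}
    {K : ℝ≥0} (hγ : LipschitzOnWith K γ (Icc a b)) (A : ℝ) :
    HasArea pm pp a b γ A ↔ A = ∫ t in a..b, (γ t).1 * deriv (fun s => (γ s).2) t := by
  obtain ⟨h1, h2⟩ := area_aux pm pp hab hγ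
  unfold HasArea
  rw [h2, add_sub_cancel]
  exact and_iff_right h1

/-- If the curve is locally Lipschitz in the open interval, then the signed area is the improper
integral of `γ¹ (γ²)'`. -/
theorem HasArea.tendsto_integral {pm pp : ℝ × ℝ} {a b : ℝ} (hab : a < b) {γ : ℝ → ℝ × ℝ}
    (hc : ContinuousOn γ (Icc a b)) (hl : LocallyLipschitzOn (Ioo a b) γ) {A : ℝ}
    (hA : HasArea pm pp a b γ A) :
    Tendsto (fun q : ℝ × ℝ => ∫ t in q.1..q.2, (γ t).1 * deriv (fun s => (γ s).2) t)
      (𝓝[>] a ×ˢ 𝓝[<] b) (𝓝 A) := by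
  obtain ⟨hi, hA⟩ := hA
  set f : ℝ → ℝ := fun t => (γ t).1 * (deriv γ t).2 -
    fderiv ℝ (wellPot pm pp) (γ t) (deriv γ t) with hf
  have hu : uIcc a b = Icc a b := uIcc_of_le hab.le
  have hprim : ContinuousOn (fun x => ∫ t in a..x, f t) (Icc a b) := by
    rw [← hu]
    exact intervalIntegral.continuousOn_primitive_interval' hi left_mem_uIcc
  have hpot : ContinuousOn (fun x => wellPot pm pp (γ x)) (Icc a b) :=
    (contDiff_wellPot pm pp).continuous.comp_continuousOn hc
  have hna : 𝓝[>] a ≤ 𝓝[Icc a b] a := nhdsWithin_le_of_mem (Icc_mem_nhdsGT hab)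
  have hnb : 𝓝[<] b ≤ 𝓝[Icc a b] b := nhdsWithin_le_of_mem (Icc_mem_nhdsLT hab)
  have hG : ContinuousOn (fun x => wellPot pm pp (γ x) + ∫ t in a..x, f t) (Icc a b) :=
    hpot.add hprim
  have t1 := ((hG a (left_mem_Icc.2 hab.le)).mono_left hna).comp
    (tendsto_fst (f := 𝓝[>] a) (g := 𝓝[<] b))
  have t2 := ((hG b (right_mem_Icc.2 hab.le)).mono_left hnb).comp
    (tendsto_snd (f := 𝓝[>] a) (g := 𝓝[<] b))
  have t3 := t2.sub t1
  have hval : A = (wellPot pm pp (γ b) + ∫ t in a..b, f t) -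
      (wellPot pm pp (γ a) + ∫ t in a..a, f t) := by
    rw [hA, intervalIntegral.integral_same]
    ring
  rw [hval]
  refine t3.congr' ?_
  have hm : ∀ᶠ q : ℝ × ℝ in 𝓝[>] a ×ˢ 𝓝[<] b,
      q.1 ∈ Ioo a ((a + b) / 2) ∧ q.2 ∈ Ioo ((a + b) / 2) b := by
    have e1 : ∀ᶠ x in 𝓝[>] a, x ∈ Ioo a ((a + b) / 2) := Ioo_mem_nhdsGT (by linarith)
    have e2 : ∀ᶠ x in 𝓝[<] b, x ∈ Ioo ((a + b) / 2) b := Ioo_mem_nhdsLT (by linarith)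
    exact e1.prod_mk e2
  filter_upwards [hm] with q hq
  have hle : q.1 ≤ q.2 := (hq.1.2.trans hq.2.1).le
  have hsub : Icc q.1 q.2 ⊆ Ioo a b := fun x hx => ⟨hq.1.1.trans_le hx.1, hx.2.trans_lt hq.2.2⟩
  obtain ⟨K, hK⟩ := LocallyLipschitzOn.exists_lipschitzOnWith_of_compact isCompact_Icc
    (hl.mono hsub)
  have h4 := (area_aux pm pp hle hK).2
  have i1 : IntervalIntegrable f volume a q.1 := by
    refine hi.mono_set ?_
    rw [hu, uIcc_of_le hq.1.1.le]
    exact Icc_subset_Icc le_rfl (hle.trans hq.2.2.le)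
  have i2 : IntervalIntegrable f volume q.1 q.2 := (area_aux pm pp hle hK).1
  have h5 := intervalIntegral.integral_add_adjacent_intervals i1 i2
  simp only [Function.comp_apply]
  rw [← h5, h4]
  ring

end

noncomputable section

/-! ### The Euclidean norm on `ℝ × ℝ` -/

theorem enorm2_nonneg (v : ℝ × ℝ) : 0 ≤ enorm2 v := Real.sqrt_nonneg _

theorem enorm2_sq (v : ℝ × ℝ) : enorm2 v ^ 2 = v.1 ^ 2 + v.2 ^ 2 :=
  Real.sq_sqrt (by positivity)

theorem enorm2_zero : enorm2 0 = 0 := by simp [enorm2]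

theorem continuous_enorm2 : Continuous enorm2 := by unfold enorm2; fun_prop

theorem abs_fst_le_enorm2 (v : ℝ × ℝ) : |v.1| ≤ enorm2 v :=
  abs_le_of_sq_le_sq (by rw [enorm2_sq]; nlinarith [sq_nonneg v.2]) (enorm2_nonneg v)

theorem abs_snd_le_enorm2 (v : ℝ × ℝ) : |v.2| ≤ enorm2 v :=
  abs_le_of_sq_le_sq (by rw [enorm2_sq]; nlinarith [sq_nonneg v.1]) (enorm2_nonneg v)

theorem norm_le_enorm2 (v : ℝ × ℝ) : ‖v‖ ≤ enorm2 v := by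
  rw [Prod.norm_def]
  exact max_le (abs_fst_le_enorm2 v) (abs_snd_le_enorm2 v)

theorem enorm2_le (v : ℝ × ℝ) : enorm2 v ≤ 2 * ‖v‖ := by
  have h1 : |v.1| ≤ ‖v‖ := norm_fst_le v
  have h2 : |v.2| ≤ ‖v‖ := norm_snd_le v
  refine (le_abs_self _).trans (abs_le_of_sq_le_sq ?_ (by positivity))
  rw [enorm2_sq, ← sq_abs v.1, ← sq_abs v.2]
  nlinarith [abs_nonneg v.1, abs_nonneg v.2]

theorem enorm2_smul (c : ℝ) (v : ℝ × ℝ) : enorm2 (c • v) = |c| * enorm2 v := by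
  unfold enorm2
  rw [← Real.sqrt_sq_eq_abs, ← Real.sqrt_mul (sq_nonneg c)]
  congr 1
  simp only [Prod.smul_fst, Prod.smul_snd, smul_eq_mul]
  ring

theorem enorm2_neg (v : ℝ × ℝ) : enorm2 (-v) = enorm2 v := by simp [enorm2]

theorem enorm2_pos {v : ℝ × ℝ} (hv : v ≠ 0) : 0 < enorm2 v :=
  (norm_pos_iff.2 hv).trans_le (norm_le_enorm2 v)

/-- Cauchy-Schwarz. -/
theorem abs_dot_le (n v : ℝ × ℝ) : |n.1 * v.1 + n.2 * v.2| ≤ enorm2 n * enorm2 v := by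
  refine abs_le_of_sq_le_sq ?_ (mul_nonneg (enorm2_nonneg _) (enorm2_nonneg _))
  rw [mul_pow, enorm2_sq, enorm2_sq]
  nlinarith [sq_nonneg (n.1 * v.2 - n.2 * v.1)]

/-! ### Real functions of one variable -/

theorem ae_differentiableAt_of_locallyLipschitzOn {V : Type*} [NormedAddCommGroup V]
    [NormedSpace ℝ V] [FiniteDimensional ℝ V] {γ : ℝ → V} {U : Set ℝ} (hU : IsOpen U)
    (h : LocallyLipschitzOn U γ) : ∀ᵐ t : ℝ, t ∈ U → DifferentiableAt ℝ γ t := by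
  rw [ae_iff]
  refine measure_null_of_locally_null _ fun x hx => ?_
  have hxU : x ∈ U := by
    by_contra hxU
    exact hx fun h' => absurd h' hxU
  obtain ⟨K, s, hs, hK⟩ := h hxU
  rw [hU.nhdsWithin_eq hxU] at hs
  obtain ⟨o, hos, ho, hxo⟩ := mem_nhds_iff.1 hs
  refine ⟨{t | ¬ (t ∈ U → DifferentiableAt ℝ γ t)} ∩ o,
    inter_mem self_mem_nhdsWithin (mem_nhdsWithin_of_mem_nhds (ho.mem_nhds hxo)), ?_⟩
  have hd := (hK.mono hos).ae_differentiableWithinAt_of_mem_real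
  rw [ae_iff] at hd
  refine measure_mono_null (fun t ht => ?_) hd
  intro hc
  exact ht.1 fun _ => (hc ht.2).differentiableAt (ho.mem_nhds ht.2)

theorem abs_deriv_le_of_abs_sub_le {f g : ℝ → ℝ} {f' g' t : ℝ} (hf : HasDerivAt f f' t)
    (hg : HasDerivAt g g' t) (h : ∀ᶠ s in 𝓝 t, |f s - f t| ≤ |g s - g t|) : |f'| ≤ |g'| := by
  have h1 := (hasDerivAt_iff_tendsto_slope.1 hf).abs
  have h2 := (hasDerivAt_iff_tendsto_slope.1 hg).abs
  refine le_of_tendsto_of_tendsto h1 h2 ?_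
  filter_upwards [mem_nhdsWithin_of_mem_nhds h] with s hs
  simp only [slope_def_field, abs_div]
  gcongr

theorem exists_lipschitz_flat (c₁ c₂ : ℝ) {ε : ℝ} (hε : 0 < ε) :
    ∃ ψ : ℝ → ℝ, LipschitzWith 1 ψ ∧ (∀ᶠ x in 𝓝 c₁, ψ x = ψ c₁) ∧ (∀ᶠ x in 𝓝 c₂, ψ x = ψ c₂) ∧
      ∀ x, |ψ x - x| ≤ 2 * ε := by
  let S : ℝ → ℝ → ℝ := fun c x => x - max (-ε) (min ε (x - c))
  have hL : ∀ c, LipschitzWith 1 (S c) := by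
    intro c
    refine LipschitzWith.of_dist_le_mul fun x y => ?_
    simp only [Real.dist_eq, NNReal.coe_one, one_mul, S]
    have key : ∀ u v : ℝ, u ≤ v → max (-ε) (min ε (u - c)) ≤ max (-ε) (min ε (v - c)) ∧
        max (-ε) (min ε (v - c)) - max (-ε) (min ε (u - c)) ≤ v - u := by
      intro u v huv
      constructor
      · gcongr
      · simp only [max_def, min_def]
        split_ifs <;> linarith
    rcases le_total x y with h | h
    · obtain ⟨k1, k2⟩ := key x y h
      rw [abs_of_nonpos (by linarith), abs_of_nonpos (by linarith)]
      linarith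
    · obtain ⟨k1, k2⟩ := key y x h
      rw [abs_of_nonneg (by linarith), abs_of_nonneg (by linarith)]
      linarith
  have hflat : ∀ c, ∀ᶠ x in 𝓝 c, S c x = S c c := by
    intro c
    filter_upwards [Metric.ball_mem_nhds c hε] with x hx
    rw [Metric.mem_ball, Real.dist_eq, abs_lt] at hx
    simp only [S, sub_self]
    rw [min_eq_right (by linarith), max_eq_right (by linarith), min_eq_right hε.le,
      max_eq_right (by linarith)]
    ring
  have hdist : ∀ c x, |S c x - x| ≤ ε := by
    intro c x
    simp only [S, sub_sub_cancel_left, abs_neg]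
    rw [abs_le]
    exact ⟨le_max_left _ _, max_le (by linarith) (min_le_left _ _)⟩
  refine ⟨fun x => S (S c₁ c₂) (S c₁ x), ?_, ?_, ?_, ?_⟩
  · have := (hL (S c₁ c₂)).comp (hL c₁)
    rw [mul_one] at this
    exact this
  · filter_upwards [hflat c₁] with x hx
    rw [hx]
  · have := (hL c₁).continuous.tendsto c₂
    filter_upwards [this (hflat (S c₁ c₂))] with x hx
    exact hx
  · intro x
    have h1 := hdist (S c₁ c₂) (S c₁ x)
    have h2 := hdist c₁ x
    rw [abs_le] at *
    constructor <;> linarith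

/-- The increment of `f` is bounded by the integral of a bound of its derivative, even if `f` is
only continuous at the times at which it takes one of two exceptional values. -/
theorem abs_sub_le_integral_of_exceptional_values {f g : ℝ → ℝ} {a b c₁ c₂ : ℝ} (hab : a ≤ b)
    (hf : ContinuousOn f (Icc a b))
    (hl : LocallyLipschitzOn {t | t ∈ Icc a b ∧ f t ≠ c₁ ∧ f t ≠ c₂} f)
    (hg : IntervalIntegrable g volume a b) (hg0 : ∀ t, 0 ≤ g t)
    (hb : ∀ᵐ t : ℝ, t ∈ Ioo a b → f t ≠ c₁ → f t ≠ c₂ → |deriv f t| ≤ g t) :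
    |f b - f a| ≤ ∫ t in a..b, g t := by
  have hu : uIcc a b = Icc a b := uIcc_of_le hab
  have key : ∀ ε > 0, |f b - f a| ≤ (∫ t in a..b, g t) + 4 * ε := by
    intro ε hε
    obtain ⟨ψ, hψ, hf1, hf2, hψd⟩ := exists_lipschitz_flat c₁ c₂ hε
    have hconst : ∀ t ∈ Icc a b, (f t = c₁ ∨ f t = c₂) →
        ∀ᶠ s in 𝓝[Icc a b] t, ψ (f s) = ψ (f t) := by
      rintro t ht (h | h)
      · have := hf t ht
        rw [ContinuousWithinAt, h] at this
        rw [h]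
        exact this hf1
      · have := hf t ht
        rw [ContinuousWithinAt, h] at this
        rw [h]
        exact this hf2
    have hloc : LocallyLipschitzOn (Icc a b) (fun t => ψ (f t)) := by
      intro t ht
      by_cases h : f t = c₁ ∨ f t = c₂
      · refine ⟨0, {s | ψ (f s) = ψ (f t)}, hconst t ht h, ?_⟩
        intro x hx y hy
        rw [mem_ofPred_eq] at hx hy
        simp [hx, hy]
      · push Not at h
        obtain ⟨K, s, hs, hK⟩ := hl ⟨ht, h⟩
        refine ⟨1 * K, s, ?_, (hψ.comp_lipschitzOnWith hK)⟩
        have hopen : {t | t ∈ Icc a b ∧ f t ≠ c₁ ∧ f t ≠ c₂} ∈ 𝓝[Icc a b] t := by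
          have e1 := (hf t ht).eventually_ne h.1
          have e2 := (hf t ht).eventually_ne h.2
          filter_upwards [e1, e2, self_mem_nhdsWithin] with x h1 h2 h3
          exact ⟨h3, h1, h2⟩
        exact nhdsWithin_le_of_mem hopen hs
    obtain ⟨K, hK⟩ := LocallyLipschitzOn.exists_lipschitzOnWith_of_compact isCompact_Icc hloc
    have hac : AbsolutelyContinuousOnInterval (fun t => ψ (f t)) a b := by
      apply LipschitzOnWith.absolutelyContinuousOnInterval (K := K)
      rwa [hu]
    have hU : IsOpen {t | t ∈ Ioo a b ∧ f t ≠ c₁ ∧ f t ≠ c₂} := by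
      rw [isOpen_iff_mem_nhds]
      rintro t ⟨ht, h1, h2⟩
      have hc : ContinuousAt f t := hf.continuousAt (Icc_mem_nhds ht.1 ht.2)
      filter_upwards [hc.eventually_ne h1, hc.eventually_ne h2, isOpen_Ioo.mem_nhds ht]
        with x h1 h2 h3
      exact ⟨h3, h1, h2⟩
    have hdf := ae_differentiableAt_of_locallyLipschitzOn hU
      (hl.mono fun t ht => ⟨Ioo_subset_Icc_self ht.1, ht.2⟩)
    have hae : ∀ᵐ t : ℝ, t ∈ Ioo a b → ‖deriv (fun t => ψ (f t)) t‖ ≤ g t := by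
      filter_upwards [hac.ae_differentiableAt, hdf, hb] with t h1 h2 h3 ht
      by_cases h : f t = c₁ ∨ f t = c₂
      · have hc := hconst t (Ioo_subset_Icc_self ht) h
        rw [nhdsWithin_eq_nhds.2 (Icc_mem_nhds ht.1 ht.2)] at hc
        have : (fun t => ψ (f t)) =ᶠ[𝓝 t] fun _ => ψ (f t) := hc
        rw [this.deriv_eq, deriv_const, norm_zero]
        exact hg0 t
      · push Not at h
        refine le_trans ?_ (h3 ht h.1 h.2)
        refine abs_deriv_le_of_abs_sub_le
          (h1 (hu ▸ Ioo_subset_Icc_self ht)).hasDerivAt (h2 ⟨ht, h⟩).hasDerivAt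
          (Eventually.of_forall fun s => ?_)
        have := hψ.dist_le_mul (f s) (f t)
        simpa [Real.dist_eq] using this
    have h1 : |ψ (f b) - ψ (f a)| ≤ ∫ t in a..b, g t := by
      rw [← hac.integral_deriv_eq_sub, ← Real.norm_eq_abs]
      refine intervalIntegral.norm_integral_le_of_norm_le hab ?_ hg
      filter_upwards [hae, Measure.ae_ne volume b] with t ht htb hmem
      exact ht ⟨hmem.1, lt_of_le_of_ne hmem.2 htb⟩
    have h2 := hψd (f a)
    have h3 := hψd (f b)
    rw [abs_le] at *
    constructor <;> linarith
  refine le_of_forall_pos_le_add fun ε hε => ?_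
  have := key (ε / 4) (by positivity)
  linarith

theorem AbsolutelyContinuousOnInterval.of_abs_sub_le {f g : ℝ → ℝ} {a b : ℝ} (hab : a ≤ b)
    (hg : IntervalIntegrable g volume a b)
    (hfg : ∀ s t, a ≤ s → s ≤ t → t ≤ b → |f t - f s| ≤ ∫ u in s..t, g u) :
    AbsolutelyContinuousOnInterval f a b := by
  have hG := hg.absolutelyContinuousOnInterval_intervalIntegral (left_mem_uIcc (a := a) (b := b))
  have hu : uIcc a b = Icc a b := uIcc_of_le hab
  rw [absolutelyContinuousOnInterval_iff] at hG ⊢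
  intro ε hε
  obtain ⟨δ, hδ, h⟩ := hG ε hε
  refine ⟨δ, hδ, fun E hE hlt => (Finset.sum_le_sum fun i hi => ?_).trans_lt (h E hE hlt)⟩
  obtain ⟨h1, h2⟩ := hE.1 i hi
  rw [hu] at h1 h2
  have hsub : ∀ x ∈ Icc a b, IntervalIntegrable g volume a x := fun x hx =>
    hg.mono_set (by rw [hu, uIcc_of_le hx.1]; exact Icc_subset_Icc le_rfl hx.2)
  rw [Real.dist_eq, Real.dist_eq, intervalIntegral.integral_interval_sub_left (hsub _ h1) (hsub _ h2)]
  rcases le_total (E.2 i).1 (E.2 i).2 with hle | hle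
  · rw [intervalIntegral.integral_symm, abs_neg, abs_sub_comm]
    exact (hfg _ _ h1.1 hle h2.2).trans (le_abs_self _)
  · exact (hfg _ _ h2.1 hle h1.2).trans (le_abs_self _)

theorem ae_abs_deriv_le_of_abs_sub_le {f g : ℝ → ℝ} {a b : ℝ} (hab : a ≤ b)
    (hg : IntervalIntegrable g volume a b)
    (hfg : ∀ s t, a ≤ s → s ≤ t → t ≤ b → |f t - f s| ≤ ∫ u in s..t, g u) :
    ∀ᵐ t : ℝ, t ∈ Ioo a b → DifferentiableAt ℝ f t ∧ |deriv f t| ≤ |g t| := by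
  have hac := AbsolutelyContinuousOnInterval.of_abs_sub_le hab hg hfg
  have hu : uIcc a b = Icc a b := uIcc_of_le hab
  filter_upwards [hac.ae_differentiableAt, hg.ae_hasDerivAt_integral] with t h1 h2 ht
  have ht' : t ∈ uIcc a b := hu ▸ Ioo_subset_Icc_self ht
  refine ⟨h1 ht', ?_⟩
  refine abs_deriv_le_of_abs_sub_le (h1 ht').hasDerivAt (h2 ht' a left_mem_uIcc) ?_
  filter_upwards [isOpen_Ioo.mem_nhds ht] with s hs
  have hsub : ∀ x ∈ Ioo a b, IntervalIntegrable g volume a x := fun x hx =>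
    hg.mono_set (by rw [hu, uIcc_of_le hx.1.le]; exact Icc_subset_Icc le_rfl hx.2.le)
  rw [intervalIntegral.integral_interval_sub_left (hsub _ hs) (hsub _ ht)]
  rcases le_total s t with hle | hle
  · rw [intervalIntegral.integral_symm, abs_neg, abs_sub_comm]
    exact (hfg _ _ hs.1.le hle ht.2.le).trans (le_abs_self _)
  · exact (hfg _ _ ht.1.le hle hs.2.le).trans (le_abs_self _)

end

noncomputable section

/-! ### The potential near the wells and the conformal factor -/

theorem TwoWell.exists_pos_le_of_well {W : ℝ × ℝ → ℝ} {pm pp : ℝ × ℝ} (hW : TwoWell W pm pp)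
    {w : ℝ × ℝ} (hw : w = pm ∨ w = pp) : W w = 0 ∧ fderiv ℝ W w = 0 ∧
      ∀ v : ℝ × ℝ, v ≠ 0 → 0 < fderiv ℝ (fderiv ℝ W) w v v := by
  have h0 : W w = 0 := (hW.zeroSet w).2 hw
  refine ⟨h0, ?_, ?_⟩
  · apply IsLocalMin.fderiv_eq_zero
    exact Eventually.of_forall fun p => by rw [h0]; exact hW.nonneg p
  · intro v hv
    have h : 0 < iteratedFDeriv ℝ 2 W w ![v, v] := by
      rcases hw with rfl | rfl
      · exact hW.hess_m v hv
      · exact hW.hess_p v hv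
    rw [iteratedFDeriv_two_apply] at h
    simpa using h

theorem TwoWell.continuous_confFactor {W : ℝ × ℝ → ℝ} {pm pp : ℝ × ℝ} (hW : TwoWell W pm pp) :
    Continuous (confFactor W) := hW.smooth.continuous.sqrt

theorem confFactor_nonneg (W : ℝ × ℝ → ℝ) (p : ℝ × ℝ) : 0 ≤ confFactor W p := Real.sqrt_nonneg _

theorem TwoWell.confFactor_sq {W : ℝ × ℝ → ℝ} {pm pp : ℝ × ℝ} (hW : TwoWell W pm pp) (p : ℝ × ℝ) :
    confFactor W p ^ 2 = W p := Real.sq_sqrt (hW.nonneg p)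

theorem TwoWell.confFactor_eq_zero_iff {W : ℝ × ℝ → ℝ} {pm pp : ℝ × ℝ} (hW : TwoWell W pm pp)
    (p : ℝ × ℝ) : confFactor W p = 0 ↔ p = pm ∨ p = pp := by
  rw [confFactor, Real.sqrt_eq_zero (hW.nonneg p), hW.zeroSet]

theorem TwoWell.confFactor_pos {W : ℝ × ℝ → ℝ} {pm pp : ℝ × ℝ} (hW : TwoWell W pm pp)
    {p : ℝ × ℝ} (h1 : p ≠ pm) (h2 : p ≠ pp) : 0 < confFactor W p := by
  refine lt_of_le_of_ne (confFactor_nonneg W p) fun h => ?_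
  rcases (hW.confFactor_eq_zero_iff p).1 h.symm with h | h
  exacts [h1 h, h2 h]

/-- The second order Taylor expansion at a well. -/
theorem TwoWell.taylor_well {W : ℝ × ℝ → ℝ} {pm pp : ℝ × ℝ} (hW : TwoWell W pm pp)
    {w : ℝ × ℝ} (hw : w = pm ∨ w = pp) {ε : ℝ} (hε : 0 < ε) : ∃ r > 0, ∀ p, ‖p - w‖ < r →
      |W p - (1 / 2) * fderiv ℝ (fderiv ℝ W) w (p - w) (p - w)| ≤ ε * ‖p - w‖ ^ 2 := by
  obtain ⟨h0, h1, -⟩ := hW.exists_pos_le_of_well hw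
  have hC2 : ContDiff ℝ 2 W := by exact_mod_cast contDiff_infty.1 hW.smooth 2
  have hC1 : ContDiff ℝ 1 (fderiv ℝ W) := hC2.fderiv_right (by norm_num)
  set L := fderiv ℝ (fderiv ℝ W) w with hL
  have hd : HasFDerivAt (fderiv ℝ W) L w := (hC1.differentiable one_ne_zero w).hasFDerivAt
  have hsymm : ∀ u v, L u v = L v u := by
    have := hC2.contDiffAt.isSymmSndFDerivAt (x := w) (by simp)
    exact fun u v => this u v
  have ho := hd.isLittleO.def hε
  rw [Metric.eventually_nhds_iff] at ho
  obtain ⟨r, hr, ho⟩ := ho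
  refine ⟨r, hr, fun p hp => ?_⟩
  have hq : ∀ x : ℝ × ℝ, HasFDerivAt (fun x => W x - (1 / 2) * L (x - w) (x - w))
      (fderiv ℝ W x - L (x - w)) x := by
    intro x
    have e1 : HasFDerivAt (fun x : ℝ × ℝ => x - w) (ContinuousLinearMap.id ℝ (ℝ × ℝ)) x :=
      (hasFDerivAt_id x).sub_const w
    have e2 := (L.hasFDerivAt (x := x - w)).comp x e1
    have e3 := (e2.clm_apply e1).const_mul (1 / 2)
    have e4 := (hC2.differentiable two_ne_zero x).hasFDerivAt.sub e3
    refine e4.congr_fderiv (ContinuousLinearMap.ext fun v => ?_)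
    have e5 := hsymm v (x - w)
    simp only [sub_apply, smul_apply,
      add_apply, ContinuousLinearMap.comp_apply, ContinuousLinearMap.flip_apply,
      ContinuousLinearMap.id_apply, Function.comp_apply, smul_eq_mul]
    rw [e5]
    ring
  have hconv := (convex_closedBall w ‖p - w‖).norm_image_sub_le_of_norm_hasFDerivWithin_le
    (f := fun x => W x - (1 / 2) * L (x - w) (x - w)) (C := ε * ‖p - w‖) (x := w) (y := p)
    (fun x _ => (hq x).hasFDerivWithinAt) (fun x hx => ?_) (by simp) (by simp [dist_eq_norm])
  · simp only [sub_self, map_zero, mul_zero, sub_zero, h0, Real.norm_eq_abs] at hconv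
    calc _ ≤ _ := hconv
      _ = _ := by ring
  · rw [Metric.mem_closedBall, dist_eq_norm] at hx
    have := ho (y := x) (by rw [dist_eq_norm]; linarith)
    rw [h1, sub_zero] at this
    exact this.trans (by gcongr)

/-- The quadratic approximation of `W` at the well `w`: `F(p) = |B (p - w)| + o(|p - w|)`, where
`B` is the symmetric matrix with entries `b₁₁, b₁₂, b₂₂`. -/
structure WellFrame (W : ℝ × ℝ → ℝ) (w : ℝ × ℝ) where
  b₁₁ : ℝ
  b₁₂ : ℝ
  b₂₂ : ℝ
  pos : 0 < b₁₁
  det_pos : 0 < b₁₁ * b₂₂ - b₁₂ ^ 2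
  approx : ∀ ε > 0, ∃ r > 0, ∀ p, ‖p - w‖ < r →
    |confFactor W p - enorm2 (b₁₁ * (p - w).1 + b₁₂ * (p - w).2, b₁₂ * (p - w).1 + b₂₂ * (p - w).2)|
      ≤ ε * ‖p - w‖

/-- A symmetric positive definite `2 × 2` matrix has a symmetric positive definite square root. -/
theorem exists_sqrt_two_by_two {α β δ : ℝ} (hα : 0 < α) (hdet : 0 < α * δ - β ^ 2) :
    ∃ x y z : ℝ, 0 < x ∧ 0 < x * z - y ^ 2 ∧ x ^ 2 + y ^ 2 = α ∧ y * (x + z) = β ∧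
      y ^ 2 + z ^ 2 = δ := by
  have hδ : 0 < δ := by
    by_contra h
    push Not at h
    nlinarith [sq_nonneg β, mul_nonneg hα.le (neg_nonneg.2 h)]
  set s := √(α * δ - β ^ 2) with hs
  have hs0 : 0 < s := Real.sqrt_pos.2 hdet
  have hs2 : s ^ 2 = α * δ - β ^ 2 := Real.sq_sqrt hdet.le
  set τ := √(α + δ + 2 * s) with hτ
  have hτ0 : 0 < τ := Real.sqrt_pos.2 (by positivity)
  have hτ2 : τ ^ 2 = α + δ + 2 * s := Real.sq_sqrt (by positivity)
  refine ⟨(α + s) / τ, β / τ, (δ + s) / τ, by positivity, ?_, ?_, ?_, ?_⟩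
  · have : (α + s) / τ * ((δ + s) / τ) - (β / τ) ^ 2 = s := by
      field_simp
      rw [hτ2]
      linear_combination (-1) * hs2
    rw [this]; exact hs0
  · field_simp
    rw [hτ2]
    linear_combination hs2
  · field_simp
    rw [hτ2]
    ring
  · field_simp
    rw [hτ2]
    linear_combination hs2

theorem exists_enorm2_lower {x y z : ℝ} (hdet : 0 < x * z - y ^ 2) :
    ∃ c > 0, ∀ v : ℝ × ℝ, c * ‖v‖ ≤ enorm2 (x * v.1 + y * v.2, y * v.1 + z * v.2) := by
  have hinj : ∀ v : ℝ × ℝ, (x * v.1 + y * v.2, y * v.1 + z * v.2) = (0 : ℝ × ℝ) → v = 0 := by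
    intro v hv
    rw [Prod.mk_eq_zero] at hv
    obtain ⟨h1, h2⟩ := hv
    have e2 : (x * z - y ^ 2) * v.2 = 0 := by linear_combination x * h2 - y * h1
    have e1 : (x * z - y ^ 2) * v.1 = 0 := by linear_combination z * h1 - y * h2
    ext
    · simpa [hdet.ne'] using e1
    · simpa [hdet.ne'] using e2
  have hcont : Continuous fun v : ℝ × ℝ => enorm2 (x * v.1 + y * v.2, y * v.1 + z * v.2) :=
    continuous_enorm2.comp (by fun_prop)
  obtain ⟨v₀, hv₀, hmin⟩ := (isCompact_sphere (0 : ℝ × ℝ) 1).exists_isMinOn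
    ⟨(1, 0), by simp [Prod.norm_def]⟩ hcont.continuousOn
  refine ⟨_, enorm2_pos (v := (x * v₀.1 + y * v₀.2, y * v₀.1 + z * v₀.2)) fun h => ?_,
    fun v => ?_⟩
  · have := hinj v₀ h
    rw [this] at hv₀
    simp at hv₀
  · by_cases hv : v = 0
    · subst hv
      simp [enorm2]
    have hn : 0 < ‖v‖ := norm_pos_iff.2 hv
    have hm := hmin (a := ‖v‖⁻¹ • v) (by simp [norm_smul, hn.ne'])
    simp only [mem_ofPred_eq] at hm
    have : (x * (‖v‖⁻¹ • v).1 + y * (‖v‖⁻¹ • v).2, y * (‖v‖⁻¹ • v).1 + z * (‖v‖⁻¹ • v).2) =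
        ‖v‖⁻¹ • (x * v.1 + y * v.2, y * v.1 + z * v.2) := by
      ext <;> simp <;> ring
    rw [this, enorm2_smul, abs_of_pos (by positivity), ← div_eq_inv_mul, le_div_iff₀ hn] at hm
    exact hm

theorem TwoWell.nonempty_wellFrame {W : ℝ × ℝ → ℝ} {pm pp : ℝ × ℝ} (hW : TwoWell W pm pp)
    {w : ℝ × ℝ} (hw : w = pm ∨ w = pp) : Nonempty (WellFrame W w) := by
  obtain ⟨-, -, hpos⟩ := hW.exists_pos_le_of_well hw
  have hC2 : ContDiff ℝ 2 W := by exact_mod_cast contDiff_infty.1 hW.smooth 2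
  set L := fderiv ℝ (fderiv ℝ W) w with hL
  have hsymm : ∀ u v, L u v = L v u := by
    have := hC2.contDiffAt.isSymmSndFDerivAt (x := w) (by simp)
    exact fun u v => this u v
  have hexp : ∀ v : ℝ × ℝ, L v v =
      v.1 ^ 2 * L (1, 0) (1, 0) + 2 * v.1 * v.2 * L (1, 0) (0, 1) + v.2 ^ 2 * L (0, 1) (0, 1) := by
    intro v
    have hv : v = v.1 • (1, 0) + v.2 • ((0, 1) : ℝ × ℝ) := by ext <;> simp
    conv_lhs => rw [hv]
    simp only [map_add, map_smul, add_apply, smul_apply,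
      smul_eq_mul]
    rw [hsymm (0, 1) (1, 0)]
    ring
  set α := L (1, 0) (1, 0) / 2 with hα
  set β := L (1, 0) (0, 1) / 2 with hβ
  set δ := L (0, 1) (0, 1) / 2 with hδ
  have hα0 : 0 < α := by
    have := hpos (1, 0) (by simp)
    positivity
  have hdet : 0 < α * δ - β ^ 2 := by
    have := hpos (-β, α) (by simp [hα0.ne'])
    rw [hexp] at this
    simp only at this
    have h2 : 0 < (2 * α) * (α * δ - β ^ 2) := by
      have e1 : L (1, 0) (1, 0) = 2 * α := by rw [hα]; ring
      have e2 : L (1, 0) (0, 1) = 2 * β := by rw [hβ]; ring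
      have e3 : L (0, 1) (0, 1) = 2 * δ := by rw [hδ]; ring
      rw [e1, e2, e3] at this
      linarith
    exact pos_of_mul_pos_right h2 (by positivity)
  obtain ⟨x, y, z, hx, hd, h1, h2, h3⟩ := exists_sqrt_two_by_two hα0 hdet
  obtain ⟨c, hc, hlow⟩ := exists_enorm2_lower hd
  refine ⟨⟨x, y, z, hx, hd, fun ε hε => ?_⟩⟩
  obtain ⟨r, hr, hT⟩ := hW.taylor_well hw (ε := c * ε) (by positivity)
  refine ⟨r, hr, fun p hp => ?_⟩
  have hT := hT p hp
  set v := p - w with hv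
  set G := enorm2 (x * v.1 + y * v.2, y * v.1 + z * v.2) with hG
  have hG2 : G ^ 2 = 1 / 2 * L v v := by
    rw [hG, enorm2_sq, hexp]
    simp only
    have e1 : L (1, 0) (1, 0) = 2 * α := by rw [hα]; ring
    have e2 : L (1, 0) (0, 1) = 2 * β := by rw [hβ]; ring
    have e3 : L (0, 1) (0, 1) = 2 * δ := by rw [hδ]; ring
    rw [e1, e2, e3, ← h1, ← h2, ← h3]
    ring
  rw [← hG2, ← hW.confFactor_sq, sq_sub_sq, abs_mul] at hT
  have hF := confFactor_nonneg W p
  have hlow := hlow v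
  by_cases hv0 : ‖v‖ = 0
  · have : v = 0 := norm_eq_zero.1 hv0
    have hpw : p = w := sub_eq_zero.1 this
    have : confFactor W p = 0 := (hW.confFactor_eq_zero_iff p).2 (by rw [hpw]; exact hw)
    rw [this, hv0, hG, norm_eq_zero.1 hv0]
    simp [enorm2]
  have hvpos : 0 < ‖v‖ := lt_of_le_of_ne (norm_nonneg _) (Ne.symm hv0)
  rw [abs_of_nonneg (add_nonneg hF (enorm2_nonneg _))] at hT
  have : c * ‖v‖ * |confFactor W p - G| ≤ c * ‖v‖ * (ε * ‖v‖) := by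
    calc _ ≤ (confFactor W p + G) * |confFactor W p - G| := by gcongr; linarith
      _ ≤ _ := hT
      _ = _ := by ring
  exact le_of_mul_le_mul_left this (by positivity)

namespace WellFrame

variable {W : ℝ × ℝ → ℝ} {w : ℝ × ℝ}

/-- The matrix `B` rotated by a right angle, as a map. -/
def rot (D : WellFrame W w) (v : ℝ × ℝ) : ℝ × ℝ :=
  (-(D.b₁₂ * v.1 + D.b₂₂ * v.2), D.b₁₁ * v.1 + D.b₁₂ * v.2)

theorem approx_rot (D : WellFrame W w) {ε : ℝ} (hε : 0 < ε) : ∃ r > 0, ∀ p, ‖p - w‖ < r →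
    |confFactor W p - enorm2 (D.rot (p - w))| ≤ ε * ‖p - w‖ := by
  obtain ⟨r, hr, h⟩ := D.approx ε hε
  refine ⟨r, hr, fun p hp => ?_⟩
  have : enorm2 (D.rot (p - w)) = enorm2 (D.b₁₁ * (p - w).1 + D.b₁₂ * (p - w).2,
      D.b₁₂ * (p - w).1 + D.b₂₂ * (p - w).2) := by
    simp only [enorm2, rot]
    congr 1
    ring
  rw [this]
  exact h p hp

theorem exists_rot_lower (D : WellFrame W w) : ∃ c > 0, ∀ v : ℝ × ℝ, c * ‖v‖ ≤ enorm2 (D.rot v) := by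
  obtain ⟨c, hc, h⟩ := exists_enorm2_lower D.det_pos
  refine ⟨c, hc, fun v => ?_⟩
  have : enorm2 (D.rot v) = enorm2 (D.b₁₁ * v.1 + D.b₁₂ * v.2, D.b₁₂ * v.1 + D.b₂₂ * v.2) := by
    simp only [enorm2, rot]
    congr 1
    ring
  rw [this]
  exact h v

theorem exists_rot_upper (D : WellFrame W w) : ∃ C > 0, ∀ v : ℝ × ℝ, enorm2 (D.rot v) ≤ C * ‖v‖ := by
  refine ⟨2 * (|D.b₁₁| + |D.b₁₂| + |D.b₂₂| + 1), by positivity, fun v => ?_⟩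
  refine (enorm2_le _).trans ?_
  rw [mul_assoc]
  gcongr
  have h1 : |v.1| ≤ ‖v‖ := norm_fst_le v
  have h2 : |v.2| ≤ ‖v‖ := norm_snd_le v
  rw [Prod.norm_def]
  refine max_le ?_ ?_
  · simp only [rot, norm_neg, Real.norm_eq_abs]
    calc _ ≤ |D.b₁₂ * v.1| + |D.b₂₂ * v.2| := abs_add_le _ _
      _ = |D.b₁₂| * |v.1| + |D.b₂₂| * |v.2| := by rw [abs_mul, abs_mul]
      _ ≤ |D.b₁₂| * ‖v‖ + |D.b₂₂| * ‖v‖ := by gcongr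
      _ ≤ _ := by nlinarith [norm_nonneg v, abs_nonneg D.b₁₁]
  · simp only [rot, Real.norm_eq_abs]
    calc _ ≤ |D.b₁₁ * v.1| + |D.b₁₂ * v.2| := abs_add_le _ _
      _ = |D.b₁₁| * |v.1| + |D.b₁₂| * |v.2| := by rw [abs_mul, abs_mul]
      _ ≤ |D.b₁₁| * ‖v‖ + |D.b₁₂| * ‖v‖ := by gcongr
      _ ≤ _ := by nlinarith [norm_nonneg v, abs_nonneg D.b₂₂]

theorem exists_confFactor_bounds (D : WellFrame W w) : ∃ c > 0, ∃ C > 0, ∃ r > 0, ∀ p, ‖p - w‖ < r →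
    c * ‖p - w‖ ≤ confFactor W p ∧ confFactor W p ≤ C * ‖p - w‖ := by
  obtain ⟨c, hc, hlow⟩ := D.exists_rot_lower
  obtain ⟨C, hC, hup⟩ := D.exists_rot_upper
  obtain ⟨r, hr, h⟩ := D.approx_rot (ε := c / 2) (by positivity)
  refine ⟨c / 2, by positivity, C + c / 2, by positivity, r, hr, fun p hp => ?_⟩
  have h1 := abs_le.1 (h p hp)
  have h2 := hlow (p - w)
  have h3 := hup (p - w)
  constructor <;> nlinarith

end WellFrame

/-- The conformal factor dominates the distance to the wells. -/
theorem TwoWell.exists_confFactor_lower {W : ℝ × ℝ → ℝ} {pm pp : ℝ × ℝ} (hW : TwoWell W pm pp) :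
    ∃ c > 0, ∀ p, c * min 1 (min ‖p - pm‖ ‖p - pp‖) ≤ confFactor W p := by
  obtain ⟨D₁⟩ := hW.nonempty_wellFrame (w := pm) (Or.inl rfl)
  obtain ⟨D₂⟩ := hW.nonempty_wellFrame (w := pp) (Or.inr rfl)
  obtain ⟨c₁, hc₁, _, _, r₁, hr₁, h₁⟩ := D₁.exists_confFactor_bounds
  obtain ⟨c₂, hc₂, _, _, r₂, hr₂, h₂⟩ := D₂.exists_confFactor_bounds
  obtain ⟨c₃, hc₃, R, h₃⟩ := hW.coercive
  have hK : IsCompact (Metric.closedBall (0 : ℝ × ℝ) R ∩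
      {p | r₁ ≤ ‖p - pm‖ ∧ r₂ ≤ ‖p - pp‖}) := by
    refine (isCompact_closedBall _ _).inter_right ?_
    have c1 : IsClosed {p : ℝ × ℝ | r₁ ≤ ‖p - pm‖} := isClosed_le (by fun_prop) (by fun_prop)
    have c2 : IsClosed {p : ℝ × ℝ | r₂ ≤ ‖p - pp‖} := isClosed_le (by fun_prop) (by fun_prop)
    exact c1.inter c2
  obtain ⟨c₄, hc₄, h₄⟩ : ∃ c > 0, ∀ p ∈ Metric.closedBall (0 : ℝ × ℝ) R ∩
      {p | r₁ ≤ ‖p - pm‖ ∧ r₂ ≤ ‖p - pp‖}, c ≤ confFactor W p := by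
    rcases (Metric.closedBall (0 : ℝ × ℝ) R ∩
      {p | r₁ ≤ ‖p - pm‖ ∧ r₂ ≤ ‖p - pp‖}).eq_empty_or_nonempty with he | hne
    · exact ⟨1, one_pos, fun p hp => by rw [he] at hp; exact hp.elim⟩
    · obtain ⟨p₀, hp₀, hmin⟩ := hK.exists_isMinOn hne hW.continuous_confFactor.continuousOn
      refine ⟨confFactor W p₀, hW.confFactor_pos ?_ ?_, fun p hp => hmin hp⟩
      · rintro rfl
        have := hp₀.2.1
        simp at this
        linarith
      · rintro rfl
        have := hp₀.2.2
        simp at this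
        linarith
  refine ⟨min (min c₁ c₂) (min (√c₃) c₄), by positivity, fun p => ?_⟩
  set c := min (min c₁ c₂) (min (√c₃) c₄) with hc
  have hc0 : 0 < c := by positivity
  have e1 : c ≤ c₁ := (min_le_left _ _).trans (min_le_left _ _)
  have e2 : c ≤ c₂ := (min_le_left _ _).trans (min_le_right _ _)
  have e3 : c ≤ √c₃ := (min_le_right _ _).trans (min_le_left _ _)
  have e4 : c ≤ c₄ := (min_le_right _ _).trans (min_le_right _ _)
  by_cases hp1 : ‖p - pm‖ < r₁
  · refine le_trans ?_ (h₁ p hp1).1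
    gcongr
    exact (min_le_right _ _).trans (min_le_left _ _)
  by_cases hp2 : ‖p - pp‖ < r₂
  · refine le_trans ?_ (h₂ p hp2).1
    gcongr
    exact (min_le_right _ _).trans (min_le_right _ _)
  have hm : c * min 1 (min ‖p - pm‖ ‖p - pp‖) ≤ c :=
    mul_le_of_le_one_right hc0.le (min_le_left _ _)
  refine hm.trans ?_
  by_cases hR : R ≤ ‖p‖
  · exact e3.trans (Real.sqrt_le_sqrt (h₃ p hR))
  · refine e4.trans (h₄ p ⟨?_, not_lt.1 hp1, not_lt.1 hp2⟩)
    simpa using (not_le.1 hR).le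

/-- The part `p₁ dp₂ - dφ` of the area form, which vanishes at the wells. -/
def areaForm (pm pp p : ℝ × ℝ) : ℝ × ℝ →L[ℝ] ℝ :=
  p.1 • ContinuousLinearMap.snd ℝ ℝ ℝ - fderiv ℝ (wellPot pm pp) p

theorem areaForm_apply (pm pp p v : ℝ × ℝ) :
    areaForm pm pp p v = p.1 * v.2 - fderiv ℝ (wellPot pm pp) p v := rfl

theorem contDiff_wellPot_two (pm pp : ℝ × ℝ) : ContDiff ℝ 2 (wellPot pm pp) := by
  unfold wellPot wellCoord
  fun_prop

theorem contDiff_areaForm (pm pp : ℝ × ℝ) : ContDiff ℝ 1 (areaForm pm pp) := by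
  have := (contDiff_wellPot_two pm pp).fderiv_right (m := 1) (by norm_num)
  unfold areaForm
  fun_prop

theorem areaForm_well {pm pp w : ℝ × ℝ} (h : pm ≠ pp) (hw : w = pm ∨ w = pp) :
    areaForm pm pp w = 0 := by
  ext
  all_goals
    rcases hw with rfl | rfl
    · simp [areaForm_apply, fderiv_wellPot_left]
    · simp [areaForm_apply, fderiv_wellPot_right _ _ _ h]

theorem TwoWell.exists_norm_areaForm_le {W : ℝ × ℝ → ℝ} {pm pp : ℝ × ℝ} (hW : TwoWell W pm pp)
    (R : ℝ) : ∃ C > 0, ∀ p, ‖p‖ ≤ R → ∀ v, |areaForm pm pp p v| ≤ C * (confFactor W p * enorm2 v) := by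
  obtain ⟨c, hc, hlow⟩ := hW.exists_confFactor_lower
  set R' := max R (max ‖pm‖ ‖pp‖) with hR'
  have hcomp := isCompact_closedBall (0 : ℝ × ℝ) R'
  obtain ⟨K, hK⟩ := LocallyLipschitzOn.exists_lipschitzOnWith_of_compact hcomp
    ((contDiff_areaForm pm pp).locallyLipschitz.locallyLipschitzOn)
  obtain ⟨M, hM⟩ := hcomp.exists_bound_of_continuousOn
    (contDiff_areaForm pm pp).continuous.continuousOn
  have hm : pm ∈ Metric.closedBall (0 : ℝ × ℝ) R' := by simp [hR']
  have hp : pp ∈ Metric.closedBall (0 : ℝ × ℝ) R' := by simp [hR']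
  have hM0 : 0 ≤ M := (norm_nonneg _).trans (hM pm hm)
  refine ⟨(K + M + 1) / c, by positivity, fun p hpR v => ?_⟩
  have hpB : p ∈ Metric.closedBall (0 : ℝ × ℝ) R' := by
    rw [mem_closedBall_zero_iff]
    exact hpR.trans (le_max_left _ _)
  have h1 := hK.dist_le_mul p hpB pm hm
  have h2 := hK.dist_le_mul p hpB pp hp
  rw [areaForm_well hW.wells_ne (Or.inl rfl), dist_zero_right, dist_eq_norm] at h1
  rw [areaForm_well hW.wells_ne (Or.inr rfl), dist_zero_right, dist_eq_norm] at h2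
  have h3 : ‖areaForm pm pp p‖ ≤ (K + M + 1) * min 1 (min ‖p - pm‖ ‖p - pp‖) := by
    rw [mul_min_of_nonneg _ _ (by positivity), mul_min_of_nonneg _ _ (by positivity)]
    refine le_min ?_ (le_min ?_ ?_)
    · have := hM p hpB
      have : (0 : ℝ) ≤ K := K.2
      linarith
    · nlinarith [norm_nonneg (p - pm)]
    · nlinarith [norm_nonneg (p - pp)]
  calc |areaForm pm pp p v| ≤ ‖areaForm pm pp p‖ * ‖v‖ := (areaForm pm pp p).le_opNorm v
    _ ≤ ((K + M + 1) * min 1 (min ‖p - pm‖ ‖p - pp‖)) * enorm2 v := by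
        gcongr
        exact norm_le_enorm2 v
    _ = (K + M + 1) / c * ((c * min 1 (min ‖p - pm‖ ‖p - pp‖)) * enorm2 v) := by
        field_simp
    _ ≤ _ := by
        gcongr
        · exact enorm2_nonneg v
        · exact hlow p

end

noncomputable section

/-! ### Curves of finite degenerate length -/

/-- The degenerate speed `F(γ) |γ'|`. -/
def degSpeed (W : ℝ × ℝ → ℝ) (γ : ℝ → ℝ × ℝ) (t : ℝ) : ℝ :=
  confFactor W (γ t) * enorm2 (deriv γ t)

theorem degSpeed_nonneg (W : ℝ × ℝ → ℝ) (γ : ℝ → ℝ × ℝ) (t : ℝ) : 0 ≤ degSpeed W γ t :=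
  mul_nonneg (confFactor_nonneg _ _) (enorm2_nonneg _)

theorem degLen_eq_lintegral (W : ℝ × ℝ → ℝ) (a b : ℝ) (γ : ℝ → ℝ × ℝ) :
    degLen (confFactor W) a b γ = ∫⁻ t in Icc a b, ENNReal.ofReal (degSpeed W γ t) := rfl

theorem locallyLipschitz_comp_on {u : ℝ × ℝ → ℝ} (hu : LocallyLipschitz u) {γ : ℝ → ℝ × ℝ}
    {S : Set ℝ} (h : LocallyLipschitzOn S γ) : LocallyLipschitzOn S (fun t => u (γ t)) := by
  intro t ht
  obtain ⟨K, s, hs, hK⟩ := h ht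
  obtain ⟨K', s', hs', hK'⟩ := hu (γ t)
  have hc : ContinuousWithinAt γ S t := h.continuousOn t ht
  refine ⟨K' * K, s ∩ γ ⁻¹' s', inter_mem hs (hc hs'), ?_⟩
  exact hK'.comp (hK.mono inter_subset_left) (fun x hx => hx.2)

section

variable {W : ℝ × ℝ → ℝ} {pm pp p q : ℝ × ℝ} {a b : ℝ} {γ : ℝ → ℝ × ℝ}

theorem IsCurve.restrict (h : IsCurve pm pp a b γ p q) {s t : ℝ} (hs : a ≤ s) (hst : s ≤ t)
    (ht : t ≤ b) : IsCurve pm pp s t γ (γ s) (γ t) :=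
  ⟨hst, h.2.1.mono (Icc_subset_Icc hs ht),
    h.2.2.1.mono fun _ hx => ⟨Icc_subset_Icc hs ht hx.1, hx.2⟩, rfl, rfl⟩

theorem aestronglyMeasurable_degSpeed (hW : TwoWell W pm pp) (h : ContinuousOn γ (Icc a b)) :
    AEStronglyMeasurable (degSpeed W γ) (volume.restrict (Icc a b)) := by
  have h1 : AEStronglyMeasurable (fun t => confFactor W (γ t)) (volume.restrict (Icc a b)) :=
    (hW.continuous_confFactor.comp_continuousOn h).aestronglyMeasurable measurableSet_Icc
  have h2 : Measurable fun t => enorm2 (deriv γ t) :=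
    continuous_enorm2.measurable.comp (measurable_deriv γ)
  exact h1.mul h2.aestronglyMeasurable

theorem degLen_eq_ofReal_integral (hab : a ≤ b)
    (hi : IntervalIntegrable (degSpeed W γ) volume a b) :
    degLen (confFactor W) a b γ = ENNReal.ofReal (∫ t in a..b, degSpeed W γ t) := by
  rw [intervalIntegrable_iff_integrableOn_Icc_of_le hab] at hi
  rw [degLen_eq_lintegral, intervalIntegral.integral_of_le hab, ← integral_Icc_eq_integral_Ioc]
  exact (ofReal_integral_eq_lintegral_ofReal hi
    (Eventually.of_forall fun t => degSpeed_nonneg W γ t)).symm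

theorem intervalIntegrable_degSpeed (hW : TwoWell W pm pp) (hab : a ≤ b)
    (h : ContinuousOn γ (Icc a b)) (hE : degLen (confFactor W) a b γ ≠ ⊤) :
    IntervalIntegrable (degSpeed W γ) volume a b := by
  rw [intervalIntegrable_iff_integrableOn_Icc_of_le hab]
  refine ⟨aestronglyMeasurable_degSpeed hW h, ?_⟩
  rw [hasFiniteIntegral_iff_ofReal (Eventually.of_forall fun t => degSpeed_nonneg W γ t)]
  exact lt_top_iff_ne_top.2 hE

theorem IsCurve.ae_differentiableAt (h : IsCurve pm pp a b γ p q) :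
    ∀ᵐ t : ℝ, t ∈ Ioo a b → γ t ≠ pm → γ t ≠ pp → DifferentiableAt ℝ γ t := by
  have hU : IsOpen {t | t ∈ Ioo a b ∧ γ t ≠ pm ∧ γ t ≠ pp} := by
    rw [isOpen_iff_mem_nhds]
    rintro t ⟨ht, h1, h2⟩
    have hc : ContinuousAt γ t := h.2.1.continuousAt (Icc_mem_nhds ht.1 ht.2)
    filter_upwards [hc.eventually_ne h1, hc.eventually_ne h2, isOpen_Ioo.mem_nhds ht]
      with x h1 h2 h3
    exact ⟨h3, h1, h2⟩
  filter_upwards [ae_differentiableAt_of_locallyLipschitzOn hU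
    (h.2.2.1.mono fun t ht => ⟨Ioo_subset_Icc_self ht.1, ht.2⟩)] with t ht h1 h2 h3
  exact ht ⟨h1, h2, h3⟩

theorem IsCurve.abs_sub_le (h : IsCurve pm pp a b γ p q)
    (hi : IntervalIntegrable (degSpeed W γ) volume a b) {u : ℝ × ℝ → ℝ} (hu : ContDiff ℝ 1 u)
    {C : ℝ} (hC0 : 0 ≤ C) (hC : ∀ t ∈ Icc a b, ∀ v,
      |fderiv ℝ u (γ t) v| ≤ C * (confFactor W (γ t) * enorm2 v)) :
    |u (γ b) - u (γ a)| ≤ ∫ t in a..b, C * degSpeed W γ t := by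
  have hsub : {t | t ∈ Icc a b ∧ u (γ t) ≠ u pm ∧ u (γ t) ≠ u pp} ⊆
      {t | t ∈ Icc a b ∧ γ t ≠ pm ∧ γ t ≠ pp} := fun t ht =>
    ⟨ht.1, fun h => ht.2.1 (by rw [h]), fun h => ht.2.2 (by rw [h])⟩
  refine abs_sub_le_integral_of_exceptional_values (f := fun t => u (γ t)) (c₁ := u pm)
    (c₂ := u pp) h.1 (hu.continuous.comp_continuousOn h.2.1)
    (locallyLipschitz_comp_on hu.locallyLipschitz (h.2.2.1.mono hsub)) (hi.const_mul C)
    (fun t => mul_nonneg hC0 (degSpeed_nonneg W γ t)) ?_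
  filter_upwards [h.ae_differentiableAt] with t hd ht h1 h2
  have hd := hd ht (fun h => h1 (by rw [h])) (fun h => h2 (by rw [h]))
  have := ((hu.differentiable one_ne_zero (γ t)).hasFDerivAt.comp_hasDerivAt t
    hd.hasDerivAt).deriv
  have e : deriv (fun t => u (γ t)) t = fderiv ℝ u (γ t) (deriv γ t) := this
  rw [e]
  exact hC t (Ioo_subset_Icc_self ht) _

/-- The fundamental theorem of calculus along a curve of finite degenerate length, for functions
whose differential is controlled by the conformal factor. -/
theorem IsCurve.integral_fderiv (hW : TwoWell W pm pp) (h : IsCurve pm pp a b γ p q)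
    (hi : IntervalIntegrable (degSpeed W γ) volume a b) {u : ℝ × ℝ → ℝ} (hu : ContDiff ℝ 1 u)
    {C : ℝ} (hC0 : 0 ≤ C) (hC : ∀ t ∈ Icc a b, ∀ v,
      |fderiv ℝ u (γ t) v| ≤ C * (confFactor W (γ t) * enorm2 v)) :
    IntervalIntegrable (fun t => fderiv ℝ u (γ t) (deriv γ t)) volume a b ∧
      ∫ t in a..b, fderiv ℝ u (γ t) (deriv γ t) = u (γ b) - u (γ a) := by
  have hab := h.1
  have hu' : uIcc a b = Icc a b := uIcc_of_le hab
  have hle : ∀ s t, a ≤ s → s ≤ t → t ≤ b →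
      |u (γ t) - u (γ s)| ≤ ∫ x in s..t, C * degSpeed W γ x := by
    intro s t hs hst ht
    refine (h.restrict hs hst ht).abs_sub_le (hi.mono_set ?_) hu hC0
      (fun x hx => hC x (Icc_subset_Icc hs ht hx))
    rw [hu', uIcc_of_le hst]
    exact Icc_subset_Icc hs ht
  have hac := AbsolutelyContinuousOnInterval.of_abs_sub_le (f := fun t => u (γ t)) hab
    (hi.const_mul C) hle
  have hae : ∀ᵐ t : ℝ, t ∈ uIoc a b →
      deriv (fun t => u (γ t)) t = fderiv ℝ u (γ t) (deriv γ t) := by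
    filter_upwards [h.ae_differentiableAt,
      ae_abs_deriv_le_of_abs_sub_le (f := fun t => u (γ t)) hab (hi.const_mul C) hle,
      Measure.ae_ne volume b] with t h1 h2 h3 ht
    rw [uIoc_of_le hab] at ht
    have ht' : t ∈ Ioo a b := ⟨ht.1, lt_of_le_of_ne ht.2 h3⟩
    by_cases hw : γ t = pm ∨ γ t = pp
    · have hF : confFactor W (γ t) = 0 := (hW.confFactor_eq_zero_iff _).2 hw
      have e1 := (h2 ht').2
      have e2 := hC t (Ioo_subset_Icc_self ht') (deriv γ t)
      rw [degSpeed, hF] at e1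
      rw [hF] at e2
      simp only [zero_mul, mul_zero, abs_zero] at e1 e2
      rw [abs_nonpos_iff.1 e1, abs_nonpos_iff.1 e2]
    · push Not at hw
      have hd := h1 ht' hw.1 hw.2
      exact ((hu.differentiable one_ne_zero (γ t)).hasFDerivAt.comp_hasDerivAt t
        hd.hasDerivAt).deriv
  refine ⟨hac.intervalIntegrable_deriv.congr_ae ((ae_restrict_iff' measurableSet_uIoc).2 hae), ?_⟩
  rw [← intervalIntegral.integral_congr_ae hae, hac.integral_deriv_eq_sub]

theorem hasArea_iff (A : ℝ) : HasArea pm pp a b γ A ↔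
    IntervalIntegrable (fun t => areaForm pm pp (γ t) (deriv γ t)) volume a b ∧
      A = wellPot pm pp (γ b) - wellPot pm pp (γ a) +
        ∫ t in a..b, areaForm pm pp (γ t) (deriv γ t) := Iff.rfl

/-! ### Operations on curves -/

theorem intervalIntegral_congr_Ioo {E : Type*} [NormedAddCommGroup E] [NormedSpace ℝ E]
    {f g : ℝ → E} (hab : a ≤ b) (hfg : ∀ t ∈ Ioo a b, f t = g t) :
    ∫ t in a..b, f t = ∫ t in a..b, g t := by
  refine intervalIntegral.integral_congr_ae ?_
  filter_upwards [Measure.ae_ne volume b] with t h3 ht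
  rw [uIoc_of_le hab] at ht
  exact hfg t ⟨ht.1, lt_of_le_of_ne ht.2 h3⟩

theorem intervalIntegrable_congr_Ioo {E : Type*} [NormedAddCommGroup E]
    {f g : ℝ → E} (hab : a ≤ b) (hf : IntervalIntegrable f volume a b)
    (hfg : ∀ t ∈ Ioo a b, f t = g t) : IntervalIntegrable g volume a b := by
  refine hf.congr_ae ((ae_restrict_iff' measurableSet_uIoc).2 ?_)
  filter_upwards [Measure.ae_ne volume b] with t h3 ht
  rw [uIoc_of_le hab] at ht
  exact hfg t ⟨ht.1, lt_of_le_of_ne ht.2 h3⟩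

theorem deriv_eq_of_eqOn_Ioo {γ' : ℝ → ℝ × ℝ} (h : ∀ t ∈ Ioo a b, γ t = γ' t) :
    ∀ t ∈ Ioo a b, deriv γ t = deriv γ' t := fun t ht => by
  apply Filter.EventuallyEq.deriv_eq
  filter_upwards [isOpen_Ioo.mem_nhds ht] with s hs
  exact h s hs

theorem HasArea.congr {γ' : ℝ → ℝ × ℝ} {A : ℝ} (hab : a ≤ b) (hA : HasArea pm pp a b γ A)
    (h : ∀ t ∈ Icc a b, γ t = γ' t) : HasArea pm pp a b γ' A := by
  have hd := deriv_eq_of_eqOn_Ioo fun t ht => h t (Ioo_subset_Icc_self ht)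
  have he : ∀ t ∈ Ioo a b, areaForm pm pp (γ t) (deriv γ t) = areaForm pm pp (γ' t) (deriv γ' t) :=
    fun t ht => by rw [hd t ht, h t (Ioo_subset_Icc_self ht)]
  rw [hasArea_iff] at hA ⊢
  refine ⟨intervalIntegrable_congr_Ioo hab hA.1 he, ?_⟩
  rw [← intervalIntegral_congr_Ioo hab he, ← h a (left_mem_Icc.2 hab), ← h b (right_mem_Icc.2 hab)]
  exact hA.2

theorem degLen_congr {γ' : ℝ → ℝ × ℝ} (h : ∀ t ∈ Icc a b, γ t = γ' t) :
    degLen (confFactor W) a b γ = degLen (confFactor W) a b γ' := by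
  have hd := deriv_eq_of_eqOn_Ioo fun t ht => h t (Ioo_subset_Icc_self ht)
  rw [degLen_eq_lintegral, degLen_eq_lintegral, ← Measure.restrict_congr_set Ioo_ae_eq_Icc]
  refine setLIntegral_congr_fun measurableSet_Ioo fun t ht => ?_
  simp only [degSpeed]
  rw [hd t ht, h t (Ioo_subset_Icc_self ht)]

theorem IsCurve.congr {γ' : ℝ → ℝ × ℝ} (hγ : IsCurve pm pp a b γ p q)
    (h : ∀ t ∈ Icc a b, γ t = γ' t) : IsCurve pm pp a b γ' p q := by
  obtain ⟨h1, h2, h3, h4, h5⟩ := hγ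
  refine ⟨h1, h2.congr fun t ht => (h t ht).symm, ?_, ?_, ?_⟩
  · have hs : {t | t ∈ Icc a b ∧ γ' t ≠ pm ∧ γ' t ≠ pp} =
        {t | t ∈ Icc a b ∧ γ t ≠ pm ∧ γ t ≠ pp} := by
      ext t
      constructor
      · rintro ⟨ht, e⟩
        exact ⟨ht, by rwa [h t ht]⟩
      · rintro ⟨ht, e⟩
        exact ⟨ht, by rwa [← h t ht]⟩
    rw [hs]
    intro x hx
    obtain ⟨K, s, hs, hK⟩ := h3 hx
    refine ⟨K, s ∩ {t | t ∈ Icc a b ∧ γ t ≠ pm ∧ γ t ≠ pp}, inter_mem hs self_mem_nhdsWithin, ?_⟩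
    intro y hy z hz
    rw [← h y hy.2.1, ← h z hz.2.1]
    exact hK hy.1 hz.1
  · rw [← h a (left_mem_Icc.2 h1), h4]
  · rw [← h b (right_mem_Icc.2 h1), h5]

theorem degLen_add (γ : ℝ → ℝ × ℝ) {a b c : ℝ} (hab : a ≤ b) (hbc : b ≤ c) :
    degLen (confFactor W) a c γ = degLen (confFactor W) a b γ + degLen (confFactor W) b c γ := by
  simp only [degLen_eq_lintegral]
  rw [← Icc_union_Ioc_eq_Icc hab hbc, lintegral_union measurableSet_Ioc,
    Measure.restrict_congr_set (Ioc_ae_eq_Icc (a := b) (b := c))]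
  exact disjoint_left.2 fun x hx hx' => absurd hx.2 (not_le.2 hx'.1)

theorem HasArea.add {a b c A B : ℝ} (h1 : HasArea pm pp a b γ A) (h2 : HasArea pm pp b c γ B) :
    HasArea pm pp a c γ (A + B) := by
  rw [hasArea_iff] at *
  refine ⟨h1.1.trans h2.1, ?_⟩
  rw [← intervalIntegral.integral_add_adjacent_intervals h1.1 h2.1, h1.2, h2.2]
  ring

theorem IsCurve.glue {m : ℝ × ℝ} {c : ℝ} (h1 : IsCurve pm pp a b γ p m)
    (h2 : IsCurve pm pp b c γ m q) : IsCurve pm pp a c γ p q := by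
  obtain ⟨hab, hc1, hl1, ha, hb⟩ := h1
  obtain ⟨hbc, hc2, hl2, -, hc⟩ := h2
  have hun : Icc a b ∪ Icc b c = Icc a c := Icc_union_Icc_eq_Icc hab hbc
  refine ⟨hab.trans hbc, ?_, ?_, ha, hc⟩
  · rw [← hun]
    exact hc1.union_of_isClosed hc2 isClosed_Icc isClosed_Icc
  rintro t ⟨ht, hw⟩
  rcases lt_trichotomy t b with htb | rfl | htb
  · obtain ⟨K, s, hs, hK⟩ := hl1 (x := t) ⟨⟨ht.1, htb.le⟩, hw⟩
    refine ⟨K, s, nhdsWithin_le_of_mem ?_ hs, hK⟩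
    filter_upwards [self_mem_nhdsWithin, mem_nhdsWithin_of_mem_nhds (Iio_mem_nhds htb)] with x h1 h2
    exact ⟨⟨h1.1.1, (mem_Iio.1 h2).le⟩, h1.2⟩
  · obtain ⟨K₁, s₁, hs₁, hK₁⟩ := hl1 (x := t) ⟨⟨hab, le_rfl⟩, hw⟩
    obtain ⟨K₂, s₂, hs₂, hK₂⟩ := hl2 (x := t) ⟨⟨le_rfl, hbc⟩, hw⟩
    have m₁ : t ∈ s₁ := mem_of_mem_nhdsWithin (by exact ⟨⟨hab, le_rfl⟩, hw⟩) hs₁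
    have m₂ : t ∈ s₂ := mem_of_mem_nhdsWithin (by exact ⟨⟨le_rfl, hbc⟩, hw⟩) hs₂
    refine ⟨K₁ + K₂, (s₁ ∩ Iic t) ∪ (s₂ ∩ Ici t), ?_, ?_⟩
    · rw [mem_nhdsWithin] at hs₁ hs₂ ⊢
      obtain ⟨u₁, ho₁, hm₁, hsub₁⟩ := hs₁
      obtain ⟨u₂, ho₂, hm₂, hsub₂⟩ := hs₂
      refine ⟨u₁ ∩ u₂, ho₁.inter ho₂, ⟨hm₁, hm₂⟩, ?_⟩
      rintro x ⟨⟨hx1, hx2⟩, hx3, hx4⟩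
      rcases le_total x t with hxt | hxt
      · exact Or.inl ⟨hsub₁ ⟨hx1, ⟨hx3.1, hxt⟩, hx4⟩, hxt⟩
      · exact Or.inr ⟨hsub₂ ⟨hx2, ⟨hxt, hx3.2⟩, hx4⟩, hxt⟩
    · refine LipschitzOnWith.of_dist_le_mul ?_
      have key : ∀ x ∈ s₁ ∩ Iic t, ∀ y ∈ s₂ ∩ Ici t,
          dist (γ x) (γ y) ≤ (K₁ + K₂ : ℝ) * dist x y := by
        rintro x ⟨hx, hxt⟩ y ⟨hy, hyt⟩
        rw [mem_Iic] at hxt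
        rw [mem_Ici] at hyt
        have e1 := hK₁.dist_le_mul x hx t m₁
        have e2 := hK₂.dist_le_mul t m₂ y hy
        have e3 := dist_triangle (γ x) (γ t) (γ y)
        rw [Real.dist_eq, abs_of_nonpos (by linarith)] at e1 e2 ⊢
        have := K₁.2
        have := K₂.2
        nlinarith [mul_nonneg K₁.2 (sub_nonneg.2 hyt), mul_nonneg K₂.2 (sub_nonneg.2 hxt)]
      have hK₁0 : (0 : ℝ) ≤ K₁ := K₁.2
      have hK₂0 : (0 : ℝ) ≤ K₂ := K₂.2
      rintro x (hx | hx) y (hy | hy)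
      · refine (hK₁.dist_le_mul x hx.1 y hy.1).trans ?_
        push_cast
        nlinarith [dist_nonneg (x := x) (y := y)]
      · simpa using key x hx y hy
      · rw [dist_comm, dist_comm x]
        simpa using key y hy x hx
      · refine (hK₂.dist_le_mul x hx.1 y hy.1).trans ?_
        push_cast
        nlinarith [dist_nonneg (x := x) (y := y)]
  · obtain ⟨K, s, hs, hK⟩ := hl2 (x := t) ⟨⟨htb.le, ht.2⟩, hw⟩
    refine ⟨K, s, nhdsWithin_le_of_mem ?_ hs, hK⟩
    filter_upwards [self_mem_nhdsWithin, mem_nhdsWithin_of_mem_nhds (Ioi_mem_nhds htb)] with x h1 h2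
    exact ⟨⟨(mem_Ioi.1 h2).le, h1.1.2⟩, h1.2⟩

theorem locallyLipschitzOn_comp_isometry {S : Set ℝ} (hl : LocallyLipschitzOn S γ) {e : ℝ → ℝ}
    (he : LipschitzWith 1 e) : LocallyLipschitzOn (e ⁻¹' S) (fun t => γ (e t)) := by
  intro t ht
  obtain ⟨K, s, hs, hK⟩ := hl ht
  refine ⟨K * 1, e ⁻¹' s, ?_, hK.comp (he.lipschitzOnWith) (fun x hx => hx)⟩
  exact (he.continuous.continuousWithinAt.tendsto_nhdsWithin fun x hx => hx) hs

theorem IsCurve.shift (h : IsCurve pm pp a b γ p q) (c : ℝ) :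
    IsCurve pm pp (a - c) (b - c) (fun t => γ (t + c)) p q := by
  obtain ⟨hab, hc, hl, ha, hb⟩ := h
  have he : LipschitzWith 1 (fun t : ℝ => t + c) := by
    refine LipschitzWith.of_dist_le_mul fun x y => ?_
    simp
  have hpre : (fun t : ℝ => t + c) ⁻¹' Icc a b = Icc (a - c) (b - c) := by
    ext; simp [le_sub_iff_add_le]
  refine ⟨by linarith, ?_, ?_, by simpa using ha, by simpa using hb⟩
  · exact hc.comp he.continuous.continuousOn (by rw [← hpre]; exact mapsTo_preimage _ _)
  · refine (locallyLipschitzOn_comp_isometry hl he).mono fun t ht => ⟨?_, ht.2⟩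
    have := ht.1
    rwa [← hpre] at this

theorem HasArea.shift {A : ℝ} (h : HasArea pm pp a b γ A) (c : ℝ) :
    HasArea pm pp (a - c) (b - c) (fun t => γ (t + c)) A := by
  rw [hasArea_iff] at *
  have hd : ∀ t, deriv (fun t => γ (t + c)) t = deriv γ (t + c) := fun t =>
    deriv_comp_add_const γ c t
  simp only [hd, sub_add_cancel]
  refine ⟨h.1.comp_add_right c, ?_⟩
  rw [intervalIntegral.integral_comp_add_right
    (fun t => areaForm pm pp (γ t) (deriv γ t)) c]
  simpa using h.2

theorem degLen_shift (c : ℝ) :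
    degLen (confFactor W) (a - c) (b - c) (fun t => γ (t + c)) = degLen (confFactor W) a b γ := by
  have hd : ∀ t, deriv (fun t => γ (t + c)) t = deriv γ (t + c) := fun t =>
    deriv_comp_add_const γ c t
  have hpre : (fun t : ℝ => t + c) ⁻¹' Icc a b = Icc (a - c) (b - c) := by
    ext; simp [le_sub_iff_add_le]
  simp only [degLen_eq_lintegral, degSpeed, hd]
  rw [← hpre]
  exact (measurePreserving_add_right volume c).setLIntegral_comp_preimage_emb
    (measurableEmbedding_addRight c) (fun t => ENNReal.ofReal (degSpeed W γ t)) _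

theorem IsCurve.reverse (h : IsCurve pm pp a b γ p q) :
    IsCurve pm pp (-b) (-a) (fun t => γ (-t)) q p := by
  obtain ⟨hab, hc, hl, ha, hb⟩ := h
  have he : LipschitzWith 1 (fun t : ℝ => -t) := by
    refine LipschitzWith.of_dist_le_mul fun x y => ?_
    simp
  have hpre : (fun t : ℝ => -t) ⁻¹' Icc a b = Icc (-b) (-a) := by
    ext; simp [and_comm]
  refine ⟨by linarith, ?_, ?_, by simpa using hb, by simpa using ha⟩
  · exact hc.comp he.continuous.continuousOn (by rw [← hpre]; exact mapsTo_preimage _ _)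
  · refine (locallyLipschitzOn_comp_isometry hl he).mono fun t ht => ⟨?_, ht.2⟩
    have := ht.1
    rwa [← hpre] at this

theorem HasArea.reverse {A : ℝ} (h : HasArea pm pp a b γ A) :
    HasArea pm pp (-b) (-a) (fun t => γ (-t)) (-A) := by
  rw [hasArea_iff] at *
  have hd : ∀ t, deriv (fun t => γ (-t)) t = -deriv γ (-t) := fun t => deriv_comp_neg γ t
  simp only [hd, neg_neg, map_neg, intervalIntegral.integral_neg]
  refine ⟨?_, ?_⟩
  · have := (h.1.comp_sub_left 0).symm
    simp only [zero_sub] at this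
    exact this.neg
  rw [intervalIntegral.integral_comp_neg (fun t => areaForm pm pp (γ t) (deriv γ t)), h.2]
  simp only [neg_neg]
  ring

theorem degLen_reverse :
    degLen (confFactor W) (-b) (-a) (fun t => γ (-t)) = degLen (confFactor W) a b γ := by
  have hd : ∀ t, deriv (fun t => γ (-t)) t = -deriv γ (-t) := fun t => deriv_comp_neg γ t
  have hpre : (fun t : ℝ => -t) ⁻¹' Icc a b = Icc (-b) (-a) := by
    ext; simp [and_comm]
  simp only [degLen_eq_lintegral, degSpeed, hd, enorm2_neg]
  rw [← hpre]
  exact (Measure.measurePreserving_neg volume).setLIntegral_comp_preimage_emb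
    (MeasurableEquiv.neg ℝ).measurableEmbedding (fun t => ENNReal.ofReal (degSpeed W γ t)) _

theorem exists_concat {m : ℝ × ℝ} {γ₁ γ₂ : ℝ → ℝ × ℝ} {a₁ b₁ a₂ b₂ A₁ A₂ : ℝ}
    (h₁ : IsCurve pm pp a₁ b₁ γ₁ p m) (h₂ : IsCurve pm pp a₂ b₂ γ₂ m q)
    (hA₁ : HasArea pm pp a₁ b₁ γ₁ A₁) (hA₂ : HasArea pm pp a₂ b₂ γ₂ A₂) :
    ∃ a b γ, IsCurve pm pp a b γ p q ∧ HasArea pm pp a b γ (A₁ + A₂) ∧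
      degLen (confFactor W) a b γ =
        degLen (confFactor W) a₁ b₁ γ₁ + degLen (confFactor W) a₂ b₂ γ₂ := by
  set c := a₂ - b₁ with hc
  have h₂' := h₂.shift c
  have hA₂' := hA₂.shift c
  have hE₂ := degLen_shift (W := W) (a := a₂) (b := b₂) (γ := γ₂) c
  have ha : a₂ - c = b₁ := by rw [hc]; ring
  rw [ha] at h₂' hA₂' hE₂
  set γ : ℝ → ℝ × ℝ := fun t => if t ≤ b₁ then γ₁ t else γ₂ (t + c) with hγ
  have e1 : ∀ t ∈ Icc a₁ b₁, γ₁ t = γ t := fun t ht => by simp [hγ, ht.2]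
  have e2 : ∀ t ∈ Icc b₁ (b₂ - c), (fun t => γ₂ (t + c)) t = γ t := by
    intro t ht
    rcases ht.1.eq_or_lt with rfl | hlt
    · have := h₂'.2.2.2.1
      simp only [hγ, le_refl, if_true]
      rw [h₁.2.2.2.2]
      exact this
    · simp [hγ, not_le.2 hlt]
  refine ⟨a₁, b₂ - c, γ, (h₁.congr e1).glue (h₂'.congr e2),
    (hA₁.congr h₁.1 e1).add (hA₂'.congr h₂'.1 e2), ?_⟩
  rw [degLen_add γ h₁.1 h₂'.1, ← degLen_congr e1, ← degLen_congr e2, hE₂]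

end

end

noncomputable section

/-! ### The distance `d_F` -/

section

variable {W : ℝ × ℝ → ℝ} {pm pp p q : ℝ × ℝ} {a b : ℝ} {γ : ℝ → ℝ × ℝ}

theorem dCC_le_degLen {P Q : ℝ × ℝ × ℝ} (h : IsCurve pm pp a b γ (proj P) (proj Q))
    (hA : HasArea pm pp a b γ (Q.2.2 - P.2.2)) :
    dCC (confFactor W) pm pp P Q ≤ degLen (confFactor W) a b γ :=
  sInf_le ⟨a, b, γ, h, hA, rfl⟩

theorem exists_curve_of_dCC_lt {P Q : ℝ × ℝ × ℝ} {x : ℝ≥0∞}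
    (h : dCC (confFactor W) pm pp P Q < x) : ∃ a b γ, IsCurve pm pp a b γ (proj P) (proj Q) ∧
      HasArea pm pp a b γ (Q.2.2 - P.2.2) ∧ degLen (confFactor W) a b γ < x := by
  obtain ⟨y, ⟨a, b, γ, h1, h2, rfl⟩, hy⟩ := sInf_lt_iff.1 h
  exact ⟨a, b, γ, h1, h2, hy⟩

theorem dCC_triangle (P Q R : ℝ × ℝ × ℝ) : dCC (confFactor W) pm pp P R ≤
    dCC (confFactor W) pm pp P Q + dCC (confFactor W) pm pp Q R := by
  refine ENNReal.le_of_forall_pos_le_add fun ε hε hlt => ?_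
  have hlt' := ENNReal.add_lt_top.1 hlt
  have hε' : (0 : ℝ≥0∞) < ε / 2 := ENNReal.half_pos (by exact_mod_cast hε.ne')
  obtain ⟨a₁, b₁, γ₁, h₁, hA₁, hE₁⟩ := exists_curve_of_dCC_lt
    (ENNReal.lt_add_right hlt'.1.ne hε'.ne')
  obtain ⟨a₂, b₂, γ₂, h₂, hA₂, hE₂⟩ := exists_curve_of_dCC_lt
    (ENNReal.lt_add_right hlt'.2.ne hε'.ne')
  obtain ⟨a, b, γ, h, hA, hE⟩ := exists_concat (W := W) h₁ h₂ hA₁ hA₂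
  refine (dCC_le_degLen h (by convert hA using 1; ring)).trans ?_
  rw [hE]
  calc _ ≤ (dCC (confFactor W) pm pp P Q + ε / 2) + (dCC (confFactor W) pm pp Q R + ε / 2) :=
        add_le_add hE₁.le hE₂.le
    _ = dCC (confFactor W) pm pp P Q + dCC (confFactor W) pm pp Q R + (ε / 2 + ε / 2) := by
        ring
    _ = _ := by rw [ENNReal.add_halves]

theorem dCC_comm_le (P Q : ℝ × ℝ × ℝ) :
    dCC (confFactor W) pm pp P Q ≤ dCC (confFactor W) pm pp Q P := by
  refine le_of_forall_gt fun x hx => ?_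
  obtain ⟨a, b, γ, h, hA, hE⟩ := exists_curve_of_dCC_lt hx
  refine (dCC_le_degLen h.reverse (by convert hA.reverse using 1; ring)).trans_lt ?_
  rwa [degLen_reverse]

theorem dCC_comm (P Q : ℝ × ℝ × ℝ) :
    dCC (confFactor W) pm pp P Q = dCC (confFactor W) pm pp Q P :=
  le_antisymm (dCC_comm_le P Q) (dCC_comm_le Q P)

theorem dCC_eq_of_proj_eq {P Q P' Q' : ℝ × ℝ × ℝ} (hP : proj P = proj P') (hQ : proj Q = proj Q')
    (h : Q.2.2 - P.2.2 = Q'.2.2 - P'.2.2) :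
    dCC (confFactor W) pm pp P Q = dCC (confFactor W) pm pp P' Q' := by
  unfold dCC
  rw [hP, hQ, h]

theorem IsCurve.of_lipschitzOnWith (hab : a ≤ b) {K : ℝ≥0} (h : LipschitzOnWith K γ (Icc a b)) :
    IsCurve pm pp a b γ (γ a) (γ b) := by
  refine ⟨hab, h.continuousOn, ?_, rfl, rfl⟩
  intro t ht
  exact ⟨K, _, self_mem_nhdsWithin, h.mono fun x hx => hx.1⟩

theorem degLen_le_of_degSpeed_le {M : ℝ} (hab : a ≤ b) (h : ∀ t ∈ Ioo a b, degSpeed W γ t ≤ M) :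
    degLen (confFactor W) a b γ ≤ ENNReal.ofReal (M * (b - a)) := by
  rw [degLen_eq_lintegral, ← Measure.restrict_congr_set Ioo_ae_eq_Icc]
  calc _ ≤ ∫⁻ _ in Ioo a b, ENNReal.ofReal M :=
        setLIntegral_mono' measurableSet_Ioo fun t ht => ENNReal.ofReal_le_ofReal (h t ht)
    _ = ENNReal.ofReal M * ENNReal.ofReal (b - a) := by
        rw [setLIntegral_const, Real.volume_Ioo]
    _ = _ := (ENNReal.ofReal_mul' (by linarith)).symm

/-- A straight segment. -/
theorem dCC_segment_le {c : ℝ × ℝ} {N M : ℝ} (hM : ∀ x, ‖x - c‖ ≤ N → confFactor W x ≤ M)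
    {p q : ℝ × ℝ} (hp : ‖p - c‖ ≤ N) (hq : ‖q - c‖ ≤ N) (z : ℝ) :
    dCC (confFactor W) pm pp (p.1, p.2, z) (q.1, q.2, z + (p.1 + q.1) / 2 * (q.2 - p.2)) ≤
      ENNReal.ofReal (M * enorm2 (q - p)) := by
  set γ : ℝ → ℝ × ℝ := fun t => p + t • (q - p) with hγ
  have hd : ∀ t, HasDerivAt γ (q - p) t := fun t => by
    have := ((hasDerivAt_id t).smul_const (q - p)).const_add p
    rw [one_smul] at this
    exact this
  have hLip : LipschitzWith ‖q - p‖₊ γ := by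
    refine LipschitzWith.of_dist_le_mul fun x y => ?_
    simp only [hγ, dist_add_left, coe_nnnorm]
    rw [dist_eq_norm, ← sub_smul, norm_smul, Real.dist_eq, Real.norm_eq_abs, mul_comm]
  have hcur := IsCurve.of_lipschitzOnWith (pm := pm) (pp := pp) (γ := γ) zero_le_one
    hLip.lipschitzOnWith
  have h0 : γ 0 = p := by simp [hγ]
  have h1 : γ 1 = q := by simp [hγ]
  rw [h0, h1] at hcur
  have hA : HasArea pm pp 0 1 γ ((p.1 + q.1) / 2 * (q.2 - p.2)) := by
    rw [hasArea_iff_of_lipschitz pm pp zero_le_one hLip.lipschitzOnWith]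
    have e : ∀ t, (γ t).1 * deriv (fun s => (γ s).2) t = (p.1 + t * (q.1 - p.1)) * (q.2 - p.2) := by
      intro t
      have h2 : HasDerivAt (fun s => (γ s).2) (q - p).2 t :=
        (ContinuousLinearMap.snd ℝ ℝ ℝ).hasFDerivAt.comp_hasDerivAt t (hd t)
      rw [h2.deriv]
      simp [hγ]
    simp_rw [e]
    have hc : Continuous fun t : ℝ => t * (q.1 - p.1) := by fun_prop
    rw [intervalIntegral.integral_mul_const, intervalIntegral.integral_add (by simp)
      (hc.intervalIntegrable _ _), intervalIntegral.integral_mul_const,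
      intervalIntegral.integral_const, integral_id, smul_eq_mul]
    ring
  refine (dCC_le_degLen (a := 0) (b := 1) (γ := γ) hcur (by convert hA using 1; simp)).trans ?_
  refine (degLen_le_of_degSpeed_le (M := M * enorm2 (q - p)) zero_le_one fun t ht => ?_).trans
    (by simp)
  rw [degSpeed, (hd t).deriv]
  have hmem : γ t ∈ Metric.closedBall c N := by
    refine (convex_closedBall c N).add_smul_mem ?_ ?_ ⟨ht.1.le, ht.2.le⟩
    · simpa [dist_eq_norm] using hp
    · simpa [dist_eq_norm] using hq
  have := hM (γ t) (by simpa [dist_eq_norm] using hmem)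
  exact mul_le_mul_of_nonneg_right this (enorm2_nonneg _)

theorem dCC_le_of_bound {P Q : ℝ × ℝ × ℝ} {M N : ℝ}
    (hN : N = |Q.1 - P.1| + |Q.2.1 - P.2.1| + 2 * √|Q.2.2 - P.2.2 - Q.1 * (Q.2.1 - P.2.1)|)
    (hM : ∀ x, ‖x - proj P‖ ≤ N → confFactor W x ≤ M) :
    dCC (confFactor W) pm pp P Q ≤ ENNReal.ofReal (2 * M * N) := by
  obtain ⟨x₀, y₀, z₀⟩ := P
  obtain ⟨x₁, y₁, z₁⟩ := Q
  simp only [proj] at hN hM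
  set B := z₁ - z₀ - x₁ * (y₁ - y₀) with hB
  obtain ⟨s, k, hsk, hs, hk⟩ : ∃ s k : ℝ, s * k = B ∧ |s| = √|B| ∧ |k| = √|B| := by
    have h0 : √|B| * √|B| = |B| := Real.mul_self_sqrt (abs_nonneg B)
    rcases le_total 0 B with h | h
    · refine ⟨√|B|, √|B|, ?_, abs_of_nonneg (Real.sqrt_nonneg _), abs_of_nonneg (Real.sqrt_nonneg _)⟩
      rw [h0, abs_of_nonneg h]
    · refine ⟨-√|B|, √|B|, ?_, by rw [abs_neg, abs_of_nonneg (Real.sqrt_nonneg _)],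
        abs_of_nonneg (Real.sqrt_nonneg _)⟩
      rw [neg_mul, h0, abs_of_nonpos h, neg_neg]
  have hx := abs_nonneg (x₁ - x₀)
  have hy := abs_nonneg (y₁ - y₀)
  have hr := Real.sqrt_nonneg |B|
  have hM0 : 0 ≤ M := (confFactor_nonneg W (x₀, y₀)).trans (hM _ (by
    simp only [sub_self, norm_zero]; rw [hN]; positivity))
  have hball : ∀ u v : ℝ, |u - x₀| ≤ N → |v - y₀| ≤ N → ‖((u, v) : ℝ × ℝ) - (x₀, y₀)‖ ≤ N := by
    intro u v hu hv
    rw [Prod.norm_def]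
    exact max_le hu hv
  have b0 : ‖((x₀, y₀) : ℝ × ℝ) - (x₀, y₀)‖ ≤ N := by
    simp only [sub_self, norm_zero]; rw [hN]; positivity
  have hX : |x₁ + s - x₀| ≤ |x₁ - x₀| + |s| := by
    rw [show x₁ + s - x₀ = (x₁ - x₀) + s by ring]; exact abs_add_le _ _
  have b1 : ‖((x₁ + s, y₀) : ℝ × ℝ) - (x₀, y₀)‖ ≤ N :=
    hball _ _ (by linarith) (by simp only [sub_self, abs_zero]; rw [hN]; positivity)
  have b2 : ‖((x₁ + s, y₀ + k) : ℝ × ℝ) - (x₀, y₀)‖ ≤ N :=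
    hball _ _ (by linarith) (by rw [add_sub_cancel_left]; linarith)
  have b3 : ‖((x₁, y₀ + k) : ℝ × ℝ) - (x₀, y₀)‖ ≤ N :=
    hball _ _ (by linarith) (by rw [add_sub_cancel_left]; linarith)
  have b4 : ‖((x₁, y₁) : ℝ × ℝ) - (x₀, y₀)‖ ≤ N :=
    hball _ _ (by linarith) (by linarith)
  have s1 := dCC_segment_le (pm := pm) (pp := pp) hM b0 b1 z₀
  have s2 := dCC_segment_le (pm := pm) (pp := pp) hM b1 b2 z₀
  have s3 := dCC_segment_le (pm := pm) (pp := pp) hM b2 b3 (z₀ + (x₁ + s) * k)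
  have s4 := dCC_segment_le (pm := pm) (pp := pp) hM b3 b4 (z₀ + (x₁ + s) * k)
  have hlen1 : ∀ u : ℝ, enorm2 (u, 0) = |u| := fun u => by simp [enorm2, Real.sqrt_sq_eq_abs]
  have hlen2 : ∀ u : ℝ, enorm2 (0, u) = |u| := fun u => by simp [enorm2, Real.sqrt_sq_eq_abs]
  simp only [Prod.mk_sub_mk, sub_self, add_sub_cancel_left, hlen1, hlen2, mul_zero, add_zero] at s1 s2 s3 s4
  have e2 : z₀ + (x₁ + s + (x₁ + s)) / 2 * k = z₀ + (x₁ + s) * k := by ring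
  have e4 : z₀ + (x₁ + s) * k + (x₁ + x₁) / 2 * (y₁ - (y₀ + k)) = z₁ := by
    linear_combination hsk + hB
  have e3 : |x₁ - (x₁ + s)| = |s| := by rw [sub_add_cancel_left, abs_neg]
  have e5 : |y₁ - (y₀ + k)| ≤ |y₁ - y₀| + |k| := by
    rw [show y₁ - (y₀ + k) = (y₁ - y₀) - k by ring]; exact abs_sub _ _
  rw [e2] at s2
  rw [e3] at s3
  rw [e4] at s4
  calc _ ≤ dCC (confFactor W) pm pp (x₀, y₀, z₀) (x₁ + s, y₀, z₀) +
        (dCC (confFactor W) pm pp (x₁ + s, y₀, z₀) (x₁ + s, y₀ + k, z₀ + (x₁ + s) * k) +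
        (dCC (confFactor W) pm pp (x₁ + s, y₀ + k, z₀ + (x₁ + s) * k)
            (x₁, y₀ + k, z₀ + (x₁ + s) * k) +
        dCC (confFactor W) pm pp (x₁, y₀ + k, z₀ + (x₁ + s) * k) (x₁, y₁, z₁))) :=
        (dCC_triangle _ _ _).trans (add_le_add le_rfl ((dCC_triangle _ _ _).trans
          (add_le_add le_rfl (dCC_triangle _ _ _))))
    _ ≤ ENNReal.ofReal (M * |x₁ + s - x₀|) + (ENNReal.ofReal (M * |k|) +
          (ENNReal.ofReal (M * |s|) + ENNReal.ofReal (M * |y₁ - (y₀ + k)|))) :=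
        add_le_add s1 (add_le_add s2 (add_le_add s3 s4))
    _ = ENNReal.ofReal (M * |x₁ + s - x₀| + (M * |k| + (M * |s| + M * |y₁ - (y₀ + k)|))) := by
        rw [ENNReal.ofReal_add (by positivity) (by positivity),
          ENNReal.ofReal_add (by positivity) (by positivity),
          ENNReal.ofReal_add (by positivity) (by positivity)]
    _ ≤ _ := by
        apply ENNReal.ofReal_le_ofReal
        have : |x₁ + s - x₀| + (|k| + (|s| + |y₁ - (y₀ + k)|)) ≤ 2 * N := by
          rw [hN]; linarith
        nlinarith

theorem dCC_ne_top (hW : TwoWell W pm pp) (P Q : ℝ × ℝ × ℝ) :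
    dCC (confFactor W) pm pp P Q ≠ ⊤ := by
  set N := |Q.1 - P.1| + |Q.2.1 - P.2.1| + 2 * √|Q.2.2 - P.2.2 - Q.1 * (Q.2.1 - P.2.1)| with hN
  obtain ⟨M, hM⟩ := (isCompact_closedBall (proj P) N).exists_bound_of_continuousOn
    hW.continuous_confFactor.continuousOn
  refine ne_top_of_le_ne_top ENNReal.ofReal_ne_top (dCC_le_of_bound hN (M := M) fun x hx => ?_)
  exact (le_abs_self _).trans (hM x (by simpa [dist_eq_norm] using hx))

/-- The distance `d_F` as a real number. -/
def ccDist (W : ℝ × ℝ → ℝ) (pm pp : ℝ × ℝ) (P Q : ℝ × ℝ × ℝ) : ℝ :=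
  (dCC (confFactor W) pm pp P Q).toReal

theorem ofReal_ccDist (hW : TwoWell W pm pp) (P Q : ℝ × ℝ × ℝ) :
    ENNReal.ofReal (ccDist W pm pp P Q) = dCC (confFactor W) pm pp P Q :=
  ENNReal.ofReal_toReal (dCC_ne_top hW P Q)

theorem ccDist_nonneg (P Q : ℝ × ℝ × ℝ) : 0 ≤ ccDist W pm pp P Q := ENNReal.toReal_nonneg

theorem ccDist_comm (P Q : ℝ × ℝ × ℝ) : ccDist W pm pp P Q = ccDist W pm pp Q P := by
  rw [ccDist, dCC_comm, ccDist]

theorem ccDist_triangle (hW : TwoWell W pm pp) (P Q R : ℝ × ℝ × ℝ) :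
    ccDist W pm pp P R ≤ ccDist W pm pp P Q + ccDist W pm pp Q R := by
  rw [ccDist, ccDist, ccDist, ← ENNReal.toReal_add (dCC_ne_top hW _ _) (dCC_ne_top hW _ _)]
  exact ENNReal.toReal_mono (ENNReal.add_ne_top.2 ⟨dCC_ne_top hW _ _, dCC_ne_top hW _ _⟩)
    (dCC_triangle P Q R)

theorem ccDist_eq_of_proj_eq {P Q P' Q' : ℝ × ℝ × ℝ} (hP : proj P = proj P')
    (hQ : proj Q = proj Q') (h : Q.2.2 - P.2.2 = Q'.2.2 - P'.2.2) :
    ccDist W pm pp P Q = ccDist W pm pp P' Q' := by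
  rw [ccDist, dCC_eq_of_proj_eq hP hQ h, ccDist]

theorem ccDist_le_integral {P Q : ℝ × ℝ × ℝ}
    (h : IsCurve pm pp a b γ (proj P) (proj Q)) (hA : HasArea pm pp a b γ (Q.2.2 - P.2.2))
    (hi : IntervalIntegrable (degSpeed W γ) volume a b) :
    ccDist W pm pp P Q ≤ ∫ t in a..b, degSpeed W γ t := by
  have := dCC_le_degLen (W := W) h hA
  rw [degLen_eq_ofReal_integral h.1 hi] at this
  exact ENNReal.toReal_le_of_le_ofReal
    (intervalIntegral.integral_nonneg h.1 fun t _ => degSpeed_nonneg W γ t) this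

theorem exists_curve_of_ccDist_lt (hW : TwoWell W pm pp) {P Q : ℝ × ℝ × ℝ} {x : ℝ}
    (h : ccDist W pm pp P Q < x) : ∃ a b γ, IsCurve pm pp a b γ (proj P) (proj Q) ∧
      HasArea pm pp a b γ (Q.2.2 - P.2.2) ∧ IntervalIntegrable (degSpeed W γ) volume a b ∧
      ∫ t in a..b, degSpeed W γ t < x := by
  have h' : dCC (confFactor W) pm pp P Q < ENNReal.ofReal x := by
    rw [← ofReal_ccDist hW]
    exact (ENNReal.ofReal_lt_ofReal_iff ((ccDist_nonneg P Q).trans_lt h)).2 h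
  obtain ⟨a, b, γ, hc, hA, hE⟩ := exists_curve_of_dCC_lt h'
  have hi := intervalIntegrable_degSpeed hW hc.1 hc.2.1 (hE.trans ENNReal.ofReal_lt_top).ne
  refine ⟨a, b, γ, hc, hA, hi, ?_⟩
  rw [degLen_eq_ofReal_integral hc.1 hi] at hE
  exact (ENNReal.ofReal_lt_ofReal_iff ((ccDist_nonneg P Q).trans_lt h)).1 hE

theorem ccDist_lt_of_close (hW : TwoWell W pm pp) (P : ℝ × ℝ × ℝ) {ε : ℝ} (hε : 0 < ε) :
    ∀ᶠ Q in 𝓝 P, ccDist W pm pp P Q < ε := by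
  obtain ⟨M, hM⟩ := (isCompact_closedBall (proj P) 1).exists_bound_of_continuousOn
    hW.continuous_confFactor.continuousOn
  have hM0 : 0 ≤ M := (norm_nonneg _).trans (hM (proj P) (by simp))
  have hc : Continuous fun Q : ℝ × ℝ × ℝ =>
      |Q.1 - P.1| + |Q.2.1 - P.2.1| + 2 * √|Q.2.2 - P.2.2 - Q.1 * (Q.2.1 - P.2.1)| := by fun_prop
  have h0 := hc.tendsto P
  simp only [sub_self, abs_zero, mul_zero, Real.sqrt_zero, add_zero] at h0
  have hpos : 0 < min 1 (ε / (2 * M + 1)) := by positivity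
  filter_upwards [h0.eventually_lt_const hpos] with Q hQ
  have h1 := hQ.trans_le (min_le_left _ _)
  have h2 := hQ.trans_le (min_le_right _ _)
  have := dCC_le_of_bound (pm := pm) (pp := pp) (W := W) (P := P) (Q := Q) (M := M) rfl
    (fun x hx => (le_abs_self _).trans (hM x (by
      rw [Metric.mem_closedBall, dist_eq_norm]; exact hx.trans h1.le)))
  set N := |Q.1 - P.1| + |Q.2.1 - P.2.1| + 2 * √|Q.2.2 - P.2.2 - Q.1 * (Q.2.1 - P.2.1)|
  have hN0 : 0 ≤ N := by positivity
  refine (ENNReal.toReal_le_of_le_ofReal (by positivity) this).trans_lt ?_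
  rw [lt_div_iff₀ (by positivity)] at h2
  nlinarith

end

end

noncomputable section

/-! ### Comparison of `d_F` with the Euclidean distance -/

theorem exists_slow_coordinate (a b : ℝ) : ∃ H : ℝ → ℝ, ContDiff ℝ 1 H ∧
    (∀ x, |deriv H x| ≤ min 1 (min |x - a| |x - b|)) ∧ StrictMono H ∧
    Tendsto H atTop atTop ∧ Tendsto H atBot atBot := by
  set k : ℝ → ℝ := fun s => min 1 (min |s - a| |s - b|) with hk
  have hkc : Continuous k := by fun_prop
  have hk0 : ∀ s, 0 ≤ k s := fun s => le_min zero_le_one (le_min (abs_nonneg _) (abs_nonneg _))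
  have hd : ∀ x, HasDerivAt (fun x => ∫ s in (0 : ℝ)..x, k s) (k x) x := fun x =>
    intervalIntegral.integral_hasDerivAt_right (hkc.intervalIntegrable _ _)
      (hkc.stronglyMeasurableAtFilter _ _) hkc.continuousAt
  have hsub : ∀ x y, (∫ s in (0 : ℝ)..y, k s) - ∫ s in (0 : ℝ)..x, k s = ∫ s in x..y, k s :=
    fun x y => intervalIntegral.integral_interval_sub_left (hkc.intervalIntegrable _ _)
      (hkc.intervalIntegrable _ _)
  set R := max |a| |b| + 1 with hR
  have hone : ∀ s, R ≤ |s| → k s = 1 := by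
    intro s hs
    have h1 : |s| ≤ |s - a| + |a| := by simpa using abs_add_le (s - a) a
    have h2 : |s| ≤ |s - b| + |b| := by simpa using abs_add_le (s - b) b
    have h3 := le_max_left |a| |b|
    have h4 := le_max_right |a| |b|
    exact min_eq_left (le_min (by linarith) (by linarith))
  have hR0 : 0 < R := by positivity
  refine ⟨fun x => ∫ s in (0 : ℝ)..x, k s, ?_, ?_, ?_, ?_, ?_⟩
  · rw [contDiff_one_iff_deriv]
    refine ⟨fun x => (hd x).differentiableAt, ?_⟩
    have : deriv (fun x => ∫ s in (0 : ℝ)..x, k s) = k := funext fun x => (hd x).deriv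
    rw [this]
    exact hkc
  · intro x
    rw [(hd x).deriv, abs_of_nonneg (hk0 x)]
  · intro x y hxy
    rw [← sub_pos, hsub]
    obtain ⟨c, hc, hc'⟩ := (Ioo_infinite hxy).exists_notMem_finite ((finite_singleton a).insert b)
    refine intervalIntegral.integral_pos hxy hkc.continuousOn (fun s _ => hk0 s)
      ⟨c, Ioo_subset_Icc_self hc, ?_⟩
    simp only [mem_insert_iff, mem_singleton_iff, not_or] at hc'
    exact lt_min one_pos (lt_min (abs_pos.2 (sub_ne_zero.2 hc'.2)) (abs_pos.2 (sub_ne_zero.2 hc'.1)))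
  · refine tendsto_atTop_mono' _ ?_
      (tendsto_atTop_add_const_left _ ((∫ s in (0 : ℝ)..R, k s) - R) tendsto_id)
    filter_upwards [eventually_ge_atTop R] with x hx
    have : ∫ s in R..x, k s = x - R := by
      rw [intervalIntegral.integral_congr (g := fun _ => (1 : ℝ)) fun s hs => ?_]
      · simp
      · rw [uIcc_of_le hx] at hs
        exact hone s (hs.1.trans (le_abs_self s))
    have h2 := hsub R x
    simp only [id]
    linarith
  · refine tendsto_atBot_mono' _ ?_
      (tendsto_atBot_add_const_left _ ((∫ s in (0 : ℝ)..(-R), k s) + R) tendsto_id)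
    filter_upwards [eventually_le_atBot (-R)] with x hx
    have : ∫ s in x..(-R), k s = -R - x := by
      rw [intervalIntegral.integral_congr (g := fun _ => (1 : ℝ)) fun s hs => ?_]
      · simp
      · rw [uIcc_of_le hx] at hs
        exact hone s (by rw [abs_of_nonpos (by linarith [hs.2])]; linarith [hs.2])
    have h2 := hsub x (-R)
    simp only [id]
    linarith

/-- A curve of finite degenerate length. -/
def IsFinCurve (W : ℝ × ℝ → ℝ) (pm pp : ℝ × ℝ) (a b : ℝ) (γ : ℝ → ℝ × ℝ) : Prop :=
  IsCurve pm pp a b γ (γ a) (γ b) ∧ IntervalIntegrable (degSpeed W γ) volume a b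

section

variable {W : ℝ × ℝ → ℝ} {pm pp : ℝ × ℝ} {a b : ℝ} {γ : ℝ → ℝ × ℝ}

theorem IsFinCurve.restrict (h : IsFinCurve W pm pp a b γ) {s t : ℝ} (hs : a ≤ s) (hst : s ≤ t)
    (ht : t ≤ b) : IsFinCurve W pm pp s t γ := by
  refine ⟨h.1.restrict hs hst ht, h.2.mono_set ?_⟩
  rw [uIcc_of_le h.1.1, uIcc_of_le hst]
  exact Icc_subset_Icc hs ht

theorem IsFinCurve.integral_mono (h : IsFinCurve W pm pp a b γ) {s t : ℝ} (hs : a ≤ s)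
    (hst : s ≤ t) (ht : t ≤ b) :
    ∫ x in s..t, degSpeed W γ x ≤ ∫ x in a..b, degSpeed W γ x := by
  refine intervalIntegral.integral_mono_interval hs hst ht ?_ h.2
  exact Eventually.of_forall fun x => degSpeed_nonneg W γ x

theorem IsFinCurve.integral_nonneg (h : IsFinCurve W pm pp a b γ) :
    0 ≤ ∫ x in a..b, degSpeed W γ x :=
  intervalIntegral.integral_nonneg h.1.1 fun t _ => degSpeed_nonneg W γ t

theorem TwoWell.exists_slow_coordinates (hW : TwoWell W pm pp) : ∃ C > 0, ∃ H₁ H₂ : ℝ → ℝ,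
    (Continuous H₁ ∧ StrictMono H₁ ∧ Tendsto H₁ atTop atTop ∧ Tendsto H₁ atBot atBot) ∧
    (Continuous H₂ ∧ StrictMono H₂ ∧ Tendsto H₂ atTop atTop ∧ Tendsto H₂ atBot atBot) ∧
    ∀ a b γ, IsFinCurve W pm pp a b γ → ∀ t ∈ Icc a b,
      |H₁ (γ t).1 - H₁ (γ a).1| ≤ C * ∫ x in a..b, degSpeed W γ x ∧
      |H₂ (γ t).2 - H₂ (γ a).2| ≤ C * ∫ x in a..b, degSpeed W γ x := by
  obtain ⟨c, hc, hlow⟩ := hW.exists_confFactor_lower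
  obtain ⟨H₁, s₁, d₁, m₁, t₁, b₁⟩ := exists_slow_coordinate pm.1 pp.1
  obtain ⟨H₂, s₂, d₂, m₂, t₂, b₂⟩ := exists_slow_coordinate pm.2 pp.2
  refine ⟨c⁻¹, by positivity, H₁, H₂, ⟨s₁.continuous, m₁, t₁, b₁⟩, ⟨s₂.continuous, m₂, t₂, b₂⟩, ?_⟩
  intro a b γ h t ht
  have h' := h.restrict le_rfl ht.1 ht.2
  have hE := h.integral_mono le_rfl ht.1 ht.2
  have hest : ∀ (x v : ℝ × ℝ) (y z : ℝ), |y| ≤ min 1 (min ‖x - pm‖ ‖x - pp‖) → |z| ≤ enorm2 v →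
      |y * z| ≤ c⁻¹ * (confFactor W x * enorm2 v) := by
    intro x v y z hy hz
    rw [abs_mul, ← mul_assoc]
    have := hlow x
    have h1 : |y| ≤ c⁻¹ * confFactor W x := by
      rw [← div_eq_inv_mul, le_div_iff₀ hc]
      nlinarith
    exact mul_le_mul h1 hz (abs_nonneg z) ((abs_nonneg y).trans h1)
  constructor
  · have hu : ContDiff ℝ 1 (fun x : ℝ × ℝ => H₁ x.1) := s₁.comp contDiff_fst
    refine (h'.1.abs_sub_le h'.2 hu (C := c⁻¹) (by positivity) fun s _ v => ?_).trans ?_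
    · have e : HasFDerivAt (fun x : ℝ × ℝ => H₁ x.1)
          (deriv H₁ (γ s).1 • ContinuousLinearMap.fst ℝ ℝ ℝ) (γ s) :=
        (s₁.differentiable one_ne_zero (γ s).1).hasDerivAt.comp_hasFDerivAt (γ s) hasFDerivAt_fst
      rw [e.fderiv]
      refine hest (γ s) v _ _ ((d₁ _).trans ?_) (abs_fst_le_enorm2 v)
      gcongr
      · exact norm_fst_le (γ s - pm)
      · exact norm_fst_le (γ s - pp)
    · rw [intervalIntegral.integral_const_mul]
      gcongr
  · have hu : ContDiff ℝ 1 (fun x : ℝ × ℝ => H₂ x.2) := s₂.comp contDiff_snd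
    refine (h'.1.abs_sub_le h'.2 hu (C := c⁻¹) (by positivity) fun s _ v => ?_).trans ?_
    · have e : HasFDerivAt (fun x : ℝ × ℝ => H₂ x.2)
          (deriv H₂ (γ s).2 • ContinuousLinearMap.snd ℝ ℝ ℝ) (γ s) :=
        (s₂.differentiable one_ne_zero (γ s).2).hasDerivAt.comp_hasFDerivAt (γ s) hasFDerivAt_snd
      rw [e.fderiv]
      refine hest (γ s) v _ _ ((d₂ _).trans ?_) (abs_snd_le_enorm2 v)
      gcongr
      · exact norm_snd_le (γ s - pm)
      · exact norm_snd_le (γ s - pp)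
    · rw [intervalIntegral.integral_const_mul]
      gcongr

theorem exists_bound_of_properness {H : ℝ → ℝ} (hc : Continuous H) (ht : Tendsto H atTop atTop)
    (hb : Tendsto H atBot atBot) (R M : ℝ) :
    ∃ R', ∀ x y, |y| ≤ R → |H x - H y| ≤ M → |x| ≤ R' := by
  obtain ⟨B, hB⟩ := (isCompact_Icc (a := -R) (b := R)).exists_bound_of_continuousOn hc.continuousOn
  obtain ⟨x₁, hx₁⟩ := (ht.eventually_gt_atTop (M + B)).exists_forall_of_atTop
  obtain ⟨x₂, hx₂⟩ := (hb.eventually_lt_atBot (-(M + B))).exists_forall_of_atBot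
  refine ⟨max x₁ (-x₂), fun x y hy hxy => ?_⟩
  have h1 := abs_le.1 (hB y (by rw [mem_Icc]; exact abs_le.1 hy))
  rw [abs_le] at hxy
  rw [abs_le]
  constructor
  · by_contra h
    push Not at h
    have := hx₂ x (by linarith [le_max_right x₁ (-x₂)])
    linarith
  · by_contra h
    push Not at h
    have := hx₁ x (by linarith [le_max_left x₁ (-x₂)])
    linarith

theorem exists_delta_of_strictMono {H : ℝ → ℝ} (hc : Continuous H) (hm : StrictMono H)
    (x₀ : ℝ) {r C : ℝ} (hr : 0 < r) (hC : 0 < C) :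
    ∃ δ > 0, ∀ x y, |y - x₀| < δ → |H x - H y| ≤ C * δ → |x - x₀| < r := by
  set m := min (H (x₀ + r) - H x₀) (H x₀ - H (x₀ - r)) with hmdef
  have hm0 : 0 < m := lt_min (sub_pos.2 (hm (by linarith))) (sub_pos.2 (hm (by linarith)))
  obtain ⟨δ, hδ, h⟩ := Metric.continuous_iff.1 hc x₀ (m / 2) (by positivity)
  refine ⟨min δ (m / (4 * C)), by positivity, fun x y hy hxy => ?_⟩
  have h1 := h y (by rw [Real.dist_eq]; exact hy.trans_le (min_le_left _ _))
  rw [Real.dist_eq] at h1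
  have h2 : C * min δ (m / (4 * C)) ≤ m / 4 := by
    calc _ ≤ C * (m / (4 * C)) := by gcongr; exact min_le_right _ _
      _ = m / 4 := by field_simp
  have h3 := min_le_left (H (x₀ + r) - H x₀) (H x₀ - H (x₀ - r))
  have h4 := min_le_right (H (x₀ + r) - H x₀) (H x₀ - H (x₀ - r))
  rw [abs_lt] at *
  rw [abs_le] at hxy
  constructor
  · have : H (x₀ - r) < H x := by linarith
    have := hm.lt_iff_lt.1 this
    linarith
  · have : H x < H (x₀ + r) := by linarith
    have := hm.lt_iff_lt.1 this
    linarith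

/-- Curves of bounded degenerate length starting in a bounded set stay in a bounded set. -/
theorem TwoWell.exists_bound_of_curve (hW : TwoWell W pm pp) (R M : ℝ) : ∃ R', ∀ a b γ,
    IsFinCurve W pm pp a b γ → ‖γ a‖ ≤ R → ∫ x in a..b, degSpeed W γ x ≤ M →
      ∀ t ∈ Icc a b, ‖γ t‖ ≤ R' := by
  obtain ⟨C, hC, H₁, H₂, ⟨c₁, -, t₁, b₁⟩, ⟨c₂, -, t₂, b₂⟩, h⟩ := hW.exists_slow_coordinates
  obtain ⟨R₁, h₁⟩ := exists_bound_of_properness c₁ t₁ b₁ R (C * M)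
  obtain ⟨R₂, h₂⟩ := exists_bound_of_properness c₂ t₂ b₂ R (C * M)
  refine ⟨max R₁ R₂, fun a b γ hγ ha hE t ht => ?_⟩
  obtain ⟨e₁, e₂⟩ := h a b γ hγ t ht
  have hCE : C * ∫ x in a..b, degSpeed W γ x ≤ C * M := by gcongr
  rw [Prod.norm_def]
  exact max_le_max (h₁ _ _ ((norm_fst_le _).trans ha) (e₁.trans hCE))
    (h₂ _ _ ((norm_snd_le _).trans ha) (e₂.trans hCE))

/-- Curves of small degenerate length starting near a point stay near it. -/
theorem TwoWell.exists_stay (hW : TwoWell W pm pp) (p₀ : ℝ × ℝ) {r : ℝ} (hr : 0 < r) :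
    ∃ δ > 0, ∀ a b γ, IsFinCurve W pm pp a b γ → ‖γ a - p₀‖ < δ →
      ∫ x in a..b, degSpeed W γ x ≤ δ → ∀ t ∈ Icc a b, ‖γ t - p₀‖ < r := by
  obtain ⟨C, hC, H₁, H₂, ⟨c₁, m₁, -⟩, ⟨c₂, m₂, -⟩, h⟩ := hW.exists_slow_coordinates
  obtain ⟨δ₁, hδ₁, h₁⟩ := exists_delta_of_strictMono c₁ m₁ p₀.1 hr hC
  obtain ⟨δ₂, hδ₂, h₂⟩ := exists_delta_of_strictMono c₂ m₂ p₀.2 hr hC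
  refine ⟨min δ₁ δ₂, by positivity, fun a b γ hγ ha hE t ht => ?_⟩
  obtain ⟨e₁, e₂⟩ := h a b γ hγ t ht
  have f₁ : C * ∫ x in a..b, degSpeed W γ x ≤ C * δ₁ := by
    gcongr; exact hE.trans (min_le_left _ _)
  have f₂ : C * ∫ x in a..b, degSpeed W γ x ≤ C * δ₂ := by
    gcongr; exact hE.trans (min_le_right _ _)
  rw [Prod.norm_def]
  refine max_lt (h₁ _ _ ?_ (e₁.trans f₁)) (h₂ _ _ ?_ (e₂.trans f₂))
  · exact ((norm_fst_le (γ a - p₀)).trans_lt ha).trans_le (min_le_left _ _)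
  · exact ((norm_snd_le (γ a - p₀)).trans_lt ha).trans_le (min_le_right _ _)

theorem exists_finCurve_of_ccDist_lt (hW : TwoWell W pm pp) {P Q : ℝ × ℝ × ℝ} {x : ℝ}
    (h : ccDist W pm pp P Q < x) : ∃ a b γ, IsFinCurve W pm pp a b γ ∧ γ a = proj P ∧
      γ b = proj Q ∧ HasArea pm pp a b γ (Q.2.2 - P.2.2) ∧
      ∫ t in a..b, degSpeed W γ t < x := by
  obtain ⟨a, b, γ, hc, hA, hi, hE⟩ := exists_curve_of_ccDist_lt hW h
  have ha := hc.2.2.2.1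
  have hb := hc.2.2.2.2
  refine ⟨a, b, γ, ⟨?_, hi⟩, ha, hb, hA, hE⟩
  rw [ha, hb]
  exact hc

theorem TwoWell.exists_proj_close (hW : TwoWell W pm pp) (p₀ : ℝ × ℝ) {r : ℝ} (hr : 0 < r) :
    ∃ δ > 0, ∀ P Q, ‖proj P - p₀‖ < δ → ccDist W pm pp P Q < δ → ‖proj Q - p₀‖ < r := by
  obtain ⟨δ, hδ, h⟩ := hW.exists_stay p₀ hr
  refine ⟨δ, hδ, fun P Q hP hd => ?_⟩
  obtain ⟨a, b, γ, hγ, ha, hb, -, hE⟩ := exists_finCurve_of_ccDist_lt hW hd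
  rw [← hb]
  exact h a b γ hγ (by rwa [ha]) hE.le b (right_mem_Icc.2 hγ.1.1)

theorem proj_eq_of_ccDist_eq_zero (hW : TwoWell W pm pp) {P Q : ℝ × ℝ × ℝ}
    (h : ccDist W pm pp P Q = 0) : proj Q = proj P := by
  rw [← sub_eq_zero, ← norm_le_zero_iff]
  refine le_of_forall_pos_le_add fun r hr => ?_
  obtain ⟨δ, hδ, hh⟩ := hW.exists_proj_close (proj P) hr
  rw [zero_add]
  exact (hh P Q (by simpa using hδ) (by rwa [h])).le

/-- The third coordinate, corrected by the potential of the exact part of the area form, is locally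
Lipschitz with respect to `d_F`. -/
theorem TwoWell.exists_height_bound (hW : TwoWell W pm pp) (R M : ℝ) : ∃ C > 0, ∃ R', ∀ P Q,
    ‖proj P‖ ≤ R → ccDist W pm pp P Q < M → ‖proj Q‖ ≤ R' ∧
      |Q.2.2 - P.2.2 - (wellPot pm pp (proj Q) - wellPot pm pp (proj P))| ≤
        C * ccDist W pm pp P Q := by
  obtain ⟨R', hR'⟩ := hW.exists_bound_of_curve R M
  obtain ⟨C, hC, hle⟩ := hW.exists_norm_areaForm_le R'
  refine ⟨C, hC, R', fun P Q hP hd => ?_⟩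
  have key : ∀ x, ccDist W pm pp P Q < x → x ≤ M → ‖proj Q‖ ≤ R' ∧
      |Q.2.2 - P.2.2 - (wellPot pm pp (proj Q) - wellPot pm pp (proj P))| ≤ C * x := by
    intro x hx hxM
    obtain ⟨a, b, γ, hγ, ha, hb, hA, hE⟩ := exists_finCurve_of_ccDist_lt hW hx
    have hbd := hR' a b γ hγ (by rwa [ha]) (hE.le.trans hxM)
    refine ⟨by rw [← hb]; exact hbd b (right_mem_Icc.2 hγ.1.1), ?_⟩
    obtain ⟨hi, hA⟩ := (hasArea_iff _).1 hA
    rw [hA, ha, hb, add_sub_cancel_left, ← Real.norm_eq_abs]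
    calc _ ≤ ∫ t in a..b, C * degSpeed W γ t := by
          refine intervalIntegral.norm_integral_le_of_norm_le hγ.1.1 ?_ (hγ.2.const_mul C)
          refine Eventually.of_forall fun t ht => ?_
          exact hle (γ t) (hbd t (Ioc_subset_Icc_self ht)) _
      _ ≤ C * x := by
          rw [intervalIntegral.integral_const_mul]
          gcongr
  refine ⟨(key M hd le_rfl).1, ?_⟩
  refine le_of_forall_gt_imp_ge_of_dense fun y hy => ?_
  have hlt : ccDist W pm pp P Q < min (y / C) M :=
    lt_min (by rw [lt_div_iff₀ hC, mul_comm]; exact hy) hd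
  refine (key _ hlt (min_le_right _ _)).2.trans ?_
  calc C * min (y / C) M ≤ C * (y / C) := by gcongr; exact min_le_left _ _
    _ = y := by field_simp

/-- Away from the wells, `d_F` is locally comparable with the Heisenberg distance. -/
theorem TwoWell.exists_local_bound (hW : TwoWell W pm pp) {p₀ : ℝ × ℝ} {m : ℝ} (hm : 0 < m)
    (hm' : m < confFactor W p₀) : ∃ δ > 0, ∀ P Q, ‖proj P - p₀‖ < δ → ccDist W pm pp P Q < δ →
      m * enorm2 (proj Q - proj P) ≤ ccDist W pm pp P Q ∧
      |Q.2.2 - P.2.2 - P.1 * (Q.2.1 - P.2.1)| ≤ (ccDist W pm pp P Q / m) ^ 2 := by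
  obtain ⟨r, hr, hFr⟩ := Metric.continuous_iff.1 hW.continuous_confFactor p₀
    (confFactor W p₀ - m) (by linarith)
  have hFm : ∀ x, ‖x - p₀‖ < r → m ≤ confFactor W x := by
    intro x hx
    have := hFr x (by rwa [dist_eq_norm])
    rw [Real.dist_eq, abs_lt] at this
    linarith
  obtain ⟨δ, hδ, hstay⟩ := hW.exists_stay p₀ hr
  refine ⟨δ, hδ, fun P Q hP hd => ?_⟩
  have key : ∀ x, ccDist W pm pp P Q < x → x ≤ δ → m * enorm2 (proj Q - proj P) ≤ x ∧
      |Q.2.2 - P.2.2 - P.1 * (Q.2.1 - P.2.1)| ≤ (x / m) ^ 2 := by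
    intro x hx hxδ
    have hx0 : 0 < x := (ccDist_nonneg P Q).trans_lt hx
    obtain ⟨a, b, γ, hγ, ha, hb, hA, hE⟩ := exists_finCurve_of_ccDist_lt hW hx
    have hs := hstay a b γ hγ (by rwa [ha]) (hE.le.trans hxδ)
    have hlow : ∀ t ∈ Icc a b, ∀ v, enorm2 v ≤ m⁻¹ * (confFactor W (γ t) * enorm2 v) := by
      intro t ht v
      rw [← mul_assoc]
      refine le_mul_of_one_le_left (enorm2_nonneg v) ?_
      rw [← div_eq_inv_mul, le_div_iff₀ hm, one_mul]
      exact hFm _ (hs t ht)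
    have hlin : ∀ n : ℝ × ℝ, enorm2 n ≤ 1 → ∀ t ∈ Icc a b,
        |(n.1 * (γ t).1 + n.2 * (γ t).2) - (n.1 * (γ a).1 + n.2 * (γ a).2)| ≤ m⁻¹ * x := by
      intro n hn t ht
      have hu : ContDiff ℝ 1 (fun y : ℝ × ℝ => n.1 * y.1 + n.2 * y.2) := by fun_prop
      have h' := hγ.restrict le_rfl ht.1 ht.2
      refine (h'.1.abs_sub_le h'.2 hu (C := m⁻¹) (by positivity) fun s hs' v => ?_).trans ?_
      · have e : HasFDerivAt (fun y : ℝ × ℝ => n.1 * y.1 + n.2 * y.2)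
            (n.1 • ContinuousLinearMap.fst ℝ ℝ ℝ + n.2 • ContinuousLinearMap.snd ℝ ℝ ℝ) (γ s) :=
          (hasFDerivAt_fst.const_mul n.1).add (hasFDerivAt_snd.const_mul n.2)
        rw [e.fderiv]
        refine (abs_dot_le n v).trans ?_
        refine le_trans ?_ (hlow s (Icc_subset_Icc le_rfl ht.2 hs') v)
        exact mul_le_of_le_one_left (enorm2_nonneg v) hn
      · rw [intervalIntegral.integral_const_mul]
        have := hγ.integral_mono le_rfl ht.1 ht.2
        gcongr
        linarith
    constructor
    · set v := proj Q - proj P with hv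
      by_cases hv0 : v = 0
      · rw [hv0, enorm2_zero]; simpa using hx0.le
      have hvpos := enorm2_pos hv0
      have h1 := hlin ((enorm2 v)⁻¹ • v) (by
        rw [enorm2_smul, abs_of_pos (by positivity), inv_mul_cancel₀ hvpos.ne']) b
        (right_mem_Icc.2 hγ.1.1)
      rw [ha, hb] at h1
      have e : ((enorm2 v)⁻¹ • v).1 * (proj Q).1 + ((enorm2 v)⁻¹ • v).2 * (proj Q).2 -
          (((enorm2 v)⁻¹ • v).1 * (proj P).1 + ((enorm2 v)⁻¹ • v).2 * (proj P).2) = enorm2 v := by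
        have : (enorm2 v)⁻¹ * (v.1 ^ 2 + v.2 ^ 2) = enorm2 v := by
          rw [← enorm2_sq]; field_simp
        have v1 : (proj Q).1 = v.1 + (proj P).1 := by simp [hv]
        have v2 : (proj Q).2 = v.2 + (proj P).2 := by simp [hv]
        refine Eq.trans ?_ this
        simp only [Prod.smul_fst, Prod.smul_snd, smul_eq_mul]
        linear_combination (enorm2 v)⁻¹ * v.1 * v1 + (enorm2 v)⁻¹ * v.2 * v2
      rw [e, abs_of_pos hvpos, ← div_eq_inv_mul, le_div_iff₀ hm] at h1
      linarith
    · obtain ⟨hi, hA⟩ := (hasArea_iff _).1 hA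
      set u : ℝ × ℝ → ℝ := fun y => wellPot pm pp y - P.1 * y.2 with hu
      have hu1 : ContDiff ℝ 1 u := (contDiff_wellPot pm pp).sub (by fun_prop)
      obtain ⟨C, hC⟩ := (isCompact_Icc (a := a) (b := b)).exists_bound_of_continuousOn
        ((hu1.continuous_fderiv one_ne_zero).comp_continuousOn hγ.1.2.1)
      have hC0 : 0 ≤ C := (norm_nonneg _).trans (hC a (left_mem_Icc.2 hγ.1.1))
      have hFTC := hγ.1.integral_fderiv hW hγ.2 hu1 (C := C * m⁻¹) (by positivity) fun t ht v => by
        calc |fderiv ℝ u (γ t) v| ≤ ‖fderiv ℝ u (γ t)‖ * ‖v‖ := (fderiv ℝ u (γ t)).le_opNorm v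
          _ ≤ C * enorm2 v := by
              gcongr
              · exact hC t ht
              · exact norm_le_enorm2 v
          _ ≤ C * (m⁻¹ * (confFactor W (γ t) * enorm2 v)) := by gcongr; exact hlow t ht v
          _ = _ := by ring
      have hval : Q.2.2 - P.2.2 - P.1 * (Q.2.1 - P.2.1) =
          ∫ t in a..b, (areaForm pm pp (γ t) (deriv γ t) + fderiv ℝ u (γ t) (deriv γ t)) := by
        rw [intervalIntegral.integral_add hi hFTC.1, hFTC.2, hA, hu, ha, hb]
        simp only [proj]
        ring
      have hpt : ∀ t ∈ Icc a b, areaForm pm pp (γ t) (deriv γ t) + fderiv ℝ u (γ t) (deriv γ t) =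
          ((γ t).1 - P.1) * (deriv γ t).2 := by
        intro t _
        have e : HasFDerivAt u (fderiv ℝ (wellPot pm pp) (γ t) -
            P.1 • ContinuousLinearMap.snd ℝ ℝ ℝ) (γ t) :=
          ((contDiff_wellPot pm pp).differentiable one_ne_zero (γ t)).hasFDerivAt.sub
            (hasFDerivAt_snd.const_mul P.1)
        rw [e.fderiv, areaForm_apply]
        simp only [sub_apply, smul_apply, ContinuousLinearMap.coe_snd', smul_eq_mul]
        ring
      rw [hval, ← Real.norm_eq_abs]
      calc _ ≤ ∫ t in a..b, (m⁻¹ * x) * (m⁻¹ * degSpeed W γ t) := by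
            refine intervalIntegral.norm_integral_le_of_norm_le hγ.1.1 ?_
              ((hγ.2.const_mul m⁻¹).const_mul _)
            refine Eventually.of_forall fun t ht => ?_
            have ht' := Ioc_subset_Icc_self ht
            rw [hpt t ht', norm_mul]
            have h1 := hlin (1, 0) (by simp [enorm2]) t ht'
            simp only [one_mul, zero_mul, add_zero] at h1
            rw [ha] at h1
            refine mul_le_mul h1 ?_ (norm_nonneg _) (by positivity)
            exact (abs_snd_le_enorm2 _).trans (hlow t ht' _)
        _ ≤ (m⁻¹ * x) * (m⁻¹ * x) := by
            rw [intervalIntegral.integral_const_mul, intervalIntegral.integral_const_mul]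
            gcongr
        _ = (x / m) ^ 2 := by ring
  have hcont1 : Tendsto (fun x : ℝ => x) (𝓝[>] (ccDist W pm pp P Q)) (𝓝 (ccDist W pm pp P Q)) :=
    tendsto_nhdsWithin_of_tendsto_nhds tendsto_id
  have hev : ∀ᶠ x in 𝓝[>] (ccDist W pm pp P Q), ccDist W pm pp P Q < x ∧ x ≤ δ := by
    filter_upwards [self_mem_nhdsWithin, Ioc_mem_nhdsGT hd] with x h1 h2
    exact ⟨h1, h2.2⟩
  constructor
  · refine ge_of_tendsto hcont1 (hev.mono fun x hx => (key x hx.1 hx.2).1)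
  · refine ge_of_tendsto ((hcont1.div_const m).pow 2) (hev.mono fun x hx => (key x hx.1 hx.2).2)

end

end

noncomputable section

/-! ### Curves that are Lipschitz with respect to `d_F` -/

/-- `Γ` is `L`-Lipschitz on `[a,b]` with respect to `d_F`. -/
def IsCCLip (W : ℝ × ℝ → ℝ) (pm pp : ℝ × ℝ) (L a b : ℝ) (Γ : ℝ → ℝ × ℝ × ℝ) : Prop :=
  ∀ s ∈ Icc a b, ∀ t ∈ Icc a b, ccDist W pm pp (Γ s) (Γ t) ≤ L * |t - s|

section

variable {W : ℝ × ℝ → ℝ} {pm pp : ℝ × ℝ} {L a b : ℝ} {Γ : ℝ → ℝ × ℝ × ℝ}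

theorem IsCCLip.of_le (hL : ∀ s t, a ≤ s → s ≤ t → t ≤ b →
    ccDist W pm pp (Γ s) (Γ t) ≤ L * (t - s)) : IsCCLip W pm pp L a b Γ := by
  intro s hs t ht
  rcases le_total s t with h | h
  · rw [abs_of_nonneg (by linarith)]
    exact hL s t hs.1 h ht.2
  · rw [abs_of_nonpos (by linarith), ccDist_comm, neg_sub]
    exact hL t s ht.1 h hs.2

theorem IsCCLip.mono (h : IsCCLip W pm pp L a b Γ) {s t : ℝ} (hs : a ≤ s) (ht : t ≤ b) :
    IsCCLip W pm pp L s t Γ := fun x hx y hy =>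
  h x (Icc_subset_Icc hs ht hx) y (Icc_subset_Icc hs ht hy)

theorem IsCCLip.eventually_ccDist_lt (h : IsCCLip W pm pp L a b Γ) {t : ℝ} (ht : t ∈ Icc a b)
    {δ : ℝ} (hδ : 0 < δ) : ∀ᶠ s in 𝓝[Icc a b] t, ccDist W pm pp (Γ t) (Γ s) < δ := by
  have hc : Tendsto (fun s : ℝ => L * |s - t|) (𝓝[Icc a b] t) (𝓝 0) := by
    have : Continuous fun s : ℝ => L * |s - t| := by fun_prop
    have := this.tendsto t
    simp only [sub_self, abs_zero, mul_zero] at this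
    exact tendsto_nhdsWithin_of_tendsto_nhds this
  filter_upwards [hc.eventually_lt_const hδ, self_mem_nhdsWithin] with s hs hs'
  exact (h t ht s hs').trans_lt hs

theorem IsCCLip.continuousOn (hW : TwoWell W pm pp) (h : IsCCLip W pm pp L a b Γ) :
    ContinuousOn (projCurve Γ) (Icc a b) := by
  intro t ht
  rw [ContinuousWithinAt, Metric.tendsto_nhds]
  intro r hr
  obtain ⟨δ, hδ, hh⟩ := hW.exists_proj_close (proj (Γ t)) hr
  filter_upwards [h.eventually_ccDist_lt ht hδ] with s hs
  rw [dist_eq_norm]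
  exact hh (Γ t) (Γ s) (by simpa using hδ) hs

/-- The local estimate along a Lipschitz curve, at a time at which it is away from the wells. -/
theorem IsCCLip.eventually_bound (hW : TwoWell W pm pp) (h : IsCCLip W pm pp L a b Γ) {t : ℝ}
    (ht : t ∈ Icc a b) {m : ℝ} (hm : 0 < m) (hm' : m < confFactor W (projCurve Γ t)) :
    ∃ s ∈ 𝓝[Icc a b] t, s ⊆ Icc a b ∧ ∀ x ∈ s, ∀ y ∈ s,
      m * enorm2 (projCurve Γ y - projCurve Γ x) ≤ L * |y - x| ∧
      |(Γ y).2.2 - (Γ x).2.2 - (Γ x).1 * ((Γ y).2.1 - (Γ x).2.1)| ≤ (L * |y - x| / m) ^ 2 := by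
  obtain ⟨δ, hδ, hh⟩ := hW.exists_local_bound hm hm'
  have e1 := h.eventually_ccDist_lt ht (half_pos hδ)
  have e2 : ∀ᶠ s in 𝓝[Icc a b] t, ‖projCurve Γ s - projCurve Γ t‖ < δ := by
    have := (h.continuousOn hW) t ht
    rw [ContinuousWithinAt, Metric.tendsto_nhds] at this
    simpa [dist_eq_norm] using this δ hδ
  refine ⟨_, inter_mem (inter_mem e1 e2) self_mem_nhdsWithin, fun x hx => hx.2, ?_⟩
  rintro x ⟨⟨hx1, hx2⟩, hx3⟩ y ⟨⟨hy1, hy2⟩, hy3⟩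
  have hd : ccDist W pm pp (Γ x) (Γ y) < δ := by
    have := ccDist_triangle hW (Γ x) (Γ t) (Γ y)
    rw [ccDist_comm (Γ x) (Γ t)] at this
    rw [mem_ofPred_eq] at hx1 hy1
    linarith
  obtain ⟨k1, k2⟩ := hh (Γ x) (Γ y) hx2 hd
  have hL := h x hx3 y hy3
  have h0 := ccDist_nonneg (W := W) (pm := pm) (pp := pp) (Γ x) (Γ y)
  refine ⟨k1.trans hL, k2.trans ?_⟩
  gcongr

theorem IsCCLip.isCurve (hW : TwoWell W pm pp) (hab : a ≤ b) (h : IsCCLip W pm pp L a b Γ) :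
    IsCurve pm pp a b (projCurve Γ) (proj (Γ a)) (proj (Γ b)) := by
  refine ⟨hab, h.continuousOn hW, ?_, rfl, rfl⟩
  rintro t ⟨ht, h1, h2⟩
  have hF := hW.confFactor_pos h1 h2
  set m := confFactor W (projCurve Γ t) / 2 with hm
  have hm0 : 0 < m := by positivity
  obtain ⟨s, hs, -, hh⟩ := h.eventually_bound hW ht hm0 (by linarith)
  refine ⟨(L / m).toNNReal, s, nhdsWithin_mono t (fun x hx => hx.1) hs, ?_⟩
  refine LipschitzOnWith.of_dist_le_mul fun x hx y hy => ?_
  have k := (hh y hy x hx).1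
  rw [dist_eq_norm, Real.dist_eq]
  refine (norm_le_enorm2 _).trans ?_
  have : enorm2 (projCurve Γ x - projCurve Γ y) ≤ L / m * |x - y| := by
    rw [div_mul_eq_mul_div, le_div_iff₀ hm0]
    linarith
  refine this.trans ?_
  gcongr
  exact Real.le_coe_toNNReal _

theorem IsCCLip.ae_differentiableAt (hW : TwoWell W pm pp) (hab : a ≤ b)
    (h : IsCCLip W pm pp L a b Γ) : ∀ᵐ t : ℝ, t ∈ Ioo a b → projCurve Γ t ≠ pm →
      projCurve Γ t ≠ pp → DifferentiableAt ℝ (projCurve Γ) t :=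
  (h.isCurve hW hab).ae_differentiableAt

theorem IsCCLip.degSpeed_le (hW : TwoWell W pm pp)
    (h : IsCCLip W pm pp L a b Γ) {t : ℝ} (ht : t ∈ Ioo a b) (h1 : projCurve Γ t ≠ pm)
    (h2 : projCurve Γ t ≠ pp) (hd : DifferentiableAt ℝ (projCurve Γ) t) :
    degSpeed W (projCurve Γ) t ≤ L := by
  have hF := hW.confFactor_pos h1 h2
  have key : ∀ m, 0 < m → m < confFactor W (projCurve Γ t) →
      m * enorm2 (deriv (projCurve Γ) t) ≤ L := by
    intro m hm hm'
    obtain ⟨s, hs, -, hh⟩ := h.eventually_bound hW (Ioo_subset_Icc_self ht) hm hm'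
    rw [nhdsWithin_eq_nhds.2 (Icc_mem_nhds ht.1 ht.2)] at hs
    have hsl := hasDerivAt_iff_tendsto_slope.1 hd.hasDerivAt
    have hsl' := ((continuous_enorm2.tendsto _).comp hsl).const_mul m
    refine le_of_tendsto hsl' ?_
    filter_upwards [mem_nhdsWithin_of_mem_nhds hs, self_mem_nhdsWithin] with x hx hxt
    have k := (hh t (mem_of_mem_nhds hs) x hx).1
    have hne : 0 < |x - t| := abs_pos.2 (sub_ne_zero.2 hxt)
    simp only [Function.comp_apply, slope, vsub_eq_sub]
    rw [enorm2_smul, abs_inv, ← mul_assoc, mul_comm m, mul_assoc, ← div_eq_inv_mul,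
      div_le_iff₀ hne]
    exact k
  have hc : Tendsto (fun m : ℝ => m * enorm2 (deriv (projCurve Γ) t))
      (𝓝[<] (confFactor W (projCurve Γ t))) (𝓝 (degSpeed W (projCurve Γ) t)) :=
    tendsto_nhdsWithin_of_tendsto_nhds (tendsto_id.mul_const _)
  refine le_of_tendsto hc ?_
  filter_upwards [Ioo_mem_nhdsLT hF] with m hm
  exact key m hm.1 hm.2

theorem IsCCLip.hasDerivAt_height (hW : TwoWell W pm pp)
    (h : IsCCLip W pm pp L a b Γ) {t : ℝ} (ht : t ∈ Ioo a b) (h1 : projCurve Γ t ≠ pm)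
    (h2 : projCurve Γ t ≠ pp) (hd : DifferentiableAt ℝ (projCurve Γ) t) :
    HasDerivAt (fun s => (Γ s).2.2) ((projCurve Γ t).1 * (deriv (projCurve Γ) t).2) t := by
  have hF := hW.confFactor_pos h1 h2
  set m := confFactor W (projCurve Γ t) / 2 with hm
  have hm0 : 0 < m := by positivity
  obtain ⟨s, hs, -, hh⟩ := h.eventually_bound hW (Ioo_subset_Icc_self ht) hm0 (by linarith)
  rw [nhdsWithin_eq_nhds.2 (Icc_mem_nhds ht.1 ht.2)] at hs
  have hy : HasDerivAt (fun s => (projCurve Γ t).1 * (projCurve Γ s).2)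
      ((projCurve Γ t).1 * (deriv (projCurve Γ) t).2) t :=
    ((ContinuousLinearMap.snd ℝ ℝ ℝ).hasFDerivAt.comp_hasDerivAt t hd.hasDerivAt).const_mul _
  have hrem : HasDerivAt (fun s => (Γ s).2.2 - (projCurve Γ t).1 * (projCurve Γ s).2) 0 t := by
    rw [hasDerivAt_iff_isLittleO]
    have hO : (fun x => (Γ x).2.2 - (projCurve Γ t).1 * (projCurve Γ x).2 -
        ((Γ t).2.2 - (projCurve Γ t).1 * (projCurve Γ t).2) - (x - t) • (0 : ℝ)) =O[𝓝 t]
        fun x => (x - t) ^ 2 := by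
      refine Asymptotics.IsBigO.of_bound ((L / m) ^ 2) ?_
      filter_upwards [hs] with x hx
      have k := (hh t (mem_of_mem_nhds hs) x hx).2
      rw [smul_zero, sub_zero, Real.norm_eq_abs, Real.norm_eq_abs, abs_of_nonneg (sq_nonneg (x - t)),
        ← mul_pow]
      calc _ = |(Γ x).2.2 - (Γ t).2.2 - (Γ t).1 * ((Γ x).2.1 - (Γ t).2.1)| := by
            simp only [projCurve, proj]
            congr 1
            ring
        _ ≤ _ := k
        _ = _ := by rw [mul_div_right_comm, mul_pow, sq_abs, mul_pow]
    refine hO.trans_isLittleO ?_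
    have : (fun x : ℝ => (x - t) ^ 2) = fun x => (x - t) * (x - t) := by ext; ring
    rw [this]
    refine Asymptotics.IsLittleO.of_isBigOWith fun c hc => ?_
    rw [Asymptotics.isBigOWith_iff]
    filter_upwards [Metric.ball_mem_nhds t hc] with x hx
    rw [norm_mul]
    rw [Metric.mem_ball, dist_eq_norm] at hx
    gcongr
  have := hrem.add hy
  rw [zero_add] at this
  refine this.congr_of_eventuallyEq (Eventually.of_forall fun s => ?_)
  simp

/-- The projection of a `d_F`-Lipschitz curve which spends almost no time at the wells is a
locally Lipschitz curve, whose signed area is the increment of the third coordinate. -/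
theorem IsCCLip.hasArea (hW : TwoWell W pm pp) (hab : a ≤ b) (h : IsCCLip W pm pp L a b Γ)
    (hK : ∀ᵐ t : ℝ, t ∈ Ioo a b → projCurve Γ t ≠ pm ∧ projCurve Γ t ≠ pp) :
    HasArea pm pp a b (projCurve Γ) ((Γ b).2.2 - (Γ a).2.2) := by
  set g : ℝ → ℝ := fun t => (Γ t).2.2 - wellPot pm pp (projCurve Γ t) with hg
  obtain ⟨R, hR⟩ := isCompact_Icc.exists_bound_of_continuousOn (h.continuousOn hW)
  obtain ⟨C, hC, _, hbd⟩ := hW.exists_height_bound R (L * |b - a| + 1)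
  have hL0 : a < b → 0 ≤ L := by
    intro hlt
    have := (ccDist_nonneg _ _).trans (h a (left_mem_Icc.2 hab) b (right_mem_Icc.2 hab))
    exact nonneg_of_mul_nonneg_left this (abs_pos.2 (by linarith))
  have hglip : LipschitzOnWith (C * L).toNNReal g (Icc a b) := by
    refine LipschitzOnWith.of_dist_le_mul fun x hx y hy => ?_
    by_cases hlt : a < b
    swap
    · have : x = y := by
        rw [mem_Icc] at hx hy
        linarith [hx.1, hx.2, hy.1, hy.2]
      simp [this]
    have hL := hL0 hlt
    have hxy : |x - y| ≤ |b - a| := by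
      rw [abs_of_nonneg (by linarith : 0 ≤ b - a), abs_le]
      constructor <;> linarith [hx.1, hx.2, hy.1, hy.2]
    have hd := h y hy x hx
    have := (hbd (Γ y) (Γ x) (hR y hy) (by
      have : L * |x - y| ≤ L * |b - a| := by gcongr
      linarith)).2
    rw [Real.coe_toNNReal _ (by positivity), Real.dist_eq, Real.dist_eq]
    calc |g x - g y| = _ := by
          rw [hg]
          congr 1
          simp only [projCurve]
          ring
      _ ≤ _ := this
      _ ≤ C * (L * |x - y|) := by gcongr
      _ = _ := by ring
  have hac : AbsolutelyContinuousOnInterval g a b := by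
    apply LipschitzOnWith.absolutelyContinuousOnInterval (K := (C * L).toNNReal)
    rwa [uIcc_of_le hab]
  have hae : ∀ᵐ t : ℝ, t ∈ uIoc a b →
      deriv g t = areaForm pm pp (projCurve Γ t) (deriv (projCurve Γ) t) := by
    filter_upwards [hK, h.ae_differentiableAt hW hab, Measure.ae_ne volume b] with t h1 h2 h3 ht
    rw [uIoc_of_le hab] at ht
    have ht' : t ∈ Ioo a b := ⟨ht.1, lt_of_le_of_ne ht.2 h3⟩
    obtain ⟨n1, n2⟩ := h1 ht'
    have hd := h2 ht' n1 n2
    have e1 := h.hasDerivAt_height hW ht' n1 n2 hd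
    have e2 := ((contDiff_wellPot pm pp).differentiable one_ne_zero
      (projCurve Γ t)).hasFDerivAt.comp_hasDerivAt t hd.hasDerivAt
    exact (e1.sub e2).deriv
  rw [hasArea_iff]
  refine ⟨hac.intervalIntegrable_deriv.congr_ae ((ae_restrict_iff' measurableSet_uIoc).2 hae), ?_⟩
  rw [← intervalIntegral.integral_congr_ae hae, hac.integral_deriv_eq_sub, hg]
  ring

theorem IsCCLip.degLen_le (hW : TwoWell W pm pp) (hab : a ≤ b) (hL : 0 ≤ L)
    (h : IsCCLip W pm pp L a b Γ) :
    degLen (confFactor W) a b (projCurve Γ) ≤ ENNReal.ofReal (L * (b - a)) := by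
  rw [degLen_eq_lintegral, ← Measure.restrict_congr_set Ioo_ae_eq_Icc]
  calc _ ≤ ∫⁻ _ in Ioo a b, ENNReal.ofReal L := by
        refine setLIntegral_mono_ae' measurableSet_Ioo ?_
        filter_upwards [h.ae_differentiableAt hW hab] with t ht hmem
        refine ENNReal.ofReal_le_ofReal ?_
        by_cases hw : projCurve Γ t = pm ∨ projCurve Γ t = pp
        · rw [degSpeed, (hW.confFactor_eq_zero_iff _).2 hw, zero_mul]
          exact hL
        · push Not at hw
          exact h.degSpeed_le hW hmem hw.1 hw.2 (ht hmem hw.1 hw.2)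
    _ = ENNReal.ofReal L * ENNReal.ofReal (b - a) := by
        rw [setLIntegral_const, Real.volume_Ioo]
    _ = _ := (ENNReal.ofReal_mul' (by linarith)).symm

theorem IsCCLip.isConstrainedMin (hW : TwoWell W pm pp)
    (h : IsCCLip W pm pp (ccDist W pm pp (Γ 0) (Γ 1)) 0 1 Γ)
    (hK : ∀ᵐ t : ℝ, t ∈ Ioo (0 : ℝ) 1 → projCurve Γ t ≠ pm ∧ projCurve Γ t ≠ pp) :
    IsConstrainedMin (confFactor W) pm pp (proj (Γ 0)) (proj (Γ 1)) ((Γ 1).2.2 - (Γ 0).2.2) 0 1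
      (projCurve Γ) := by
  refine ⟨h.isCurve hW zero_le_one, h.hasArea hW zero_le_one hK, fun a' b' ζ hζ hA => ?_⟩
  refine (h.degLen_le hW zero_le_one (ccDist_nonneg _ _)).trans ?_
  rw [sub_zero, mul_one, ofReal_ccDist hW]
  exact dCC_le_degLen hζ hA

end

end

noncomputable section

/-! ### Distances within the fibre over a well -/

/-- The distance of two points of the fibre over `w` whose heights differ by `h`. -/
def fiberDist (W : ℝ × ℝ → ℝ) (pm pp w : ℝ × ℝ) (h : ℝ) : ℝ :=
  ccDist W pm pp (w.1, w.2, 0) (w.1, w.2, h)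

section

variable {W : ℝ × ℝ → ℝ} {pm pp w : ℝ × ℝ}

theorem ccDist_eq_fiberDist {P Q : ℝ × ℝ × ℝ} (hP : proj P = w) (hQ : proj Q = w) :
    ccDist W pm pp P Q = fiberDist W pm pp w (Q.2.2 - P.2.2) :=
  ccDist_eq_of_proj_eq (by rw [hP]; rfl) (by rw [hQ]; rfl) (by simp)

theorem fiberDist_nonneg (h : ℝ) : 0 ≤ fiberDist W pm pp w h := ccDist_nonneg _ _

theorem fiberDist_neg (h : ℝ) : fiberDist W pm pp w (-h) = fiberDist W pm pp w h := by
  unfold fiberDist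
  rw [ccDist_comm]
  exact ccDist_eq_of_proj_eq rfl rfl (by simp)

theorem fiberDist_abs (h : ℝ) : fiberDist W pm pp w |h| = fiberDist W pm pp w h := by
  rcases abs_choice h with e | e <;> rw [e]
  exact fiberDist_neg h

theorem fiberDist_zero : fiberDist W pm pp w 0 = 0 := by
  refine le_antisymm ?_ (fiberDist_nonneg 0)
  have hc : IsCurve pm pp 0 0 (fun _ => w) w w := by
    refine ⟨le_rfl, continuousOn_const, fun t _ => ?_, rfl, rfl⟩
    exact ⟨0, univ, univ_mem, (LipschitzWith.const w).lipschitzOnWith⟩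
  have := dCC_le_degLen (W := W) (P := (w.1, w.2, 0)) (Q := (w.1, w.2, 0)) hc (by
    rw [hasArea_iff]
    simp)
  have h0 : degLen (confFactor W) 0 0 (fun _ => w) = 0 := by simp [degLen]
  rw [h0] at this
  simp [fiberDist, ccDist, le_antisymm this zero_le]

theorem fiberDist_add_le (hW : TwoWell W pm pp) (h k : ℝ) :
    fiberDist W pm pp w (h + k) ≤ fiberDist W pm pp w h + fiberDist W pm pp w k := by
  have := ccDist_triangle hW (w.1, w.2, 0) (w.1, w.2, h) (w.1, w.2, h + k)
  refine this.trans_eq ?_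
  congr 1
  exact ccDist_eq_of_proj_eq rfl rfl (by simp)

end

namespace WellFrame

variable {W : ℝ × ℝ → ℝ} {w : ℝ × ℝ}

/-- The trace of `B`. -/
def tr (D : WellFrame W w) : ℝ := D.b₁₁ + D.b₂₂

theorem pos_snd (D : WellFrame W w) : 0 < D.b₂₂ := by
  have h1 := D.pos
  have h2 := D.det_pos
  by_contra h
  nlinarith [sq_nonneg D.b₁₂]

theorem tr_pos (D : WellFrame W w) : 0 < D.tr := add_pos D.pos D.pos_snd

/-- The square root of the determinant of `B`. -/
def freq (D : WellFrame W w) : ℝ := √(D.b₁₁ * D.b₂₂ - D.b₁₂ ^ 2)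

theorem freq_pos (D : WellFrame W w) : 0 < D.freq := Real.sqrt_pos.2 D.det_pos

theorem freq_sq (D : WellFrame W w) : D.freq ^ 2 = D.b₁₁ * D.b₂₂ - D.b₁₂ ^ 2 :=
  Real.sq_sqrt D.det_pos.le

/-- The quadratic potential `ψ` with `tr B · p₁ dp₂ = ⟨J B (p - w), dp⟩ + dψ`. -/
def pot (D : WellFrame W w) (p : ℝ × ℝ) : ℝ :=
  D.tr * w.1 * (p.2 - w.2) + D.b₂₂ * ((p.1 - w.1) * (p.2 - w.2)) +
    D.b₁₂ * (((p.1 - w.1) ^ 2 - (p.2 - w.2) ^ 2) / 2)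

theorem contDiff_pot (D : WellFrame W w) : ContDiff ℝ 1 D.pot := by
  unfold pot
  fun_prop

theorem hasDerivAt_pot (D : WellFrame W w) {x y : ℝ → ℝ} {x' y' t : ℝ} (hx : HasDerivAt x x' t)
    (hy : HasDerivAt y y' t) : HasDerivAt (fun s => D.pot (x s, y s))
      (D.tr * x t * y' - ((D.rot ((x t, y t) - w)).1 * x' + (D.rot ((x t, y t) - w)).2 * y')) t := by
  have h1 := hx.sub_const w.1
  have h2 := hy.sub_const w.2
  have := ((h2.const_mul (D.tr * w.1)).add ((h1.mul h2).const_mul D.b₂₂)).add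
    ((((h1.pow 2).sub (h2.pow 2)).div_const 2).const_mul D.b₁₂)
  convert! this using 1
  simp only [rot, tr, Prod.fst_sub, Prod.snd_sub]
  push_cast
  ring

theorem fderiv_pot (D : WellFrame W w) (p v : ℝ × ℝ) : fderiv ℝ D.pot p v =
    D.tr * p.1 * v.2 - ((D.rot (p - w)).1 * v.1 + (D.rot (p - w)).2 * v.2) := by
  have h1 : HasDerivAt (fun t : ℝ => p.1 + t * v.1) v.1 0 := by
    simpa using ((hasDerivAt_id (0 : ℝ)).mul_const v.1).const_add p.1
  have h2 : HasDerivAt (fun t : ℝ => p.2 + t * v.2) v.2 0 := by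
    simpa using ((hasDerivAt_id (0 : ℝ)).mul_const v.2).const_add p.2
  have h3 := D.hasDerivAt_pot h1 h2
  have hd : DifferentiableAt ℝ D.pot p := D.contDiff_pot.differentiable one_ne_zero p
  have hc : HasDerivAt (fun t : ℝ => D.pot (p.1 + t * v.1, p.2 + t * v.2))
      (fderiv ℝ D.pot p v) 0 :=
    HasFDerivAt.comp_hasDerivAt (0 : ℝ) (f := fun t : ℝ => (p.1 + t * v.1, p.2 + t * v.2))
      (l := D.pot) (l' := fderiv ℝ D.pot p) (by simpa using hd.hasFDerivAt) (h1.prodMk h2)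
  have h4 := hc.unique h3
  simpa using h4

theorem exists_rot_le (D : WellFrame W w) {ε : ℝ} (hε : 0 < ε) : ∃ r > 0, ∀ p, ‖p - w‖ < r →
    enorm2 (D.rot (p - w)) ≤ (1 + ε) * confFactor W p := by
  obtain ⟨c, hc, hlow⟩ := D.exists_rot_lower
  obtain ⟨r, hr, h⟩ := D.approx_rot (ε := c * (ε / (1 + ε))) (by positivity)
  refine ⟨r, hr, fun p hp => ?_⟩
  have h1 := (abs_le.1 (h p hp)).1
  have h2 := hlow (p - w)
  have h3 : c * (ε / (1 + ε)) * ‖p - w‖ ≤ ε / (1 + ε) * enorm2 (D.rot (p - w)) := by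
    rw [mul_comm c, mul_assoc]
    gcongr
  have h4 : enorm2 (D.rot (p - w)) - ε / (1 + ε) * enorm2 (D.rot (p - w)) ≤ confFactor W p := by
    linarith
  have h5 : enorm2 (D.rot (p - w)) - ε / (1 + ε) * enorm2 (D.rot (p - w)) =
      enorm2 (D.rot (p - w)) / (1 + ε) := by
    field_simp
    ring
  rw [h5, div_le_iff₀ (by positivity)] at h4
  linarith

/-- Near a well the vector field `J B (p - w)` almost calibrates the isoperimetric quotient. -/
theorem exists_tr_mul_abs_le {pm pp : ℝ × ℝ} (hW : TwoWell W pm pp) (D : WellFrame W w)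
    {ε : ℝ} (hε : 0 < ε) : ∃ δ > 0, ∀ h, fiberDist W pm pp w h < δ →
      D.tr * |h| ≤ (1 + ε) * fiberDist W pm pp w h := by
  obtain ⟨r, hr, hrot⟩ := D.exists_rot_le hε
  obtain ⟨δ, hδ, hstay⟩ := hW.exists_stay w hr
  obtain ⟨C, hC, hform⟩ := hW.exists_norm_areaForm_le (‖w‖ + r)
  refine ⟨δ, hδ, fun h hh => ?_⟩
  have key : ∀ x, fiberDist W pm pp w h < x → x ≤ δ → D.tr * |h| ≤ (1 + ε) * x := by
    intro x hx hxδ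
    obtain ⟨a, b, γ, hγ, ha, hb, hA, hE⟩ := exists_finCurve_of_ccDist_lt hW hx
    have ha' : γ a = w := ha
    have hb' : γ b = w := hb
    have hnear := hstay a b γ hγ (by rw [ha']; simpa using hδ) (hE.le.trans hxδ)
    obtain ⟨hAi, hA⟩ := (hasArea_iff _).1 hA
    rw [ha', hb'] at hA
    set u : ℝ × ℝ → ℝ := fun p => D.pot p - D.tr * wellPot pm pp p with hu
    have hu1 : ContDiff ℝ 1 u := by
      have := D.contDiff_pot
      have := contDiff_wellPot pm pp
      fun_prop
    have hdu : ∀ p v, fderiv ℝ u p v = D.tr * areaForm pm pp p v -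
        ((D.rot (p - w)).1 * v.1 + (D.rot (p - w)).2 * v.2) := by
      intro p v
      have e1 := (D.contDiff_pot.differentiable one_ne_zero p).hasFDerivAt
      have e2 := ((contDiff_wellPot pm pp).differentiable one_ne_zero p).hasFDerivAt
      have e3 := (e1.sub (e2.const_mul D.tr)).fderiv
      have e4 : fderiv ℝ u p v = fderiv ℝ D.pot p v - D.tr * fderiv ℝ (wellPot pm pp) p v := by
        have := congrArg (fun L : ℝ × ℝ →L[ℝ] ℝ => L v) e3
        exact this
      rw [e4, areaForm_apply, D.fderiv_pot]
      ring
    have hrotv : ∀ t ∈ Icc a b, ∀ v : ℝ × ℝ,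
        |(D.rot (γ t - w)).1 * v.1 + (D.rot (γ t - w)).2 * v.2| ≤
          (1 + ε) * (confFactor W (γ t) * enorm2 v) := by
      intro t ht v
      refine (abs_dot_le _ _).trans ?_
      rw [← mul_assoc]
      exact mul_le_mul_of_nonneg_right (hrot _ (hnear t ht)) (enorm2_nonneg _)
    have hintv := hγ.1.integral_fderiv hW hγ.2 hu1 (C := D.tr * C + (1 + ε))
      (by have := D.tr_pos; positivity) (by
        intro t ht v
        rw [hdu]
        refine (abs_sub _ _).trans ?_
        rw [abs_mul, abs_of_pos D.tr_pos, add_mul, mul_assoc]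
        have hn : ‖γ t‖ ≤ ‖w‖ + r := by
          have := norm_add_le (γ t - w) w
          rw [sub_add_cancel] at this
          linarith [hnear t ht]
        exact add_le_add (mul_le_mul_of_nonneg_left (hform _ hn v) D.tr_pos.le) (hrotv t ht v))
    rw [ha', hb', sub_self] at hintv
    have hsum : D.tr * h = ∫ t in a..b, ((D.rot (γ t - w)).1 * (deriv γ t).1 +
        (D.rot (γ t - w)).2 * (deriv γ t).2) := by
      have e : ∀ t, (D.rot (γ t - w)).1 * (deriv γ t).1 + (D.rot (γ t - w)).2 * (deriv γ t).2 =
          D.tr * areaForm pm pp (γ t) (deriv γ t) - fderiv ℝ u (γ t) (deriv γ t) := by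
        intro t
        rw [hdu]
        ring
      simp only [e]
      rw [intervalIntegral.integral_sub (hAi.const_mul _) hintv.1, hintv.2,
        intervalIntegral.integral_const_mul, sub_zero]
      have : h = ∫ t in a..b, areaForm pm pp (γ t) (deriv γ t) := by simpa using hA
      rw [← this]
    have hle : |D.tr * h| ≤ ∫ t in a..b, (1 + ε) * degSpeed W γ t := by
      rw [hsum, ← Real.norm_eq_abs]
      refine intervalIntegral.norm_integral_le_of_norm_le hγ.1.1 ?_ (hγ.2.const_mul _)
      exact Eventually.of_forall fun t ht => hrotv t (Ioc_subset_Icc_self ht) _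
    rw [intervalIntegral.integral_const_mul, abs_mul, abs_of_pos D.tr_pos] at hle
    refine hle.trans ?_
    gcongr
  have hl : Tendsto (fun x : ℝ => (1 + ε) * x) (𝓝[>] (fiberDist W pm pp w h))
      (𝓝 ((1 + ε) * fiberDist W pm pp w h)) :=
    tendsto_nhdsWithin_of_tendsto_nhds (tendsto_id.const_mul _)
  refine ge_of_tendsto hl ?_
  filter_upwards [Ioo_mem_nhdsGT hh] with x hx
  exact key x hx.1 hx.2.le

/-- The closed orbits of the vector field `J B (p - w)`. -/
def orbit (D : WellFrame W w) (r t : ℝ) : ℝ × ℝ :=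
  (w.1 + (r * Real.cos (D.freq * t) - D.b₁₂ / D.freq * r * Real.sin (D.freq * t)),
    w.2 + D.b₁₁ / D.freq * r * Real.sin (D.freq * t))

theorem contDiff_orbit (D : WellFrame W w) (r : ℝ) : ContDiff ℝ 1 (D.orbit r) := by
  unfold orbit
  fun_prop

theorem hasDerivAt_orbit (D : WellFrame W w) (r t : ℝ) :
    HasDerivAt (D.orbit r) (D.rot (D.orbit r t - w)) t := by
  have hm : HasDerivAt (fun s : ℝ => D.freq * s) D.freq t := by
    simpa using (hasDerivAt_id t).const_mul D.freq
  have hs := hm.sin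
  have hc := hm.cos
  have h1 := ((hc.const_mul r).sub (hs.const_mul (D.b₁₂ / D.freq * r))).const_add w.1
  have h2 := (hs.const_mul (D.b₁₁ / D.freq * r)).const_add w.2
  convert! h1.prodMk h2 using 1
  have hf := D.freq_pos.ne'
  have hf2 := D.freq_sq
  simp only [rot, orbit, Prod.fst_sub, Prod.snd_sub, add_sub_cancel_left, Prod.mk.injEq]
  constructor
  · field_simp
    linear_combination (r * Real.sin (D.freq * t)) * hf2
  · field_simp
    ring

theorem exists_orbit_bound (D : WellFrame W w) : ∃ C > 0, ∀ r t, 0 ≤ r →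
    ‖D.orbit r t - w‖ ≤ C * r := by
  have hf := D.freq_pos
  have hb := D.pos
  refine ⟨1 + |D.b₁₂| / D.freq + D.b₁₁ / D.freq, by positivity, fun r t hr => ?_⟩
  have hs := Real.abs_sin_le_one (D.freq * t)
  have hc := Real.abs_cos_le_one (D.freq * t)
  have e1 : |r * Real.cos (D.freq * t)| ≤ r := by
    rw [abs_mul, abs_of_nonneg hr]
    nlinarith
  have e2 : |D.b₁₂ / D.freq * r * Real.sin (D.freq * t)| ≤ |D.b₁₂| / D.freq * r := by
    rw [abs_mul, abs_mul, abs_div, abs_of_pos hf, abs_of_nonneg hr]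
    exact mul_le_of_le_one_right (by positivity) hs
  have e3 : |D.b₁₁ / D.freq * r * Real.sin (D.freq * t)| ≤ D.b₁₁ / D.freq * r := by
    rw [abs_mul, abs_mul, abs_div, abs_of_pos hf, abs_of_nonneg hr, abs_of_pos hb]
    exact mul_le_of_le_one_right (by positivity) hs
  have p2 : 0 ≤ |D.b₁₂| / D.freq * r := by positivity
  have p3 : 0 ≤ D.b₁₁ / D.freq * r := by positivity
  rw [Prod.norm_def]
  simp only [orbit, Prod.fst_sub, Prod.snd_sub, add_sub_cancel_left, Real.norm_eq_abs]
  refine max_le ((abs_sub _ _).trans ?_) ?_ <;> linarith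

/-- Windings of a closed orbit: the height gained and the length spent. -/
theorem ccDist_orbit_le {pm pp : ℝ × ℝ} (hW : TwoWell W pm pp) (D : WellFrame W w) {r κ : ℝ}
    (n : ℕ) (hκ : ∀ t, confFactor W (D.orbit r t) * enorm2 (D.rot (D.orbit r t - w)) ≤
      enorm2 (D.rot (D.orbit r t - w)) ^ 2 + κ) {h : ℝ}
    (hh : h = D.b₁₁ * r ^ 2 * (n * Real.pi / D.freq)) (z : ℝ) :
    ccDist W pm pp (w.1 + r, w.2, z) (w.1 + r, w.2, z + h) ≤
      D.tr * h + κ * (n * (2 * Real.pi) / D.freq) := by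
  have hf := D.freq_pos
  set T := n * (2 * Real.pi) / D.freq with hT
  have hT0 : 0 ≤ T := by positivity
  have hfT : D.freq * T = n * (2 * Real.pi) := by rw [hT]; field_simp
  have hsT : Real.sin (D.freq * T) = 0 := by
    rw [hfT, show (n : ℝ) * (2 * Real.pi) = (2 * n : ℕ) * Real.pi by push_cast; ring]
    exact Real.sin_nat_mul_pi _
  have hcT : Real.cos (D.freq * T) = 1 := by
    rw [hfT]
    exact Real.cos_nat_mul_two_pi n
  have h0 : D.orbit r 0 = (w.1 + r, w.2) := by simp [orbit]
  have h1 : D.orbit r T = (w.1 + r, w.2) := by simp [orbit, hsT, hcT]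
  have hderiv : ∀ t, deriv (D.orbit r) t = D.rot (D.orbit r t - w) := fun t =>
    (D.hasDerivAt_orbit r t).deriv
  obtain ⟨K, hK⟩ := LocallyLipschitzOn.exists_lipschitzOnWith_of_compact
    (isCompact_Icc (a := 0) (b := T)) ((D.contDiff_orbit r).locallyLipschitz.locallyLipschitzOn)
  have hcurve := IsCurve.of_lipschitzOnWith (pm := pm) (pp := pp) hT0 hK
  have hx : ∀ t, HasDerivAt (fun s => (D.orbit r s).1) (D.rot (D.orbit r t - w)).1 t := fun t =>
    (ContinuousLinearMap.fst ℝ ℝ ℝ).hasFDerivAt.comp_hasDerivAt t (D.hasDerivAt_orbit r t)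
  have hy : ∀ t, HasDerivAt (fun s => (D.orbit r s).2) (D.rot (D.orbit r t - w)).2 t := fun t =>
    (ContinuousLinearMap.snd ℝ ℝ ℝ).hasFDerivAt.comp_hasDerivAt t (D.hasDerivAt_orbit r t)
  have hcont := (D.contDiff_orbit r).continuous
  have hrotc : Continuous fun t => D.rot (D.orbit r t - w) := by
    unfold rot
    fun_prop
  set G : ℝ → ℝ := fun t => w.1 * (D.b₁₁ / D.freq * r * Real.sin (D.freq * t)) +
    D.b₁₁ * r ^ 2 * (t / 2 + Real.sin (D.freq * t) * Real.cos (D.freq * t) / (2 * D.freq)) -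
    D.b₁₂ * D.b₁₁ / (2 * D.freq ^ 2) * r ^ 2 * Real.sin (D.freq * t) ^ 2 with hG
  have hGd : ∀ t, HasDerivAt G ((D.orbit r t).1 * (D.rot (D.orbit r t - w)).2) t := by
    intro t
    have hm : HasDerivAt (fun s : ℝ => D.freq * s) D.freq t := by
      simpa using (hasDerivAt_id t).const_mul D.freq
    have hs := hm.sin
    have hc := hm.cos
    have := (((hs.const_mul (D.b₁₁ / D.freq * r)).const_mul w.1).add
      ((((hasDerivAt_id t).div_const 2).add ((hs.mul hc).div_const (2 * D.freq))).const_mul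
        (D.b₁₁ * r ^ 2))).sub ((hs.pow 2).const_mul (D.b₁₂ * D.b₁₁ / (2 * D.freq ^ 2) * r ^ 2))
    convert! this using 1
    have hcs := Real.sin_sq_add_cos_sq (D.freq * t)
    simp only [rot, orbit, Prod.fst_sub, Prod.snd_sub, add_sub_cancel_left]
    push_cast
    field_simp
    linear_combination (D.freq ^ 2 * D.b₁₁ * r ^ 2) * hcs
  have hGT : G T - G 0 = h := by
    rw [hG]
    simp only [hsT, hcT, mul_zero, Real.sin_zero]
    rw [hh, hT]
    field_simp
    ring
  have hgi : ∀ (a b : ℝ), IntervalIntegrable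
      (fun t => (D.orbit r t).1 * (D.rot (D.orbit r t - w)).2) volume a b := fun a b =>
    Continuous.intervalIntegrable (by fun_prop) a b
  have hAint : ∫ t in (0 : ℝ)..T, (D.orbit r t).1 * (D.rot (D.orbit r t - w)).2 = h := by
    rw [intervalIntegral.integral_eq_sub_of_hasDerivAt (fun t _ => hGd t) (hgi _ _), hGT]
  have hA : HasArea pm pp 0 T (D.orbit r) h := by
    rw [hasArea_iff_of_lipschitz pm pp hT0 hK]
    rw [← hAint]
    congr 1
    ext t
    rw [(hy t).deriv]
  have hVint : ∫ t in (0 : ℝ)..T, enorm2 (D.rot (D.orbit r t - w)) ^ 2 = D.tr * h := by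
    have hd : ∀ t, HasDerivAt (fun s => D.tr * G s - D.pot (D.orbit r s))
        (enorm2 (D.rot (D.orbit r t - w)) ^ 2) t := by
      intro t
      have := ((hGd t).const_mul D.tr).sub (D.hasDerivAt_pot (hx t) (hy t))
      convert! this using 1
      rw [enorm2_sq]
      ring
    rw [intervalIntegral.integral_eq_sub_of_hasDerivAt (fun t _ => hd t)
      (Continuous.intervalIntegrable (by have := continuous_enorm2; fun_prop) _ _), h0, h1, ← hGT]
    ring
  have hFc := hW.continuous_confFactor
  have hds : degSpeed W (D.orbit r) =
      fun t => confFactor W (D.orbit r t) * enorm2 (D.rot (D.orbit r t - w)) := by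
    ext t
    rw [degSpeed, hderiv]
  have hdsc : Continuous (degSpeed W (D.orbit r)) := by
    rw [hds]
    have := continuous_enorm2
    fun_prop
  rw [h0, h1] at hcurve
  refine (ccDist_le_integral (P := (w.1 + r, w.2, z)) (Q := (w.1 + r, w.2, z + h)) hcurve
    (by simpa using hA) (hdsc.intervalIntegrable _ _)).trans ?_
  have i1 : IntervalIntegrable (fun t => enorm2 (D.rot (D.orbit r t - w)) ^ 2) volume 0 T :=
    Continuous.intervalIntegrable (by have := continuous_enorm2; fun_prop) _ _
  calc _ ≤ ∫ t in (0 : ℝ)..T, (enorm2 (D.rot (D.orbit r t - w)) ^ 2 + κ) := by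
        refine intervalIntegral.integral_mono_on hT0 (hdsc.intervalIntegrable _ _)
          (i1.add intervalIntegrable_const) fun t _ => ?_
        rw [hds]
        exact hκ t
    _ = _ := by
        rw [intervalIntegral.integral_add i1 intervalIntegrable_const, hVint,
          intervalIntegral.integral_const, sub_zero, smul_eq_mul]
        ring

/-- In the fibre over a well the distance is at most `tr B` times the height difference. -/
theorem fiberDist_le {pm pp : ℝ × ℝ} (hW : TwoWell W pm pp) (D : WellFrame W w) (h : ℝ) :
    fiberDist W pm pp w h ≤ D.tr * |h| := by
  rw [← fiberDist_abs]
  generalize hh' : |h| = k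
  have hk : 0 ≤ k := hh' ▸ abs_nonneg h
  rcases hk.eq_or_lt with rfl | hk
  · rw [fiberDist_zero, mul_zero]
  obtain ⟨C, hC, horb⟩ := D.exists_orbit_bound
  obtain ⟨C₂, hC₂, hup⟩ := D.exists_rot_upper
  obtain ⟨_, _, C', hC', r₀, hr₀, hFb⟩ := D.exists_confFactor_bounds
  have hf := D.freq_pos
  have hb := D.pos
  have hpi := Real.pi_pos
  have key : ∀ ε > 0, fiberDist W pm pp w k ≤
      D.tr * k + ε * (C₂ * C ^ 2 * (2 * k / D.b₁₁) + 2 * C') := by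
    intro ε hε
    obtain ⟨rε, hrε, happ⟩ := D.approx_rot hε
    set s := min (min r₀ (rε / C)) (min 1 ε) with hs
    have hs0 : 0 < s := by positivity
    set N₀ := k * D.freq / (D.b₁₁ * Real.pi) with hN₀
    have hN₀p : 0 < N₀ := by positivity
    obtain ⟨n, hn⟩ := exists_nat_gt (N₀ / s ^ 2)
    have hn0 : (0 : ℝ) < n := (by positivity : 0 < N₀ / s ^ 2).trans hn
    set r := √(N₀ / n) with hr
    have hr2 : r ^ 2 = N₀ / n := Real.sq_sqrt (by positivity)
    have hr0 : 0 < r := Real.sqrt_pos.2 (by positivity)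
    have hrs : r < s := by
      refine lt_of_pow_lt_pow_left₀ 2 hs0.le ?_
      rw [hr2, div_lt_iff₀ hn0]
      rw [div_lt_iff₀ (by positivity)] at hn
      linarith
    have hrr₀ : r < r₀ := hrs.trans_le ((min_le_left _ _).trans (min_le_left _ _))
    have hrC : r * C < rε := by
      have := hrs.trans_le ((min_le_left _ _).trans (min_le_right _ _))
      rwa [lt_div_iff₀ hC] at this
    have hr1 : r ≤ 1 := (hrs.trans_le ((min_le_right _ _).trans (min_le_left _ _))).le
    have hrε' : r ≤ ε := (hrs.trans_le ((min_le_right _ _).trans (min_le_right _ _))).le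
    have hsq : r ^ 2 ≤ ε := by nlinarith
    have hκ : ∀ t, confFactor W (D.orbit r t) * enorm2 (D.rot (D.orbit r t - w)) ≤
        enorm2 (D.rot (D.orbit r t - w)) ^ 2 + ε * C₂ * C ^ 2 * r ^ 2 := by
      intro t
      have b1 := horb r t hr0.le
      have b2 := (abs_le.1 (happ (D.orbit r t) (by linarith))).2
      have b3 := hup (D.orbit r t - w)
      set q := ‖D.orbit r t - w‖ with hq
      set v := enorm2 (D.rot (D.orbit r t - w)) with hv
      have hv0 : 0 ≤ v := enorm2_nonneg _
      have hq0 : 0 ≤ q := norm_nonneg _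
      calc _ ≤ (v + ε * q) * v := by gcongr; linarith
        _ = v ^ 2 + ε * (q * v) := by ring
        _ ≤ v ^ 2 + ε * ((C * r) * (C₂ * (C * r))) := by
            gcongr
            exact b3.trans (by gcongr)
        _ = _ := by ring
    have hkr : k = D.b₁₁ * r ^ 2 * (n * Real.pi / D.freq) := by
      rw [hr2, hN₀]
      field_simp
    have hor := fun z => D.ccDist_orbit_le (pm := pm) (pp := pp) hW n hκ hkr z
    have hseg : ∀ z, ccDist W pm pp (w.1, w.2, z) (w.1 + r, w.2, z) ≤ C' * r * r := by
      intro z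
      have hM : ∀ x, ‖x - w‖ ≤ r → confFactor W x ≤ C' * r := by
        intro x hx
        refine (hFb x (by linarith)).2.trans ?_
        gcongr
      have := dCC_segment_le (pm := pm) (pp := pp) hM (p := w) (q := (w.1 + r, w.2))
        (by simpa using hr0.le) (by
          rw [Prod.norm_def]
          simp [abs_of_pos hr0, hr0.le]) z
      have e1 : enorm2 ((w.1 + r, w.2) - w) = r := by
        simp [enorm2, Real.sqrt_sq hr0.le]
      rw [e1] at this
      simp only [sub_self, mul_zero, add_zero] at this
      exact ENNReal.toReal_le_of_le_ofReal (by positivity) this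
    have t1 := ccDist_triangle hW (w.1, w.2, 0) (w.1 + r, w.2, 0) (w.1, w.2, k)
    have t2 := ccDist_triangle hW (w.1 + r, w.2, 0) (w.1 + r, w.2, k) (w.1, w.2, k)
    have t3 := hor 0
    rw [zero_add] at t3
    have t4 := hseg k
    rw [ccDist_comm] at t4
    have t5 := hseg 0
    have e1 : ε * C₂ * C ^ 2 * r ^ 2 * (n * (2 * Real.pi) / D.freq) =
        ε * (C₂ * C ^ 2 * (2 * k / D.b₁₁)) := by
      rw [hkr]
      field_simp
    have e2 : C' * r * r ≤ C' * ε := by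
      rw [mul_assoc, ← sq]
      gcongr
    rw [e1] at t3
    have : fiberDist W pm pp w k ≤ C' * ε + (D.tr * k + ε * (C₂ * C ^ 2 * (2 * k / D.b₁₁)) + C' * ε) := by
      unfold fiberDist
      linarith
    linarith
  have hl : Tendsto (fun ε : ℝ => D.tr * k + ε * (C₂ * C ^ 2 * (2 * k / D.b₁₁) + 2 * C')) (𝓝[>] 0)
      (𝓝 (D.tr * k)) := by
    have : Continuous fun ε : ℝ => D.tr * k + ε * (C₂ * C ^ 2 * (2 * k / D.b₁₁) + 2 * C') := by
      fun_prop
    have := this.tendsto 0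
    simp only [zero_mul, add_zero] at this
    exact tendsto_nhdsWithin_of_tendsto_nhds this
  refine ge_of_tendsto hl ?_
  filter_upwards [self_mem_nhdsWithin] with ε hε
  exact key ε hε

end WellFrame

end

noncomputable section

/-! ### Geodesics which spend positive time in the fibre over a well -/

section

variable {W : ℝ × ℝ → ℝ} {pm pp w : ℝ × ℝ}

/-- A decomposition of a height increment `Δ` over a time `τ`, spent with speed `d`: a part `V`
gained during a time `ℓ` almost within the fibre, and a part `B` gained during the rest. -/
def FiberSplit (W : ℝ × ℝ → ℝ) (pm pp w : ℝ × ℝ) (lam ε d m τ Δ : ℝ) : Prop :=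
  ∃ V B ℓ : ℝ, Δ = V + B ∧ fiberDist W pm pp w B ≤ d * (τ - ℓ) ∧ lam * |V| ≤ (1 + ε) * (d * ℓ) ∧
    m ≤ ℓ

theorem FiberSplit.add (hW : TwoWell W pm pp) {lam ε d m₁ m₂ m τ₁ τ₂ Δ₁ Δ₂ : ℝ} (hlam : 0 ≤ lam)
    (h₁ : FiberSplit W pm pp w lam ε d m₁ τ₁ Δ₁) (h₂ : FiberSplit W pm pp w lam ε d m₂ τ₂ Δ₂)
    (hm : m ≤ m₁ + m₂) : FiberSplit W pm pp w lam ε d m (τ₁ + τ₂) (Δ₁ + Δ₂) := by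
  obtain ⟨V₁, B₁, ℓ₁, e₁, b₁, v₁, k₁⟩ := h₁
  obtain ⟨V₂, B₂, ℓ₂, e₂, b₂, v₂, k₂⟩ := h₂
  refine ⟨V₁ + V₂, B₁ + B₂, ℓ₁ + ℓ₂, by rw [e₁, e₂]; ring, ?_, ?_, by linarith⟩
  · have := fiberDist_add_le (w := w) hW B₁ B₂
    linarith
  · have := mul_le_mul_of_nonneg_left (abs_add_le V₁ V₂) hlam
    linarith

theorem WellFrame.exists_tr_mul_le_fiberDist (hW : TwoWell W pm pp) (D : WellFrame W w)
    {a b d : ℝ} (hd : 0 < d) {Γ : ℝ → ℝ × ℝ × ℝ}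
    (hΓ : ∀ s t, a ≤ s → s ≤ t → t ≤ b → ccDist W pm pp (Γ s) (Γ t) = d * (t - s))
    (hc : ContinuousOn (projCurve Γ) (Icc a b))
    (hK : volume {t | t ∈ Icc a b ∧ projCurve Γ t = w} ≠ 0) :
    ∃ v₀ > 0, ∀ h ∈ Icc 0 v₀, D.tr * h ≤ fiberDist W pm pp w h := by
  set K := {t | t ∈ Icc a b ∧ projCurve Γ t = w} with hKdef
  have hKc : IsCompact K := by
    have : IsClosed K := hc.preimage_isClosed_of_isClosed isClosed_Icc isClosed_singleton
    exact isCompact_Icc.of_isClosed_subset this fun t ht => ht.1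
  have hfin : ∀ s t : ℝ, volume (K ∩ Icc s t) ≠ ⊤ := fun s t =>
    (measure_mono inter_subset_right).trans_lt (by simp) |>.ne
  have hKne : K.Nonempty := nonempty_of_measure_ne_zero hK
  have hρ : ∀ s ∈ K, ∀ t ∈ K, s ≤ t →
      fiberDist W pm pp w ((Γ t).2.2 - (Γ s).2.2) = d * (t - s) := by
    intro s hs t ht hst
    rw [← hΓ s t hs.1.1 hst ht.1.2]
    exact (ccDist_eq_fiberDist hs.2 ht.2).symm
  have hsplit : ∀ ε > 0, ∀ s ∈ K, ∀ t ∈ K, s ≤ t →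
      FiberSplit W pm pp w D.tr ε d (volume.real (K ∩ Icc s t)) (t - s)
        ((Γ t).2.2 - (Γ s).2.2) := by
    intro ε hε
    obtain ⟨δ, hδ, hcal⟩ := D.exists_tr_mul_abs_le hW hε
    set η := δ / (2 * d) with hη
    have hη0 : 0 < η := by positivity
    have hshort : ∀ s ∈ K, ∀ t ∈ K, s ≤ t → t - s ≤ η →
        FiberSplit W pm pp w D.tr ε d (volume.real (K ∩ Icc s t)) (t - s)
          ((Γ t).2.2 - (Γ s).2.2) := by
      intro s hs t ht hst hle
      have e := hρ s hs t ht hst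
      refine ⟨_, 0, t - s, (add_zero _).symm, by rw [fiberDist_zero]; simp, ?_, ?_⟩
      · rw [← e]
        refine hcal _ ?_
        rw [e]
        have : d * (t - s) ≤ d * η := by gcongr
        have : d * η = δ / 2 := by rw [hη]; field_simp
        linarith
      · have : volume.real (K ∩ Icc s t) ≤ volume.real (Icc s t) :=
          measureReal_mono inter_subset_right (by simp)
        simpa [hst] using this
    have hgap : ∀ s ∈ K, ∀ t ∈ K, s ≤ t → K ∩ Ioo s t = ∅ →
        FiberSplit W pm pp w D.tr ε d (volume.real (K ∩ Icc s t)) (t - s)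
          ((Γ t).2.2 - (Γ s).2.2) := by
      intro s hs t ht hst hem
      refine ⟨0, _, 0, (zero_add _).symm, by rw [hρ s hs t ht hst, sub_zero], by simp, ?_⟩
      have hsub : K ∩ Icc s t ⊆ {s, t} := by
        rintro x ⟨hx, hx1, hx2⟩
        by_contra hne
        simp only [mem_insert_iff, mem_singleton_iff, not_or] at hne
        have : x ∈ K ∩ Ioo s t :=
          ⟨hx, lt_of_le_of_ne hx1 (Ne.symm hne.1), lt_of_le_of_ne hx2 hne.2⟩
        rw [hem] at this
        exact this
      have h0 : volume (K ∩ Icc s t) = 0 :=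
        measure_mono_null hsub ((toFinite {s, t}).measure_zero volume)
      simp [Measure.real, h0]
    have hmeas : ∀ x y z : ℝ, volume.real (K ∩ Icc x z) ≤
        volume.real (K ∩ Icc x y) + volume.real (K ∩ Icc y z) := by
      intro x y z
      refine (measureReal_mono ?_ (measure_union_ne_top (hfin x y) (hfin y z))).trans
        (measureReal_union_le _ _)
      rintro u ⟨hu, hu1, hu2⟩
      rcases le_total u y with h | h
      · exact Or.inl ⟨hu, hu1, h⟩
      · exact Or.inr ⟨hu, h, hu2⟩
    have hind : ∀ n : ℕ, ∀ s ∈ K, ∀ t ∈ K, s ≤ t → t - s ≤ n * η →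
        FiberSplit W pm pp w D.tr ε d (volume.real (K ∩ Icc s t)) (t - s)
          ((Γ t).2.2 - (Γ s).2.2) := by
      intro n
      induction n with
      | zero =>
        intro s hs t ht hst hle
        exact hshort s hs t ht hst (by push_cast at hle; linarith)
      | succ n ih =>
        intro s hs t ht hst hle
        rcases le_or_gt (t - s) η with h | h
        · exact hshort s hs t ht hst h
        obtain ⟨x, ⟨hxK, hx1, hx2⟩, hxmax⟩ := (hKc.inter_right (isClosed_Icc (a := s)
          (b := s + η))).exists_isGreatest ⟨s, hs, le_rfl, by linarith⟩
        obtain ⟨y, ⟨hyK, hy1, hy2⟩, hymin⟩ := (hKc.inter_right (isClosed_Icc (a := s + η)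
          (b := t))).exists_isLeast ⟨t, ht, by linarith, le_rfl⟩
        have hem : K ∩ Ioo x y = ∅ := by
          refine eq_empty_of_forall_notMem fun u hu => ?_
          obtain ⟨huK, hu1, hu2⟩ := hu
          rcases le_total u (s + η) with h' | h'
          · exact absurd (hxmax ⟨huK, by linarith, h'⟩) (not_le.2 hu1)
          · exact absurd (hymin ⟨huK, h', by linarith⟩) (not_le.2 hu2)
        have f1 := hshort s hs x hxK hx1 (by linarith)
        have f2 := hgap x hxK y hyK (by linarith) hem
        have f3 := ih y hyK t ht hy2 (by push_cast at hle; linarith)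
        have f := (f1.add hW D.tr_pos.le f2 (hmeas s x y)).add hW D.tr_pos.le f3 (hmeas s y t)
        convert f using 1 <;> ring
    intro s hs t ht hst
    obtain ⟨n, hn⟩ := exists_nat_gt ((t - s) / η)
    refine hind n s hs t ht hst ?_
    rw [div_lt_iff₀ hη0] at hn
    exact hn.le
  obtain ⟨t₀, ht₀, hmin⟩ := hKc.exists_isLeast hKne
  obtain ⟨t₁, ht₁, hmax⟩ := hKc.exists_isGreatest hKne
  have h01 : t₀ ≤ t₁ := hmin ht₁
  have hKeq : K ∩ Icc t₀ t₁ = K := inter_eq_left.2 fun t ht => ⟨hmin ht, hmax ht⟩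
  set m := volume.real K with hm
  have hm0 : 0 < m := by
    have := hfin t₀ t₁
    rw [hKeq] at this
    exact ENNReal.toReal_pos hK this
  have hlam := D.tr_pos
  refine ⟨d * m / D.tr, by positivity, fun h hh => ?_⟩
  have key : ∀ ε > 0, D.tr * h ≤ fiberDist W pm pp w h + ε * (d * (t₁ - t₀)) := by
    intro ε hε
    obtain ⟨V, B, ℓ, e, b, v, k⟩ := hsplit ε hε t₀ ht₀ t₁ ht₁ h01
    rw [hKeq, ← hm] at k
    have hr := hρ t₀ ht₀ t₁ ht₁ h01
    rw [e] at hr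
    have s1 := fiberDist_add_le (w := w) hW V B
    have s2 := D.fiberDist_le (pm := pm) (pp := pp) hW V
    have s3 : d * ℓ ≤ fiberDist W pm pp w V := by linarith
    have s4 : d * m ≤ d * ℓ := by gcongr
    have hhV : h ≤ |V| := by
      refine hh.2.trans ?_
      rw [div_le_iff₀ hlam]
      linarith
    have s5 := fiberDist_add_le (w := w) hW h (|V| - h)
    rw [add_sub_cancel, fiberDist_abs] at s5
    have s6 := D.fiberDist_le (pm := pm) (pp := pp) hW (|V| - h)
    rw [abs_of_nonneg (by linarith : 0 ≤ |V| - h)] at s6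
    have s7 : d * ℓ ≤ d * (t₁ - t₀) := by
      have := fiberDist_nonneg (W := W) (pm := pm) (pp := pp) (w := w) B
      linarith
    have s8 : ε * (d * ℓ) ≤ ε * (d * (t₁ - t₀)) := by gcongr
    linarith
  have hl : Tendsto (fun ε : ℝ => fiberDist W pm pp w h + ε * (d * (t₁ - t₀))) (𝓝[>] 0)
      (𝓝 (fiberDist W pm pp w h)) := by
    have : Continuous fun ε : ℝ => fiberDist W pm pp w h + ε * (d * (t₁ - t₀)) := by fun_prop
    have := this.tendsto 0
    simp only [zero_mul, add_zero] at this
    exact tendsto_nhdsWithin_of_tendsto_nhds this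
  refine ge_of_tendsto hl ?_
  filter_upwards [self_mem_nhdsWithin] with ε hε
  exact key ε hε

end

end

noncomputable section

/-! ### The Euler-Lagrange equation for the magnetic energy -/

theorem intervalIntegrable_of_bounded {f : ℝ → ℝ} {a b C : ℝ} (hab : a ≤ b)
    (hf : AEStronglyMeasurable f (volume.restrict (Icc a b))) (hC : ∀ t ∈ Ioo a b, |f t| ≤ C) :
    IntervalIntegrable f volume a b := by
  rw [intervalIntegrable_iff_integrableOn_Icc_of_le hab]
  refine Integrable.of_bound hf C ?_
  rw [← Measure.restrict_congr_set Ioo_ae_eq_Icc]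
  exact (ae_restrict_iff' measurableSet_Ioo).2 (Eventually.of_forall hC)

/-- The lemma of du Bois-Reymond, for bounded functions and one-sided variations. -/
theorem ae_eq_const_add_integral_of_forall_integral_nonpos {f g : ℝ → ℝ} {a b M : ℝ} (hab : a < b)
    (hf : IntervalIntegrable f volume a b) (hfM : ∀ t ∈ Ioo a b, |f t| ≤ M)
    (hg : IntervalIntegrable g volume a b)
    (H : ∀ (k : ℝ → ℝ) (C : ℝ), IntervalIntegrable k volume a b → (∀ t ∈ Ioo a b, |k t| ≤ C) →
      ∫ t in a..b, k t = 0 → ∫ t in a..b, (f t * k t + g t * ∫ s in a..t, k s) ≤ 0) :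
    ∃ c, ∀ᵐ t : ℝ, t ∈ Ioo a b → f t = c + ∫ s in a..t, g s := by
  have huI : uIcc a b = Icc a b := uIcc_of_le hab.le
  set G : ℝ → ℝ := fun t => ∫ s in a..t, g s with hG
  have hGac : AbsolutelyContinuousOnInterval G a b :=
    hg.absolutelyContinuousOnInterval_intervalIntegral left_mem_uIcc
  have hGi : IntervalIntegrable G volume a b := hGac.continuousOn.intervalIntegrable
  obtain ⟨B, hB⟩ := isCompact_Icc.exists_bound_of_continuousOn (huI ▸ hGac.continuousOn)
  set c := (∫ t in a..b, (f t - G t)) / (b - a) with hc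
  set k : ℝ → ℝ := fun t => f t - G t - c with hk
  have hki : IntervalIntegrable k volume a b := (hf.sub hGi).sub intervalIntegrable_const
  have hkC : ∀ t ∈ Ioo a b, |k t| ≤ M + B + |c| := by
    intro t ht
    have h1 := hfM t ht
    have h2 := hB t (Ioo_subset_Icc_self ht)
    rw [Real.norm_eq_abs] at h2
    have h3 := abs_sub (f t - G t) c
    have h4 := abs_sub (f t) (G t)
    simp only [hk]
    linarith
  have hk0 : ∫ t in a..b, k t = 0 := by
    have hne : b - a ≠ 0 := (sub_pos.2 hab).ne'
    simp only [hk]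
    rw [intervalIntegral.integral_sub (hf.sub hGi) intervalIntegrable_const,
      intervalIntegral.integral_const, smul_eq_mul, hc, mul_div_cancel₀ _ hne, sub_self]
  have hH := H k _ hki hkC hk0
  set η : ℝ → ℝ := fun t => ∫ s in a..t, k s with hη
  have hηac : AbsolutelyContinuousOnInterval η a b :=
    hki.absolutelyContinuousOnInterval_intervalIntegral left_mem_uIcc
  have hηa : η a = 0 := intervalIntegral.integral_same
  have hηb : η b = 0 := hk0
  have hparts := hGac.integral_mul_deriv_eq_deriv_mul hηac
  rw [hηa, hηb, mul_zero, mul_zero, sub_zero, zero_sub] at hparts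
  have e1 : ∫ t in a..b, G t * deriv η t = ∫ t in a..b, G t * k t := by
    refine intervalIntegral.integral_congr_ae ?_
    filter_upwards [hki.ae_hasDerivAt_integral] with t ht ht'
    rw [(ht (uIoc_subset_uIcc ht') a left_mem_uIcc).deriv]
  have e2 : ∫ t in a..b, deriv G t * η t = ∫ t in a..b, g t * η t := by
    refine intervalIntegral.integral_congr_ae ?_
    filter_upwards [hg.ae_hasDerivAt_integral] with t ht ht'
    rw [(ht (uIoc_subset_uIcc ht') a left_mem_uIcc).deriv]
  rw [e1, e2] at hparts
  have hmk : AEStronglyMeasurable k (volume.restrict (Icc a b)) :=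
    ((intervalIntegrable_iff_integrableOn_Icc_of_le hab.le).1 hki).aestronglyMeasurable
  have hk2 : IntervalIntegrable (fun t => k t * k t) volume a b := by
    refine intervalIntegrable_of_bounded (C := (M + B + |c|) * (M + B + |c|)) hab.le
      (hmk.mul hmk) fun t ht => ?_
    rw [abs_mul]
    have := hkC t ht
    exact mul_le_mul this this (abs_nonneg _) ((abs_nonneg _).trans this)
  have hGk : IntervalIntegrable (fun t => G t * k t) volume a b :=
    hki.continuousOn_mul hGac.continuousOn
  have hgη : IntervalIntegrable (fun t => g t * η t) volume a b :=
    hg.mul_continuousOn hηac.continuousOn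
  have hfk : ∫ t in a..b, (f t * k t + g t * η t) = ∫ t in a..b, k t * k t := by
    have : (fun t => f t * k t + g t * η t) =
        fun t => (k t * k t + c * k t) + (G t * k t + g t * η t) := by
      ext t
      simp only [hk]
      ring
    rw [this, intervalIntegral.integral_add (hk2.add (hki.const_mul c)) (hGk.add hgη),
      intervalIntegral.integral_add hk2 (hki.const_mul c), intervalIntegral.integral_add hGk hgη,
      hparts, intervalIntegral.integral_const_mul, hk0]
    ring
  rw [hfk] at hH
  have hz : ∫ t in a..b, k t * k t = 0 :=
    le_antisymm hH (intervalIntegral.integral_nonneg hab.le fun t _ => mul_self_nonneg _)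
  rw [intervalIntegral.integral_eq_zero_iff_of_le_of_nonneg_ae hab.le
    (Eventually.of_forall fun t => mul_self_nonneg _) hk2] at hz
  refine ⟨c, ?_⟩
  filter_upwards [(ae_restrict_iff' measurableSet_Ioc).1 hz] with t ht htm
  have h0 : k t * k t = 0 := ht (Ioo_subset_Ioc_self htm)
  have h1 : k t = 0 := mul_self_eq_zero.1 h0
  simp only [hk] at h1
  linarith

theorem exists_taylor_bound {f : ℝ × ℝ → ℝ} (hf : ContDiff ℝ 2 f) (R : ℝ) : ∃ M ≥ 0, ∀ p v,
    ‖p‖ ≤ R → ‖p + v‖ ≤ R → |f (p + v) - f p - fderiv ℝ f p v| ≤ M * ‖v‖ ^ 2 := by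
  have h1 : ContDiff ℝ 1 (fderiv ℝ f) := hf.fderiv_right (by norm_num)
  obtain ⟨K, hK⟩ := LocallyLipschitzOn.exists_lipschitzOnWith_of_compact
    (isCompact_closedBall (0 : ℝ × ℝ) R) (h1.locallyLipschitz.locallyLipschitzOn)
  refine ⟨K, K.2, fun p v hp hv => ?_⟩
  have hp' : p ∈ Metric.closedBall (0 : ℝ × ℝ) R := by simpa using hp
  have hv' : p + v ∈ Metric.closedBall (0 : ℝ × ℝ) R := by simpa using hv
  have hseg := (convex_closedBall (0 : ℝ × ℝ) R).segment_subset hp' hv'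
  have := (convex_segment p (p + v)).norm_image_sub_le_of_norm_fderiv_le' (f := f)
    (φ := fderiv ℝ f p) (C := K * ‖v‖) (𝕜 := ℝ)
    (fun x _ => (hf.differentiable (by norm_num)) x) (fun x hx => ?_)
    (left_mem_segment ℝ p (p + v)) (right_mem_segment ℝ p (p + v))
  · rw [add_sub_cancel_left, Real.norm_eq_abs] at this
    linarith
  · have h2 := hK.dist_le_mul x (hseg hx) p hp'
    rw [dist_eq_norm, dist_eq_norm] at h2
    refine h2.trans ?_
    gcongr
    have := norm_sub_le_of_mem_segment hx
    simpa using this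

theorem energy_expansion_le {A B S c κ m ε Wξ : ℝ} {A₀ B₀ S₀ c₀ κ₀ m₀ : ℝ} (hε : 0 ≤ ε)
    (hε1 : ε ≤ 1) (hA : |A| ≤ A₀) (hB : |B| ≤ B₀) (hS : |S| ≤ S₀) (hc : |c| ≤ c₀) (hκ : |κ| ≤ κ₀)
    (hm : |m| ≤ m₀) (hsq : 0 ≤ S - 2 * ε * c + ε ^ 2 * κ) (hW : Wξ ≤ A - ε * B + ε ^ 2 * m) :
    Wξ * (S - 2 * ε * c + ε ^ 2 * κ) ≤ A * S - ε * (B * S + 2 * A * c) +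
      ε ^ 2 * (m₀ * (S₀ + 2 * c₀ + κ₀) + A₀ * κ₀ + 2 * (B₀ * c₀) + B₀ * κ₀) := by
  have h1 := mul_le_mul_of_nonneg_right hW hsq
  refine h1.trans ?_
  have hid : (A - ε * B + ε ^ 2 * m) * (S - 2 * ε * c + ε ^ 2 * κ) =
      A * S - ε * (B * S + 2 * A * c) + ε ^ 2 * (m * (S - 2 * ε * c + ε ^ 2 * κ) +
        A * κ + 2 * (B * c) - ε * (B * κ)) := by ring
  rw [hid]
  have hm0 := (abs_nonneg _).trans hm
  have hA0 := (abs_nonneg _).trans hA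
  have hB0 := (abs_nonneg _).trans hB
  have hc0 := (abs_nonneg _).trans hc
  have hκ0 := (abs_nonneg _).trans hκ
  have b0 : ε ^ 2 ≤ 1 := by nlinarith
  have b1 : |S - 2 * ε * c + ε ^ 2 * κ| ≤ S₀ + 2 * c₀ + κ₀ := by
    have t1 := abs_add_le (S - 2 * ε * c) (ε ^ 2 * κ)
    have t2 := abs_sub S (2 * ε * c)
    have t3 : |2 * ε * c| ≤ 2 * c₀ := by
      rw [abs_mul, abs_mul, abs_two, abs_of_nonneg hε]
      nlinarith [abs_nonneg c]
    have t4 : |ε ^ 2 * κ| ≤ κ₀ := by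
      rw [abs_mul, abs_of_nonneg (sq_nonneg ε)]
      nlinarith [abs_nonneg κ, sq_nonneg ε]
    linarith
  have b2 : m * (S - 2 * ε * c + ε ^ 2 * κ) ≤ m₀ * (S₀ + 2 * c₀ + κ₀) := by
    refine (le_abs_self _).trans ?_
    rw [abs_mul]
    exact mul_le_mul hm b1 (abs_nonneg _) hm0
  have b3 : A * κ ≤ A₀ * κ₀ := by
    refine (le_abs_self _).trans ?_
    rw [abs_mul]
    exact mul_le_mul hA hκ (abs_nonneg _) hA0
  have b4 : B * c ≤ B₀ * c₀ := by
    refine (le_abs_self _).trans ?_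
    rw [abs_mul]
    exact mul_le_mul hB hc (abs_nonneg _) hB0
  have b5 : -(ε * (B * κ)) ≤ B₀ * κ₀ := by
    refine (neg_le_abs _).trans ?_
    rw [abs_mul, abs_mul, abs_of_nonneg hε]
    have : |B| * |κ| ≤ B₀ * κ₀ := mul_le_mul hB hκ (abs_nonneg _) hB0
    have h0 : 0 ≤ |B| * |κ| := by positivity
    nlinarith
  gcongr
  linarith

end

noncomputable section

/-- Twice the kinetic energy of a planar curve, with respect to the conformal factor `√W`. -/
def kinEnergy (W : ℝ × ℝ → ℝ) (a b : ℝ) (ξ : ℝ → ℝ × ℝ) : ℝ :=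
  ∫ t in a..b, W (ξ t) * ((deriv ξ t).1 ^ 2 + (deriv ξ t).2 ^ 2)

/-- The integral of `p₁ dp₂` along a planar curve. -/
def areaIntegral (a b : ℝ) (ξ : ℝ → ℝ × ℝ) : ℝ := ∫ t in a..b, (ξ t).1 * (deriv ξ t).2

section

variable {W : ℝ × ℝ → ℝ} {ζ : ℝ → ℝ × ℝ} {a b lam s : ℝ} {K : ℝ≥0}

theorem LipschitzOnWith.abs_deriv_fst_le (h : LipschitzOnWith K ζ (Icc a b)) {t : ℝ}
    (ht : t ∈ Ioo a b) : |(deriv ζ t).1| ≤ K :=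
  (norm_fst_le (deriv ζ t)).trans (norm_deriv_le_of_lipschitzOn (Icc_mem_nhds ht.1 ht.2) h)

theorem LipschitzOnWith.abs_deriv_snd_le (h : LipschitzOnWith K ζ (Icc a b)) {t : ℝ}
    (ht : t ∈ Ioo a b) : |(deriv ζ t).2| ≤ K :=
  (norm_snd_le (deriv ζ t)).trans (norm_deriv_le_of_lipschitzOn (Icc_mem_nhds ht.1 ht.2) h)

theorem LipschitzOnWith.intervalIntegrable_fst (hab : a ≤ b) (h : LipschitzOnWith K ζ (Icc a b)) :
    IntervalIntegrable (fun t => (deriv ζ t).1) volume a b :=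
  intervalIntegrable_of_bounded (C := K) hab
    (measurable_fst.comp (measurable_deriv ζ)).aestronglyMeasurable fun _ ht => h.abs_deriv_fst_le ht

theorem LipschitzOnWith.intervalIntegrable_snd (hab : a ≤ b) (h : LipschitzOnWith K ζ (Icc a b)) :
    IntervalIntegrable (fun t => (deriv ζ t).2) volume a b :=
  intervalIntegrable_of_bounded (C := K) hab
    (measurable_snd.comp (measurable_deriv ζ)).aestronglyMeasurable fun _ ht => h.abs_deriv_snd_le ht

theorem LipschitzOnWith.sq_deriv_le (h : LipschitzOnWith K ζ (Icc a b)) {t : ℝ}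
    (ht : t ∈ Ioo a b) : |(deriv ζ t).1 ^ 2 + (deriv ζ t).2 ^ 2| ≤ K ^ 2 + K ^ 2 := by
  rw [abs_of_nonneg (by positivity), ← sq_abs (deriv ζ t).1, ← sq_abs (deriv ζ t).2]
  gcongr
  · exact h.abs_deriv_fst_le ht
  · exact h.abs_deriv_snd_le ht

theorem LipschitzOnWith.intervalIntegrable_sq (hab : a ≤ b) (h : LipschitzOnWith K ζ (Icc a b)) :
    IntervalIntegrable (fun t => (deriv ζ t).1 ^ 2 + (deriv ζ t).2 ^ 2) volume a b :=
  intervalIntegrable_of_bounded (C := K ^ 2 + K ^ 2) hab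
    (((measurable_fst.comp (measurable_deriv ζ)).pow_const 2).add
      ((measurable_snd.comp (measurable_deriv ζ)).pow_const 2)).aestronglyMeasurable
    fun _ ht => h.sq_deriv_le ht

theorem LipschitzOnWith.intervalIntegrable_kinEnergy (hW : Continuous W) (hab : a ≤ b)
    (h : LipschitzOnWith K ζ (Icc a b)) :
    IntervalIntegrable (fun t => W (ζ t) * ((deriv ζ t).1 ^ 2 + (deriv ζ t).2 ^ 2)) volume a b := by
  refine (h.intervalIntegrable_sq hab).continuousOn_mul ?_
  rw [uIcc_of_le hab]
  exact hW.comp_continuousOn h.continuousOn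

theorem LipschitzOnWith.ae_differentiableAt_Ioo (h : LipschitzOnWith K ζ (Icc a b)) :
    ∀ᵐ t : ℝ, t ∈ Ioo a b → DifferentiableAt ℝ ζ t :=
  ae_differentiableAt_of_locallyLipschitzOn isOpen_Ioo fun _ _ =>
    ⟨K, Ioo a b, self_mem_nhdsWithin, h.mono Ioo_subset_Icc_self⟩

/-- The integrated Euler-Lagrange equation in the direction `e` for minimizers of the difference
of kinetic energy and area. -/
theorem first_variation (hW : ContDiff ℝ 2 W) (hab : a < b) (hζ : LipschitzOnWith K ζ (Icc a b))
    (hs : kinEnergy W a b ζ < s)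
    (hmin : ∀ (ξ : ℝ → ℝ × ℝ) (K' : ℝ≥0), LipschitzOnWith K' ξ (Icc a b) → ξ a = ζ a → ξ b = ζ b →
      kinEnergy W a b ξ < s → kinEnergy W a b ζ / 2 - lam * areaIntegral a b ζ ≤
        kinEnergy W a b ξ / 2 - lam * areaIntegral a b ξ) (e : ℝ × ℝ) :
    ∃ c, ∀ᵐ t : ℝ, t ∈ Ioo a b →
      W (ζ t) * ((deriv ζ t).1 * e.1 + (deriv ζ t).2 * e.2) - lam * ((ζ t).1 * e.2) =
        c + ∫ u in a..t, (fderiv ℝ W (ζ u) e / 2 * ((deriv ζ u).1 ^ 2 + (deriv ζ u).2 ^ 2) -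
          lam * (e.1 * (deriv ζ u).2)) := by
  have hle := hab.le
  have huI : uIcc a b = Icc a b := uIcc_of_le hle
  have hζc := hζ.continuousOn
  have hWζ : ContinuousOn (fun t => W (ζ t)) (uIcc a b) := by
    rw [huI]; exact hW.continuous.comp_continuousOn hζc
  have hdWζ : ContinuousOn (fun t => fderiv ℝ W (ζ t) e) (uIcc a b) := by
    rw [huI]
    exact ((hW.continuous_fderiv (by norm_num)).clm_apply continuous_const).comp_continuousOn hζc
  have hx : ContinuousOn (fun t => (ζ t).1) (uIcc a b) := by
    rw [huI]; exact continuous_fst.comp_continuousOn hζc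
  have hp := hζ.intervalIntegrable_fst hle
  have hq := hζ.intervalIntegrable_snd hle
  have hS := hζ.intervalIntegrable_sq hle
  obtain ⟨R₀, hR₀⟩ := isCompact_Icc.exists_bound_of_continuousOn hζc
  obtain ⟨A₀, hA₀⟩ := isCompact_Icc.exists_bound_of_continuousOn (huI ▸ hWζ)
  obtain ⟨D₀, hD₀⟩ := isCompact_Icc.exists_bound_of_continuousOn (huI ▸ hdWζ)
  have hdot : IntervalIntegrable (fun t => (deriv ζ t).1 * e.1 + (deriv ζ t).2 * e.2) volume a b :=
    (hp.mul_const _).add (hq.mul_const _)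
  have hdotb : ∀ t ∈ Ioo a b, |(deriv ζ t).1 * e.1 + (deriv ζ t).2 * e.2| ≤
      K * |e.1| + K * |e.2| := by
    intro t ht
    refine (abs_add_le _ _).trans ?_
    rw [abs_mul, abs_mul]
    gcongr
    · exact hζ.abs_deriv_fst_le ht
    · exact hζ.abs_deriv_snd_le ht
  have hf : IntervalIntegrable (fun t => W (ζ t) * ((deriv ζ t).1 * e.1 + (deriv ζ t).2 * e.2) -
      lam * ((ζ t).1 * e.2)) volume a b :=
    (hdot.continuousOn_mul hWζ).sub
      ((hx.intervalIntegrable.mul_const _).const_mul _)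
  have hg : IntervalIntegrable (fun u => fderiv ℝ W (ζ u) e / 2 *
      ((deriv ζ u).1 ^ 2 + (deriv ζ u).2 ^ 2) - lam * (e.1 * (deriv ζ u).2)) volume a b :=
    (hS.continuousOn_mul (hdWζ.div_const 2)).sub ((hq.const_mul _).const_mul _)
  refine ae_eq_const_add_integral_of_forall_integral_nonpos hab hf
    (M := A₀ * (K * |e.1| + K * |e.2|) + |lam| * (R₀ * |e.2|)) ?_ hg ?_
  · intro t ht
    have ht' := Ioo_subset_Icc_self ht
    refine (abs_sub _ _).trans ?_
    rw [abs_mul, abs_mul lam, abs_mul _ e.2]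
    have h1 := hA₀ t ht'
    have h2 := (norm_fst_le (ζ t)).trans (hR₀ t ht')
    rw [Real.norm_eq_abs] at h1 h2
    have h3 := hdotb t ht
    gcongr
    exact (abs_nonneg _).trans h1
  intro k C hk hkC hk0
  set η : ℝ → ℝ := fun t => ∫ u in a..t, k u with hη
  have hηac : AbsolutelyContinuousOnInterval η a b :=
    hk.absolutelyContinuousOnInterval_intervalIntegral left_mem_uIcc
  have hηc := hηac.continuousOn
  have hC0 : 0 ≤ C := (abs_nonneg _).trans (hkC ((a + b) / 2) ⟨by linarith, by linarith⟩)
  have hsubI : ∀ x ∈ Icc a b, IntervalIntegrable k volume a x := fun x hx' =>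
    hk.mono_set (by rw [huI, uIcc_of_le hx'.1]; exact Icc_subset_Icc le_rfl hx'.2)
  have hηlip : ∀ x ∈ Icc a b, ∀ y ∈ Icc a b, |η x - η y| ≤ C * |x - y| := by
    intro x hx' y hy'
    have e1 : η x - η y = ∫ u in y..x, k u :=
      intervalIntegral.integral_interval_sub_left (hsubI x hx') (hsubI y hy')
    rw [e1, ← Real.norm_eq_abs]
    refine intervalIntegral.norm_integral_le_of_norm_le_const_ae ?_
    filter_upwards [Measure.ae_ne volume b] with u hu hu'
    refine hkC u ⟨?_, ?_⟩
    · exact (le_min hy'.1 hx'.1).trans_lt hu'.1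
    · exact lt_of_le_of_ne (hu'.2.trans (max_le hy'.2 hx'.2)) hu
  have hηa : η a = 0 := intervalIntegral.integral_same
  have hηb : η b = 0 := hk0
  set H := C * (b - a) with hH
  have hH0 : 0 ≤ H := mul_nonneg hC0 (by linarith)
  have hηH : ∀ t ∈ Icc a b, |η t| ≤ H := by
    intro t ht
    have := hηlip t ht a (left_mem_Icc.2 hle)
    rw [hηa, sub_zero] at this
    refine this.trans ?_
    rw [hH, abs_of_nonneg (by linarith [ht.1])]
    gcongr
    exact ht.2
  obtain ⟨M, hM0, hM⟩ := exists_taylor_bound hW (R₀ + H * ‖e‖)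
  set ξ : ℝ → ℝ → ℝ × ℝ := fun ε t => ζ t - (ε * η t) • e with hξ
  set κ₀ := C ^ 2 * (e.1 ^ 2 + e.2 ^ 2) with hκ₀
  set c₀ := C * (K * |e.1| + K * |e.2|) with hc₀
  set C₁ := M * (H * ‖e‖) ^ 2 * ((K ^ 2 + K ^ 2) + 2 * c₀ + κ₀) + A₀ * κ₀ +
    2 * (H * D₀ * c₀) + H * D₀ * κ₀ with hC₁
  have hξlip : ∀ ε : ℝ, 0 ≤ ε → LipschitzOnWith (K + (ε * C * ‖e‖).toNNReal) (ξ ε) (Icc a b) := by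
    intro ε hε
    refine LipschitzOnWith.of_dist_le_mul fun x hx' y hy' => ?_
    have h1 := hζ.dist_le_mul x hx' y hy'
    have h2 := hηlip x hx' y hy'
    rw [dist_eq_norm, Real.dist_eq] at h1
    rw [dist_eq_norm, Real.dist_eq]
    have e1 : ξ ε x - ξ ε y = (ζ x - ζ y) - (ε * (η x - η y)) • e := by
      simp only [hξ]
      rw [mul_sub, sub_smul]
      abel
    rw [e1]
    refine (norm_sub_le _ _).trans ?_
    rw [norm_smul, norm_mul, Real.norm_eq_abs, Real.norm_eq_abs, abs_of_nonneg hε]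
    push_cast
    rw [Real.coe_toNNReal _ (by positivity), add_mul]
    have h3 : ε * |η x - η y| * ‖e‖ ≤ ε * (C * |x - y|) * ‖e‖ := by gcongr
    linarith
  have hξd : ∀ ε : ℝ, ∀ᵐ t : ℝ, t ∈ Ioo a b → deriv (ξ ε) t = deriv ζ t - (ε * k t) • e := by
    intro ε
    filter_upwards [hζ.ae_differentiableAt_Ioo, hk.ae_hasDerivAt_integral] with t h1 h2 ht
    have h3 := h2 (by rw [huI]; exact Ioo_subset_Icc_self ht) a left_mem_uIcc
    exact ((h1 ht).hasDerivAt.sub ((h3.const_mul ε).smul_const e)).deriv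
  have hη_int : IntervalIntegrable (fun t => η t * fderiv ℝ W (ζ t) e *
      ((deriv ζ t).1 ^ 2 + (deriv ζ t).2 ^ 2) +
      2 * W (ζ t) * (k t * ((deriv ζ t).1 * e.1 + (deriv ζ t).2 * e.2))) volume a b := by
    have hkdot : IntervalIntegrable
        (fun t => k t * ((deriv ζ t).1 * e.1 + (deriv ζ t).2 * e.2)) volume a b := by
      refine intervalIntegrable_of_bounded (C := c₀) hle (AEStronglyMeasurable.mul
        ((intervalIntegrable_iff_integrableOn_Icc_of_le hle).1 hk).aestronglyMeasurable
        ((intervalIntegrable_iff_integrableOn_Icc_of_le hle).1 hdot).aestronglyMeasurable) ?_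
      intro t ht
      rw [abs_mul]
      exact mul_le_mul (hkC t ht) (hdotb t ht) (abs_nonneg _) hC0
    exact (hS.continuousOn_mul (hηc.mul hdWζ)).add
      (hkdot.continuousOn_mul (continuousOn_const.mul hWζ))
  have ha_int : IntervalIntegrable (fun t => η t * (e.1 * (deriv ζ t).2) +
      (ζ t).1 * (k t * e.2)) volume a b :=
    ((hq.const_mul _).continuousOn_mul hηc).add ((hk.mul_const _).continuousOn_mul hx)
  have hQ_int : IntervalIntegrable (fun t => η t * (k t * (e.1 * e.2))) volume a b :=
    (hk.mul_const _).continuousOn_mul hηc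
  set I₁ := ∫ t in a..b, (η t * fderiv ℝ W (ζ t) e * ((deriv ζ t).1 ^ 2 + (deriv ζ t).2 ^ 2) +
      2 * W (ζ t) * (k t * ((deriv ζ t).1 * e.1 + (deriv ζ t).2 * e.2))) with hI₁
  set I₂ := ∫ t in a..b, (η t * (e.1 * (deriv ζ t).2) + (ζ t).1 * (k t * e.2)) with hI₂
  set Q := ∫ t in a..b, η t * (k t * (e.1 * e.2)) with hQ
  have hen : ∀ ε : ℝ, 0 ≤ ε → ε ≤ 1 →
      kinEnergy W a b (ξ ε) ≤ kinEnergy W a b ζ - ε * I₁ + ε ^ 2 * C₁ * (b - a) := by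
    intro ε hε hε1
    have i1 := hζ.intervalIntegrable_kinEnergy hW.continuous hle
    have hsum : kinEnergy W a b ζ - ε * I₁ + ε ^ 2 * C₁ * (b - a) =
        ∫ t in a..b, (W (ζ t) * ((deriv ζ t).1 ^ 2 + (deriv ζ t).2 ^ 2) -
          ε * (η t * fderiv ℝ W (ζ t) e * ((deriv ζ t).1 ^ 2 + (deriv ζ t).2 ^ 2) +
            2 * W (ζ t) * (k t * ((deriv ζ t).1 * e.1 + (deriv ζ t).2 * e.2))) + ε ^ 2 * C₁) := by
      rw [intervalIntegral.integral_add (i1.sub (hη_int.const_mul ε)) intervalIntegrable_const,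
        intervalIntegral.integral_sub i1 (hη_int.const_mul ε), intervalIntegral.integral_const_mul,
        intervalIntegral.integral_const, smul_eq_mul, kinEnergy]
      ring
    rw [hsum, kinEnergy]
    refine intervalIntegral.integral_mono_ae_restrict hle
      ((hξlip ε hε).intervalIntegrable_kinEnergy hW.continuous hle)
      ((i1.sub (hη_int.const_mul ε)).add intervalIntegrable_const) ?_
    rw [← Measure.restrict_congr_set Ioo_ae_eq_Icc]
    refine (ae_restrict_iff' measurableSet_Ioo).2 ?_
    filter_upwards [hξd ε] with t ht1 ht
    rw [ht1 ht]
    have ht' := Ioo_subset_Icc_self ht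
    have hT := hM (ζ t) (-((ε * η t) • e)) ((hR₀ t ht').trans (by nlinarith [norm_nonneg e])) (by
      refine (norm_add_le _ _).trans ?_
      rw [norm_neg, norm_smul, norm_mul, Real.norm_eq_abs, Real.norm_eq_abs, abs_of_nonneg hε]
      have h1 := hR₀ t ht'
      have h2 : ε * |η t| ≤ 1 * H := mul_le_mul hε1 (hηH t ht') (abs_nonneg _) zero_le_one
      have h3 : ε * |η t| * ‖e‖ ≤ H * ‖e‖ := by
        gcongr
        linarith
      linarith)
    have hT' := (abs_le.1 hT).2
    rw [map_neg, map_smul, norm_neg, norm_smul, smul_eq_mul, Real.norm_eq_abs] at hT'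
    have hmain := energy_expansion_le (A := W (ζ t)) (B := η t * fderiv ℝ W (ζ t) e)
      (S := (deriv ζ t).1 ^ 2 + (deriv ζ t).2 ^ 2)
      (c := k t * ((deriv ζ t).1 * e.1 + (deriv ζ t).2 * e.2))
      (κ := k t ^ 2 * (e.1 ^ 2 + e.2 ^ 2)) (m := M * (|η t| * ‖e‖) ^ 2) (Wξ := W (ξ ε t))
      (A₀ := A₀) (B₀ := H * D₀) (S₀ := K ^ 2 + K ^ 2) (c₀ := c₀) (κ₀ := κ₀)
      (m₀ := M * (H * ‖e‖) ^ 2) hε hε1 (hA₀ t ht') (by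
        rw [abs_mul]
        exact mul_le_mul (hηH t ht') (hD₀ t ht') (abs_nonneg _) hH0) (hζ.sq_deriv_le ht) (by
        rw [abs_mul]
        exact mul_le_mul (hkC t ht) (hdotb t ht) (abs_nonneg _) hC0) (by
        rw [abs_mul, abs_of_nonneg (sq_nonneg (k t)),
          abs_of_nonneg (by positivity : 0 ≤ e.1 ^ 2 + e.2 ^ 2), ← sq_abs (k t), hκ₀]
        gcongr
        exact hkC t ht) (by
        rw [abs_of_nonneg (by positivity)]
        gcongr
        exact hηH t ht') (by
        have : 0 ≤ ((deriv ζ t).1 - ε * k t * e.1) ^ 2 + ((deriv ζ t).2 - ε * k t * e.2) ^ 2 := by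
          positivity
        linarith) (by
        have e1 : (|ε * η t| * ‖e‖) ^ 2 = ε ^ 2 * (|η t| * ‖e‖) ^ 2 := by
          rw [abs_mul, abs_of_nonneg hε]
          ring
        rw [e1] at hT'
        have e2 : ζ t + -((ε * η t) • e) = ξ ε t := by simp only [hξ]; abel
        rw [e2] at hT'
        linarith)
    refine le_trans (le_of_eq ?_) (hmain.trans (le_of_eq ?_))
    · simp only [Prod.fst_sub, Prod.snd_sub, Prod.smul_fst, Prod.smul_snd, smul_eq_mul]
      ring
    · rw [hC₁]
  have har : ∀ ε : ℝ, areaIntegral a b (ξ ε) = areaIntegral a b ζ - ε * I₂ + ε ^ 2 * Q := by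
    intro ε
    have i1 : IntervalIntegrable (fun t => (ζ t).1 * (deriv ζ t).2) volume a b :=
      hq.continuousOn_mul hx
    have hsum : areaIntegral a b ζ - ε * I₂ + ε ^ 2 * Q =
        ∫ t in a..b, ((ζ t).1 * (deriv ζ t).2 -
          ε * (η t * (e.1 * (deriv ζ t).2) + (ζ t).1 * (k t * e.2)) +
          ε ^ 2 * (η t * (k t * (e.1 * e.2)))) := by
      rw [intervalIntegral.integral_add (i1.sub (ha_int.const_mul ε)) (hQ_int.const_mul _),
        intervalIntegral.integral_sub i1 (ha_int.const_mul ε), intervalIntegral.integral_const_mul,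
        intervalIntegral.integral_const_mul, areaIntegral]
    rw [hsum, areaIntegral]
    refine intervalIntegral.integral_congr_ae ?_
    filter_upwards [hξd ε, Measure.ae_ne volume b] with t ht hb htm
    rw [uIoc_of_le hle] at htm
    rw [ht ⟨htm.1, lt_of_le_of_ne htm.2 hb⟩]
    simp only [hξ, Prod.fst_sub, Prod.snd_sub, Prod.smul_fst, Prod.smul_snd, smul_eq_mul]
    ring
  have htot : ∫ t in a..b, ((W (ζ t) * ((deriv ζ t).1 * e.1 + (deriv ζ t).2 * e.2) -
      lam * ((ζ t).1 * e.2)) * k t + (fderiv ℝ W (ζ t) e / 2 *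
        ((deriv ζ t).1 ^ 2 + (deriv ζ t).2 ^ 2) - lam * (e.1 * (deriv ζ t).2)) * η t) =
      I₁ / 2 - lam * I₂ := by
    rw [hI₁, hI₂, ← intervalIntegral.integral_const_mul, ← intervalIntegral.integral_div,
      ← intervalIntegral.integral_sub (hη_int.div_const 2) (ha_int.const_mul lam)]
    congr 1
    ext t
    ring
  rw [htot]
  have hlim : Tendsto (fun ε : ℝ => kinEnergy W a b ζ - ε * I₁ + ε ^ 2 * C₁ * (b - a)) (𝓝[>] 0)
      (𝓝 (kinEnergy W a b ζ)) := by
    have : Continuous fun ε : ℝ => kinEnergy W a b ζ - ε * I₁ + ε ^ 2 * C₁ * (b - a) := by fun_prop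
    have := this.tendsto 0
    simp only [zero_mul, sub_zero, ne_eq, OfNat.ofNat_ne_zero, not_false_eq_true, zero_pow,
      add_zero] at this
    exact tendsto_nhdsWithin_of_tendsto_nhds this
  have hlim2 : Tendsto (fun ε : ℝ => ε * (C₁ * (b - a) / 2 - lam * Q)) (𝓝[>] 0) (𝓝 0) := by
    have : Continuous fun ε : ℝ => ε * (C₁ * (b - a) / 2 - lam * Q) := by fun_prop
    have := this.tendsto 0
    simp only [zero_mul] at this
    exact tendsto_nhdsWithin_of_tendsto_nhds this
  refine ge_of_tendsto hlim2 ?_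
  filter_upwards [hlim.eventually_lt_const hs, Ioo_mem_nhdsGT (zero_lt_one' ℝ)] with ε h1 h2
  have h3 := hen ε h2.1.le h2.2.le
  have h4 := hmin (ξ ε) _ (hξlip ε h2.1.le) (by simp [hξ, hηa]) (by simp [hξ, hηb])
    (h3.trans_lt h1)
  rw [har ε] at h4
  have h5 : ε * (I₁ / 2 - lam * I₂) ≤ ε * (ε * (C₁ * (b - a) / 2 - lam * Q)) := by
    linarith
  exact le_of_mul_le_mul_left h5 h2.1

end

end

noncomputable section

section

variable {a b : ℝ}

theorem hasDerivAt_of_eq_integral {F φ ψ : ℝ → ℝ} {c : ℝ}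
    (hF : ∀ t ∈ Icc a b, F t = c + ∫ u in a..t, ψ u) (hψ : ∀ᵐ t : ℝ, t ∈ Ioo a b → ψ t = φ t)
    (hφ : ContinuousOn φ (Icc a b)) {t : ℝ} (ht : t ∈ Ioo a b) : HasDerivAt F (φ t) t := by
  have hF' : ∀ u ∈ Icc a b, F u = c + ∫ x in a..u, φ x := by
    intro u hu
    rw [hF u hu]
    congr 1
    refine intervalIntegral.integral_congr_ae ?_
    filter_upwards [hψ, Measure.ae_ne volume b] with x hx hb hx'
    rw [uIoc_of_le hu.1] at hx'
    exact hx ⟨hx'.1, lt_of_le_of_ne (hx'.2.trans hu.2) hb⟩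
  have hi : IntervalIntegrable φ volume a t := by
    refine ContinuousOn.intervalIntegrable (hφ.mono ?_)
    rw [uIcc_of_le ht.1.le]
    exact Icc_subset_Icc le_rfl ht.2.le
  have hm : Icc a b ∈ 𝓝 t := Icc_mem_nhds ht.1 ht.2
  have hd : HasDerivAt (fun u => c + ∫ x in a..u, φ x) (φ t) t :=
    (intervalIntegral.integral_hasDerivAt_right hi
      ((hφ.mono Ioo_subset_Icc_self).stronglyMeasurableAtFilter isOpen_Ioo t ht)
      (hφ.continuousAt hm)).const_add c
  refine hd.congr_of_eventuallyEq ?_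
  filter_upwards [hm] with u hu
  exact hF' u hu

theorem HasDerivAt.fst {ζ : ℝ → ℝ × ℝ} {v : ℝ × ℝ} {t : ℝ} (h : HasDerivAt ζ v t) :
    HasDerivAt (fun s => (ζ s).1) v.1 t :=
  (ContinuousLinearMap.fst ℝ ℝ ℝ).hasFDerivAt.comp_hasDerivAt t h

theorem HasDerivAt.snd {ζ : ℝ → ℝ × ℝ} {v : ℝ × ℝ} {t : ℝ} (h : HasDerivAt ζ v t) :
    HasDerivAt (fun s => (ζ s).2) v.2 t :=
  (ContinuousLinearMap.snd ℝ ℝ ℝ).hasFDerivAt.comp_hasDerivAt t h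

/-- Minimizers of the difference of kinetic energy and area solve the Euler-Lagrange equation
in the classical sense. -/
theorem euler_lagrange {W : ℝ × ℝ → ℝ} {ζ : ℝ → ℝ × ℝ} {lam s : ℝ} {K : ℝ≥0}
    (hW : ContDiff ℝ 2 W) (hab : a < b) (hζ : LipschitzOnWith K ζ (Icc a b))
    (hne : ∀ t ∈ Icc a b, W (ζ t) ≠ 0) (hs : kinEnergy W a b ζ < s)
    (hmin : ∀ (ξ : ℝ → ℝ × ℝ) (K' : ℝ≥0), LipschitzOnWith K' ξ (Icc a b) → ξ a = ζ a → ξ b = ζ b →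
      kinEnergy W a b ξ < s → kinEnergy W a b ζ / 2 - lam * areaIntegral a b ζ ≤
        kinEnergy W a b ξ / 2 - lam * areaIntegral a b ξ) {t : ℝ} (ht : t ∈ Ioo a b) :
    DifferentiableAt ℝ ζ t ∧ HasDerivAt (fun u => W (ζ u) • deriv ζ u)
      (fderiv ℝ W (ζ t) (1, 0) / 2 * ((deriv ζ t).1 ^ 2 + (deriv ζ t).2 ^ 2) -
          lam * (deriv ζ t).2,
        fderiv ℝ W (ζ t) (0, 1) / 2 * ((deriv ζ t).1 ^ 2 + (deriv ζ t).2 ^ 2) +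
          lam * (deriv ζ t).1) t := by
  have hle := hab.le
  have huI : uIcc a b = Icc a b := uIcc_of_le hle
  have hζc := hζ.continuousOn
  obtain ⟨c₁, h₁⟩ := first_variation hW hab hζ hs hmin (1, 0)
  obtain ⟨c₂, h₂⟩ := first_variation hW hab hζ hs hmin (0, 1)
  simp only [mul_one, mul_zero, add_zero, sub_zero, one_mul, zero_add, zero_mul] at h₁ h₂
  have hq := hζ.intervalIntegrable_snd hle
  have hS := hζ.intervalIntegrable_sq hle
  have hdW : ∀ e, ContinuousOn (fun t => fderiv ℝ W (ζ t) e) (Icc a b) := fun e =>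
    ((hW.continuous_fderiv (by norm_num)).clm_apply continuous_const).comp_continuousOn hζc
  have hWζ : ContinuousOn (fun t => W (ζ t)) (Icc a b) := hW.continuous.comp_continuousOn hζc
  have hx : ContinuousOn (fun t => (ζ t).1) (Icc a b) := continuous_fst.comp_continuousOn hζc
  set g₁ : ℝ → ℝ := fun u => fderiv ℝ W (ζ u) (1, 0) / 2 *
    ((deriv ζ u).1 ^ 2 + (deriv ζ u).2 ^ 2) - lam * (deriv ζ u).2 with hg₁
  set g₂ : ℝ → ℝ := fun u => fderiv ℝ W (ζ u) (0, 1) / 2 *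
    ((deriv ζ u).1 ^ 2 + (deriv ζ u).2 ^ 2) with hg₂
  have ig₁ : IntervalIntegrable g₁ volume a b :=
    (hS.continuousOn_mul (huI.symm ▸ (hdW _).div_const 2)).sub (hq.const_mul _)
  have ig₂ : IntervalIntegrable g₂ volume a b :=
    hS.continuousOn_mul (huI.symm ▸ (hdW _).div_const 2)
  set P₁ : ℝ → ℝ := fun t => c₁ + ∫ u in a..t, g₁ u with hP₁
  set P₂ : ℝ → ℝ := fun t => c₂ + (∫ u in a..t, g₂ u) + lam * (ζ t).1 with hP₂
  have cP₁ : ContinuousOn P₁ (Icc a b) := huI ▸ continuousOn_const.add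
    (ig₁.absolutelyContinuousOnInterval_intervalIntegral left_mem_uIcc).continuousOn
  have cP₂ : ContinuousOn P₂ (Icc a b) := (huI ▸ continuousOn_const.add
    (ig₂.absolutelyContinuousOnInterval_intervalIntegral left_mem_uIcc).continuousOn :
      ContinuousOn (fun t => c₂ + ∫ u in a..t, g₂ u) (Icc a b)).add (continuousOn_const.mul hx)
  set v₁ : ℝ → ℝ := fun t => P₁ t / W (ζ t) with hv₁
  set v₂ : ℝ → ℝ := fun t => P₂ t / W (ζ t) with hv₂
  have cv₁ : ContinuousOn v₁ (Icc a b) := cP₁.div hWζ hne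
  have cv₂ : ContinuousOn v₂ (Icc a b) := cP₂.div hWζ hne
  have hae : ∀ᵐ t : ℝ, t ∈ Ioo a b → (deriv ζ t).1 = v₁ t ∧ (deriv ζ t).2 = v₂ t := by
    filter_upwards [h₁, h₂] with t k₁ k₂ ht
    have k₁ := k₁ ht
    have k₂ := k₂ ht
    have hn := hne t (Ioo_subset_Icc_self ht)
    constructor
    · simp only [hv₁, hP₁]
      rw [eq_div_iff hn, ← k₁, mul_comm]
    · simp only [hv₂, hP₂]
      rw [eq_div_iff hn, ← k₂]
      ring
  have hprim : ∀ (π : ℝ × ℝ →L[ℝ] ℝ), ∀ t ∈ Icc a b,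
      π (ζ t) = π (ζ a) + ∫ u in a..t, π (deriv ζ u) := by
    intro π t ht
    have hac : AbsolutelyContinuousOnInterval (fun u => π (ζ u)) a t := by
      apply LipschitzOnWith.absolutelyContinuousOnInterval (K := ‖π‖₊ * K)
      rw [uIcc_of_le ht.1]
      exact π.lipschitz.comp_lipschitzOnWith (hζ.mono (Icc_subset_Icc le_rfl ht.2))
    have e1 := hac.integral_deriv_eq_sub
    have e2 : ∫ u in a..t, deriv (fun u => π (ζ u)) u = ∫ u in a..t, π (deriv ζ u) := by
      refine intervalIntegral.integral_congr_ae ?_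
      filter_upwards [hζ.ae_differentiableAt_Ioo, Measure.ae_ne volume b] with u hu hb hu'
      rw [uIoc_of_le ht.1] at hu'
      exact (π.hasFDerivAt.comp_hasDerivAt u
        (hu ⟨hu'.1, lt_of_le_of_ne (hu'.2.trans ht.2) hb⟩).hasDerivAt).deriv
    rw [e2] at e1
    linarith
  have hder : ∀ t ∈ Ioo a b, HasDerivAt ζ (v₁ t, v₂ t) t := by
    intro t ht
    have d1 := hasDerivAt_of_eq_integral (hprim (ContinuousLinearMap.fst ℝ ℝ ℝ))
      (hae.mono fun t h ht => (h ht).1) cv₁ ht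
    have d2 := hasDerivAt_of_eq_integral (hprim (ContinuousLinearMap.snd ℝ ℝ ℝ))
      (hae.mono fun t h ht => (h ht).2) cv₂ ht
    exact d1.prodMk d2
  have hdt := hder t ht
  refine ⟨hdt.differentiableAt, ?_⟩
  have dG₁ : HasDerivAt P₁ (fderiv ℝ W (ζ t) (1, 0) / 2 * (v₁ t ^ 2 + v₂ t ^ 2) - lam * v₂ t) t := by
    refine hasDerivAt_of_eq_integral (c := c₁) (ψ := g₁) (φ := fun t =>
      fderiv ℝ W (ζ t) (1, 0) / 2 * (v₁ t ^ 2 + v₂ t ^ 2) - lam * v₂ t) (fun _ _ => rfl) ?_ ?_ ht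
    · filter_upwards [hae] with u hu hu'
      simp only [hg₁]
      rw [(hu hu').1, (hu hu').2]
    · have := hdW (1, 0)
      fun_prop
  have dG₂ : HasDerivAt (fun t => c₂ + ∫ u in a..t, g₂ u)
      (fderiv ℝ W (ζ t) (0, 1) / 2 * (v₁ t ^ 2 + v₂ t ^ 2)) t := by
    refine hasDerivAt_of_eq_integral (c := c₂) (ψ := g₂) (φ := fun t =>
      fderiv ℝ W (ζ t) (0, 1) / 2 * (v₁ t ^ 2 + v₂ t ^ 2)) (fun _ _ => rfl) ?_ ?_ ht
    · filter_upwards [hae] with u hu hu'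
      simp only [hg₂]
      rw [(hu hu').1, (hu hu').2]
    · have := hdW (0, 1)
      fun_prop
  have dP := dG₁.prodMk (dG₂.add (hdt.fst.const_mul lam))
  rw [hdt.deriv]
  refine dP.congr_of_eventuallyEq ?_
  filter_upwards [Ioo_mem_nhds ht.1 ht.2] with u hu
  have hn := hne u (Ioo_subset_Icc_self hu)
  rw [(hder u hu).deriv]
  ext
  · simp only [Prod.smul_fst, smul_eq_mul, hv₁]
    field_simp
  · simp only [Prod.smul_snd, smul_eq_mul, hv₂, hP₂, Pi.add_apply]
    field_simp

end

end

noncomputable section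

/-! ### Calibrated loops -/

/-- A loop over the well `w`, parametrized by arclength on `[0,ℓ]`, which is off the wells in
between and whose length is `lam` times the height it gains. -/
structure CalLoop (W : ℝ × ℝ → ℝ) (pm pp w : ℝ × ℝ) (lam δ ℓ : ℝ) (Γ : ℝ → ℝ × ℝ × ℝ) : Prop where
  pos : 0 < ℓ
  short : 4 * ℓ < δ
  lip : IsCCLip W pm pp 1 0 ℓ Γ
  start : projCurve Γ 0 = w
  terminus : projCurve Γ ℓ = w
  off : ∀ t ∈ Ioo 0 ℓ, projCurve Γ t ≠ pm ∧ projCurve Γ t ≠ pp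
  height : lam * ((Γ ℓ).2.2 - (Γ 0).2.2) = ℓ

/-- The Hamiltonian vector field on phase space, in the arclength parametrization. -/
def phaseField (W : ℝ × ℝ → ℝ) (lam : ℝ) (z : (ℝ × ℝ) × (ℝ × ℝ)) : (ℝ × ℝ) × (ℝ × ℝ) :=
  (W z.1)⁻¹ • (z.2, (fderiv ℝ W z.1 (1, 0) / 2 - lam * z.2.2,
    fderiv ℝ W z.1 (0, 1) / 2 + lam * z.2.1))

theorem contDiffAt_phaseField {W : ℝ × ℝ → ℝ} (hW : ContDiff ℝ 2 W) (lam : ℝ)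
    {z : (ℝ × ℝ) × (ℝ × ℝ)} (hz : W z.1 ≠ 0) : ContDiffAt ℝ 1 (phaseField W lam) z := by
  have h1 : ContDiff ℝ 1 (fderiv ℝ W) := hW.fderiv_right (by norm_num)
  have h2 : ∀ e, ContDiff ℝ 1 fun z : (ℝ × ℝ) × (ℝ × ℝ) => fderiv ℝ W z.1 e := fun e =>
    (h1.comp contDiff_fst).clm_apply contDiff_const
  have h3 : ContDiffAt ℝ 1 (fun z : (ℝ × ℝ) × (ℝ × ℝ) => (W z.1)⁻¹) z :=
    ((hW.of_le (by norm_num)).comp contDiff_fst).contDiffAt.inv hz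
  have h4 := h2 (1, 0)
  have h5 := h2 (0, 1)
  unfold phaseField
  refine h3.smul (ContDiff.contDiffAt ?_)
  fun_prop

theorem HasArea.unique {pm pp : ℝ × ℝ} {a b A A' : ℝ} {γ : ℝ → ℝ × ℝ} (h : HasArea pm pp a b γ A)
    (h' : HasArea pm pp a b γ A') : A = A' := h.2.trans h'.2.symm

theorem LipschitzOnWith.hasArea_areaIntegral (pm pp : ℝ × ℝ) {a b : ℝ} (hab : a ≤ b)
    {ξ : ℝ → ℝ × ℝ} {K : ℝ≥0} (h : LipschitzOnWith K ξ (Icc a b)) :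
    HasArea pm pp a b ξ (areaIntegral a b ξ) := by
  rw [hasArea_iff_of_lipschitz pm pp hab h, areaIntegral]
  refine intervalIntegral.integral_congr_ae ?_
  filter_upwards [h.ae_differentiableAt_Ioo, Measure.ae_ne volume b] with u hu hb hu'
  rw [uIoc_of_le hab] at hu'
  have := (hu ⟨hu'.1, lt_of_le_of_ne hu'.2 hb⟩).hasDerivAt.snd
  rw [this.deriv]

namespace CalLoop

variable {W : ℝ × ℝ → ℝ} {pm pp w : ℝ × ℝ} {lam δ ℓ : ℝ} {Γ : ℝ → ℝ × ℝ × ℝ}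

/-- Sub-arcs of calibrated loops minimize length minus `lam` times the height gained. -/
theorem sub_le (hW : TwoWell W pm pp)
    (hcal : ∀ h, fiberDist W pm pp w h < δ → lam * h ≤ fiberDist W pm pp w h)
    (hL : CalLoop W pm pp w lam δ ℓ Γ) {t₁ t₂ : ℝ} (h0 : 0 ≤ t₁) (h12 : t₁ ≤ t₂) (h2 : t₂ ≤ ℓ)
    {P Q : ℝ × ℝ × ℝ} (hP : proj P = projCurve Γ t₁) (hQ : proj Q = projCurve Γ t₂)
    (hd : ccDist W pm pp P Q < δ / 2) :
    t₂ - t₁ - lam * ((Γ t₂).2.2 - (Γ t₁).2.2) + lam * (Q.2.2 - P.2.2) ≤ ccDist W pm pp P Q := by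
  set Q' : ℝ × ℝ × ℝ := ((Γ t₂).1, (Γ t₂).2.1, (Γ t₁).2.2 + (Q.2.2 - P.2.2)) with hQ'
  set R : ℝ × ℝ × ℝ := ((Γ ℓ).1, (Γ ℓ).2.1,
    (Γ t₁).2.2 + (Q.2.2 - P.2.2) + ((Γ ℓ).2.2 - (Γ t₂).2.2)) with hR
  have e1 : ccDist W pm pp (Γ t₁) Q' = ccDist W pm pp P Q :=
    ccDist_eq_of_proj_eq hP.symm hQ.symm (by simp [hQ'])
  have e2 : ccDist W pm pp Q' R = ccDist W pm pp (Γ t₂) (Γ ℓ) :=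
    ccDist_eq_of_proj_eq rfl rfl (by simp [hQ', hR])
  have m0 : (0 : ℝ) ∈ Icc 0 ℓ := left_mem_Icc.2 hL.pos.le
  have m1 : t₁ ∈ Icc 0 ℓ := ⟨h0, h12.trans h2⟩
  have m2 : t₂ ∈ Icc 0 ℓ := ⟨h0.trans h12, h2⟩
  have m3 : ℓ ∈ Icc 0 ℓ := right_mem_Icc.2 hL.pos.le
  have l1 := hL.lip 0 m0 t₁ m1
  have l2 := hL.lip t₂ m2 ℓ m3
  rw [abs_of_nonneg (by linarith), one_mul] at l1 l2
  have t1 := ccDist_triangle hW (Γ 0) (Γ t₁) R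
  have t2 := ccDist_triangle hW (Γ t₁) Q' R
  have hρ : ccDist W pm pp (Γ 0) R = fiberDist W pm pp w (R.2.2 - (Γ 0).2.2) :=
    ccDist_eq_fiberDist hL.start hL.terminus
  have hs := hL.short
  have hp := hL.pos
  have hc := hcal (R.2.2 - (Γ 0).2.2) (by rw [← hρ]; linarith)
  rw [← hρ] at hc
  have hh := hL.height
  have : lam * (R.2.2 - (Γ 0).2.2) = ℓ - lam * ((Γ t₂).2.2 - (Γ t₁).2.2) +
      lam * (Q.2.2 - P.2.2) := by
    rw [← hh]
    simp only [hR]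
    ring
  linarith

theorem exists_lipschitzOnWith (hW : TwoWell W pm pp) (hL : CalLoop W pm pp w lam δ ℓ Γ)
    {a b : ℝ} (ha : 0 < a) (hb : b < ℓ) : ∃ K, LipschitzOnWith K (projCurve Γ) (Icc a b) := by
  refine LocallyLipschitzOn.exists_lipschitzOnWith_of_compact isCompact_Icc
    ((hL.lip.isCurve hW hL.pos.le).2.2.1.mono fun t ht => ?_)
  have ht' : t ∈ Ioo 0 ℓ := ⟨ha.trans_le ht.1, ht.2.trans_lt hb⟩
  exact ⟨Ioo_subset_Icc_self ht', hL.off t ht'⟩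

theorem ccDist_le_kinEnergy (hW : TwoWell W pm pp) {a b : ℝ} (hab : a ≤ b) {ξ : ℝ → ℝ × ℝ}
    {K : ℝ≥0} (hξ : LipschitzOnWith K ξ (Icc a b)) {P Q : ℝ × ℝ × ℝ} (hP : proj P = ξ a)
    (hQ : proj Q = ξ b) (hA : Q.2.2 - P.2.2 = areaIntegral a b ξ) :
    ccDist W pm pp P Q ≤ kinEnergy W a b ξ / 2 + (b - a) / 2 := by
  have hWc : Continuous W := hW.smooth.continuous
  have hke := hξ.intervalIntegrable_kinEnergy hWc hab
  have hsum : kinEnergy W a b ξ / 2 + (b - a) / 2 =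
      ∫ t in a..b, (W (ξ t) * ((deriv ξ t).1 ^ 2 + (deriv ξ t).2 ^ 2) / 2 + 1 / 2) := by
    rw [intervalIntegral.integral_add (hke.div_const 2) intervalIntegrable_const,
      intervalIntegral.integral_div, intervalIntegral.integral_const, kinEnergy, smul_eq_mul]
    ring
  have hpt : ∀ t, degSpeed W ξ t ≤
      W (ξ t) * ((deriv ξ t).1 ^ 2 + (deriv ξ t).2 ^ 2) / 2 + 1 / 2 := by
    intro t
    have h1 := hW.confFactor_sq (ξ t)
    have h2 := enorm2_sq (deriv ξ t)
    rw [← h1, ← h2, ← mul_pow, degSpeed]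
    nlinarith [sq_nonneg (confFactor W (ξ t) * enorm2 (deriv ξ t) - 1)]
  have hi : IntervalIntegrable (degSpeed W ξ) volume a b := by
    have hdom := (hke.div_const 2).add (intervalIntegrable_const (c := (1 / 2 : ℝ)) (μ := volume))
    rw [intervalIntegrable_iff_integrableOn_Icc_of_le hab] at hdom ⊢
    refine hdom.mono' (aestronglyMeasurable_degSpeed hW hξ.continuousOn) ?_
    refine Eventually.of_forall fun t => ?_
    rw [Real.norm_eq_abs, abs_of_nonneg (degSpeed_nonneg W ξ t)]
    exact hpt t
  rw [hsum]
  have hcu := IsCurve.of_lipschitzOnWith (pm := pm) (pp := pp) hab hξ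
  rw [← hP, ← hQ] at hcu
  refine (ccDist_le_integral hcu (by rw [hA]; exact hξ.hasArea_areaIntegral pm pp hab) hi).trans ?_
  exact intervalIntegral.integral_mono_on hab hi
    ((hke.div_const 2).add intervalIntegrable_const) fun t _ => hpt t

theorem euler_lagrange (hW : TwoWell W pm pp)
    (hcal : ∀ h, fiberDist W pm pp w h < δ → lam * h ≤ fiberDist W pm pp w h)
    (hL : CalLoop W pm pp w lam δ ℓ Γ) {t : ℝ} (ht : t ∈ Ioo 0 ℓ) :
    DifferentiableAt ℝ (projCurve Γ) t ∧
      HasDerivAt (fun u => W (projCurve Γ u) • deriv (projCurve Γ) u)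
      (fderiv ℝ W (projCurve Γ t) (1, 0) / 2 * ((deriv (projCurve Γ) t).1 ^ 2 +
          (deriv (projCurve Γ) t).2 ^ 2) - lam * (deriv (projCurve Γ) t).2,
        fderiv ℝ W (projCurve Γ t) (0, 1) / 2 * ((deriv (projCurve Γ) t).1 ^ 2 +
          (deriv (projCurve Γ) t).2 ^ 2) + lam * (deriv (projCurve Γ) t).1) t := by
  set a := t / 2 with ha
  set b := (t + ℓ) / 2 with hb
  have ht1 := ht.1
  have ht2 := ht.2
  have ha0 : 0 < a := by positivity
  have hbl : b < ℓ := by linarith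
  have hab : a < b := by linarith
  obtain ⟨K, hK⟩ := hL.exists_lipschitzOnWith hW ha0 hbl
  have hoff : ∀ u ∈ Icc a b, projCurve Γ u ≠ pm ∧ projCurve Γ u ≠ pp := fun u hu =>
    hL.off u ⟨ha0.trans_le hu.1, hu.2.trans_lt hbl⟩
  have hC2 : ContDiff ℝ 2 W := by exact_mod_cast contDiff_infty.1 hW.smooth 2
  have hlip' := hL.lip.mono ha0.le hbl.le
  have hs := hL.short
  have hen : kinEnergy W a b (projCurve Γ) ≤ b - a := by
    have hle : kinEnergy W a b (projCurve Γ) ≤ ∫ _ in a..b, (1 : ℝ) := by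
      refine intervalIntegral.integral_mono_ae_restrict hab.le
        (hK.intervalIntegrable_kinEnergy hC2.continuous hab.le) intervalIntegrable_const ?_
      rw [← Measure.restrict_congr_set Ioo_ae_eq_Icc]
      refine (ae_restrict_iff' measurableSet_Ioo).2 ?_
      filter_upwards [hK.ae_differentiableAt_Ioo] with u hu hu'
      have ho := hoff u (Ioo_subset_Icc_self hu')
      have h1 := hlip'.degSpeed_le hW hu' ho.1 ho.2 (hu hu')
      have h0 := degSpeed_nonneg W (projCurve Γ) u
      have h2 := hW.confFactor_sq (projCurve Γ u)
      have h3 := enorm2_sq (deriv (projCurve Γ) u)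
      rw [← h2, ← h3, ← mul_pow]
      exact pow_le_one₀ h0 h1
    simpa using hle
  have har : areaIntegral a b (projCurve Γ) = (Γ b).2.2 - (Γ a).2.2 := by
    refine (hK.hasArea_areaIntegral pm pp hab.le).unique (hlip'.hasArea hW hab.le ?_)
    exact Eventually.of_forall fun u hu => hoff u (Ioo_subset_Icc_self hu)
  refine _root_.euler_lagrange (s := δ / 2) (a := a) (b := b) hC2 hab hK (fun u hu => ?_) (by linarith) ?_
    ⟨by linarith, by linarith⟩
  · rw [Ne, hW.zeroSet]
    push Not
    exact hoff u hu
  · intro ξ K' hξ hξa hξb hξs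
    set P : ℝ × ℝ × ℝ := ((Γ a).1, (Γ a).2.1, 0) with hP
    set Q : ℝ × ℝ × ℝ := ((Γ b).1, (Γ b).2.1, areaIntegral a b ξ) with hQ
    have hle := ccDist_le_kinEnergy hW hab.le hξ (P := P) (Q := Q) hξa.symm hξb.symm (by simp [hP, hQ])
    have := hL.sub_le hW hcal ha0.le hab.le hbl.le (P := P) (Q := Q) rfl rfl (by linarith)
    have e : Q.2.2 - P.2.2 = areaIntegral a b ξ := by simp [hP, hQ]
    rw [e] at this
    rw [har]
    linarith

theorem continuousAt_deriv (hW : TwoWell W pm pp)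
    (hcal : ∀ h, fiberDist W pm pp w h < δ → lam * h ≤ fiberDist W pm pp w h)
    (hL : CalLoop W pm pp w lam δ ℓ Γ) {t : ℝ} (ht : t ∈ Ioo 0 ℓ) :
    ContinuousAt (deriv (projCurve Γ)) t := by
  have hne : ∀ u ∈ Ioo 0 ℓ, W (projCurve Γ u) ≠ 0 := by
    intro u hu
    rw [Ne, hW.zeroSet]
    push Not
    exact hL.off u hu
  obtain ⟨h1, h2⟩ := hL.euler_lagrange hW hcal ht
  have h3 : ContinuousAt (fun u => (W (projCurve Γ u))⁻¹) t :=
    (hW.smooth.continuous.continuousAt.comp h1.continuousAt).inv₀ (hne t ht)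
  refine (h3.smul h2.continuousAt).congr ?_
  filter_upwards [Ioo_mem_nhds ht.1 ht.2] with u hu
  exact inv_smul_smul₀ (hne u hu) _

theorem degSpeed_eq_one (hW : TwoWell W pm pp)
    (hcal : ∀ h, fiberDist W pm pp w h < δ → lam * h ≤ fiberDist W pm pp w h)
    (hL : CalLoop W pm pp w lam δ ℓ Γ) {t : ℝ} (ht : t ∈ Ioo 0 ℓ) :
    degSpeed W (projCurve Γ) t = 1 := by
  have hd := (hL.euler_lagrange hW hcal ht).1
  have ho := hL.off t ht
  refine le_antisymm (hL.lip.degSpeed_le hW ht ho.1 ho.2 hd) ?_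
  by_contra hlt
  push Not at hlt
  obtain ⟨m, hm1, hm2⟩ := exists_between hlt
  have hcont : ContinuousAt (degSpeed W (projCurve Γ)) t :=
    (hW.continuous_confFactor.continuousAt.comp hd.continuousAt).mul
      (continuous_enorm2.continuousAt.comp (hL.continuousAt_deriv hW hcal ht))
  obtain ⟨r, hr, hball⟩ := Metric.eventually_nhds_iff.1 (hcont.eventually_lt_const hm1)
  set v := min (t + r / 2) ((t + ℓ) / 2) with hv
  have hvt : t < v := lt_min (by linarith) (by linarith [ht.2])
  have hvl : v < ℓ := (min_le_right _ _).trans_lt (by linarith [ht.2])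
  have hvr : v ≤ t + r / 2 := min_le_left _ _
  have hlip' := hL.lip.mono ht.1.le hvl.le
  have hoff : ∀ u ∈ Icc t v, projCurve Γ u ≠ pm ∧ projCurve Γ u ≠ pp := fun u hu =>
    hL.off u ⟨ht.1.trans_le hu.1, hu.2.trans_lt hvl⟩
  have hA := hlip'.hasArea hW hvt.le
    (Eventually.of_forall fun u hu => hoff u (Ioo_subset_Icc_self hu))
  have h1 := dCC_le_degLen (W := W) (hlip'.isCurve hW hvt.le) hA
  have h2 := h1.trans (degLen_le_of_degSpeed_le (M := m) hvt.le fun u hu => (hball (by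
    rw [Real.dist_eq, abs_of_pos (by linarith [hu.1])]
    linarith [hu.2])).le)
  have hm0 : 0 ≤ m := (degSpeed_nonneg _ _ _).trans hm1.le
  have h3 : ccDist W pm pp (Γ t) (Γ v) ≤ m * (v - t) :=
    ENNReal.toReal_le_of_le_ofReal (mul_nonneg hm0 (by linarith)) h2
  have h4 : m * (v - t) < 1 * (v - t) := mul_lt_mul_of_pos_right hm2 (by linarith)
  have hs := hL.short
  have h5 := hL.sub_le hW hcal ht.1.le hvt.le hvl.le (P := Γ t) (Q := Γ v) rfl rfl
    (by linarith [ht.1])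
  linarith

theorem momentum_sq (hW : TwoWell W pm pp)
    (hcal : ∀ h, fiberDist W pm pp w h < δ → lam * h ≤ fiberDist W pm pp w h)
    (hL : CalLoop W pm pp w lam δ ℓ Γ) {t : ℝ} (ht : t ∈ Ioo 0 ℓ) :
    W (projCurve Γ t) * ((deriv (projCurve Γ) t).1 ^ 2 + (deriv (projCurve Γ) t).2 ^ 2) = 1 := by
  have h := hL.degSpeed_eq_one hW hcal ht
  have h2 := hW.confFactor_sq (projCurve Γ t)
  have h3 := enorm2_sq (deriv (projCurve Γ) t)
  rw [← h2, ← h3, ← mul_pow]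
  rw [degSpeed] at h
  rw [h, one_pow]

/-- Position and momentum of a calibrated loop solve the Hamiltonian equations. -/
theorem hasDerivAt_phase (hW : TwoWell W pm pp)
    (hcal : ∀ h, fiberDist W pm pp w h < δ → lam * h ≤ fiberDist W pm pp w h)
    (hL : CalLoop W pm pp w lam δ ℓ Γ) {t : ℝ} (ht : t ∈ Ioo 0 ℓ) :
    HasDerivAt (fun u => (projCurve Γ u, W (projCurve Γ u) • deriv (projCurve Γ) u))
      (phaseField W lam (projCurve Γ t, W (projCurve Γ t) • deriv (projCurve Γ) t)) t := by
  obtain ⟨h1, h2⟩ := hL.euler_lagrange hW hcal ht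
  have h3 := hL.momentum_sq hW hcal ht
  have hne : W (projCurve Γ t) ≠ 0 := by
    intro h0
    rw [h0, zero_mul] at h3
    exact zero_ne_one h3
  convert! h1.hasDerivAt.prodMk h2 using 1
  have h4 : (deriv (projCurve Γ) t).1 ^ 2 + (deriv (projCurve Γ) t).2 ^ 2 =
      (W (projCurve Γ t))⁻¹ := by
    refine eq_inv_of_mul_eq_one_left ?_
    rw [mul_comm]
    exact h3
  rw [h4]
  simp only [phaseField, Prod.smul_mk, smul_smul, inv_mul_cancel₀ hne, one_smul, smul_eq_mul,
    Prod.smul_fst, Prod.smul_snd, Prod.mk.injEq, true_and]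
  constructor <;> field_simp

end CalLoop

end

noncomputable section

namespace CalLoop

variable {W : ℝ × ℝ → ℝ} {pm pp w : ℝ × ℝ} {lam δ ℓ : ℝ} {Γ : ℝ → ℝ × ℝ × ℝ}

/-- Closed sub-arcs of calibrated loops are calibrated. -/
theorem height_of_proj_eq (hW : TwoWell W pm pp)
    (hcal : ∀ h, fiberDist W pm pp w h < δ → lam * h ≤ fiberDist W pm pp w h)
    (hL : CalLoop W pm pp w lam δ ℓ Γ) {t₁ t₂ : ℝ} (h0 : 0 ≤ t₁) (h12 : t₁ ≤ t₂) (h2 : t₂ ≤ ℓ)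
    (he : projCurve Γ t₁ = projCurve Γ t₂) : lam * ((Γ t₂).2.2 - (Γ t₁).2.2) = t₂ - t₁ := by
  have m1 : t₁ ∈ Icc 0 ℓ := ⟨h0, h12.trans h2⟩
  have m2 : t₂ ∈ Icc 0 ℓ := ⟨h0.trans h12, h2⟩
  have hs := hL.short
  have hp := hL.pos
  have d0 : ccDist W pm pp (Γ t₁) (Γ t₁) = 0 :=
    le_antisymm (by simpa using hL.lip t₁ m1 t₁ m1) (ccDist_nonneg _ _)
  have a1 := hL.sub_le hW hcal h0 h12 h2 (P := Γ t₁) (Q := Γ t₁) rfl he (by rw [d0]; linarith)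
  rw [d0, sub_self, mul_zero, add_zero] at a1
  set Δ := (Γ t₂).2.2 - (Γ t₁).2.2 with hΔ
  set Q : ℝ × ℝ × ℝ := ((Γ t₂).1, (Γ t₂).2.1, (Γ t₁).2.2 + 2 * Δ) with hQ
  have l1 := hL.lip t₁ m1 t₂ m2
  rw [abs_of_nonneg (by linarith), one_mul] at l1
  have e1 : ccDist W pm pp (Γ t₂) Q = ccDist W pm pp (Γ t₁) (Γ t₂) :=
    ccDist_eq_of_proj_eq he.symm rfl (by simp only [hQ, hΔ]; ring)
  have tr := ccDist_triangle hW (Γ t₁) (Γ t₂) Q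
  have a2 := hL.sub_le hW hcal h0 h12 h2 (P := Γ t₁) (Q := Q) rfl rfl (by linarith)
  have e2 : Q.2.2 - (Γ t₁).2.2 = 2 * Δ := by simp only [hQ]; ring
  rw [e2] at a2
  linarith

/-- Cutting a closed sub-arc out of a calibrated loop. -/
theorem shortcut (hW : TwoWell W pm pp)
    (hcal : ∀ h, fiberDist W pm pp w h < δ → lam * h ≤ fiberDist W pm pp w h)
    (hL : CalLoop W pm pp w lam δ ℓ Γ) {t₁ t₂ : ℝ} (h0 : 0 < t₁) (h12 : t₁ ≤ t₂) (h2 : t₂ < ℓ)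
    (he : projCurve Γ t₁ = projCurve Γ t₂) : ∃ Γ', CalLoop W pm pp w lam δ (ℓ - (t₂ - t₁)) Γ' ∧
      (∀ t ≤ t₁, projCurve Γ' t = projCurve Γ t) ∧
      ∀ t, t₁ < t → projCurve Γ' t = projCurve Γ (t + (t₂ - t₁)) := by
  have hh := hL.height_of_proj_eq hW hcal h0.le h12 h2.le he
  set τ := t₂ - t₁ with hτ
  have hτ0 : 0 ≤ τ := by linarith
  set Δ := (Γ t₂).2.2 - (Γ t₁).2.2 with hΔ
  set Γ' : ℝ → ℝ × ℝ × ℝ := fun t =>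
    if t ≤ t₁ then Γ t else ((Γ (t + τ)).1, (Γ (t + τ)).2.1, (Γ (t + τ)).2.2 - Δ) with hΓ'
  have g1 : ∀ t ≤ t₁, Γ' t = Γ t := fun t ht => if_pos ht
  have g2 : ∀ t, t₁ < t → Γ' t = ((Γ (t + τ)).1, (Γ (t + τ)).2.1, (Γ (t + τ)).2.2 - Δ) :=
    fun t ht => if_neg (not_le.2 ht)
  have p1 : ∀ t ≤ t₁, projCurve Γ' t = projCurve Γ t := fun t ht => by
    simp only [projCurve, g1 t ht]
  have p2 : ∀ t, t₁ < t → projCurve Γ' t = projCurve Γ (t + τ) := fun t ht => by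
    simp only [projCurve, g2 t ht, proj]
  have hp := hL.pos
  have hs := hL.short
  have hbase : ∀ s t, 0 ≤ s → s ≤ t → t ≤ ℓ → ccDist W pm pp (Γ s) (Γ t) ≤ t - s := by
    intro s t hs' hst ht
    have := hL.lip s ⟨hs', hst.trans ht⟩ t ⟨hs'.trans hst, ht⟩
    rwa [abs_of_nonneg (by linarith), one_mul] at this
  refine ⟨Γ', ⟨by linarith, by linarith, IsCCLip.of_le fun s t hs' hst ht => ?_, ?_, ?_, ?_, ?_⟩,
    p1, p2⟩
  · rw [one_mul]
    rcases le_or_gt t t₁ with htc | htc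
    · rw [g1 t htc, g1 s (hst.trans htc)]
      exact hbase s t hs' hst (by linarith)
    rcases le_or_gt s t₁ with hsc | hsc
    · have tr := ccDist_triangle hW (Γ' s) (Γ t₁) (Γ' t)
      have b1 := hbase s t₁ hs' hsc (by linarith)
      have b2 := hbase t₂ (t + τ) (by linarith) (by linarith) (by linarith)
      have e : ccDist W pm pp (Γ t₁) (Γ' t) = ccDist W pm pp (Γ t₂) (Γ (t + τ)) :=
        ccDist_eq_of_proj_eq he (p2 t htc) (by rw [g2 t htc]; simp only [hΔ]; ring)
      rw [g1 s hsc] at tr ⊢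
      linarith
    · have e : ccDist W pm pp (Γ' s) (Γ' t) = ccDist W pm pp (Γ (s + τ)) (Γ (t + τ)) :=
        ccDist_eq_of_proj_eq (p2 s hsc) (p2 t htc) (by rw [g2 s hsc, g2 t htc]; ring)
      rw [e]
      have := hbase (s + τ) (t + τ) (by linarith) (by linarith) (by linarith)
      linarith
  · rw [p1 0 h0.le]
    exact hL.start
  · rw [p2 _ (by linarith), sub_add_cancel]
    exact hL.terminus
  · intro t ht
    rcases le_or_gt t t₁ with htc | htc
    · rw [p1 t htc]
      exact hL.off t ⟨ht.1, by linarith [ht.2]⟩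
    · rw [p2 t htc]
      exact hL.off _ ⟨by linarith [ht.1], by linarith [ht.2]⟩
  · rw [g2 _ (by linarith), g1 0 h0.le, sub_add_cancel]
    have := hL.height
    linarith

/-- The projection of a calibrated loop is simple. -/
theorem proj_ne (hW : TwoWell W pm pp) (hw : w = pm ∨ w = pp)
    (hcal : ∀ h, fiberDist W pm pp w h < δ → lam * h ≤ fiberDist W pm pp w h)
    (hL : CalLoop W pm pp w lam δ ℓ Γ) {t₁ t₂ : ℝ} (h0 : 0 < t₁) (h12 : t₁ < t₂) (h2 : t₂ < ℓ) :
    projCurve Γ t₁ ≠ projCurve Γ t₂ := by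
  intro he
  obtain ⟨Γ', hL', p1, p2⟩ := hL.shortcut hW hcal h0 h12.le h2 he
  set τ := t₂ - t₁ with hτ
  have hτ0 : 0 < τ := by linarith
  have hC2 : ContDiff ℝ 2 W := by exact_mod_cast contDiff_infty.1 hW.smooth 2
  set Φ : ℝ → (ℝ × ℝ) × (ℝ × ℝ) :=
    fun u => (projCurve Γ u, W (projCurve Γ u) • deriv (projCurve Γ) u) with hΦ
  set Φ' : ℝ → (ℝ × ℝ) × (ℝ × ℝ) :=
    fun u => (projCurve Γ' u, W (projCurve Γ' u) • deriv (projCurve Γ') u) with hΦ'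
  have hstart : Φ (t₁ / 2) = Φ' (t₁ / 2) := by
    have hev : projCurve Γ' =ᶠ[𝓝 (t₁ / 2)] projCurve Γ := by
      filter_upwards [Iio_mem_nhds (show t₁ / 2 < t₁ by linarith)] with t ht
      exact p1 t (le_of_lt ht)
    simp only [hΦ, hΦ']
    rw [hev.deriv_eq, hev.eq_of_nhds]
  have hd : ∀ t ∈ Ioo 0 ℓ, HasDerivAt Φ (phaseField W lam (Φ t)) t := fun t ht =>
    hL.hasDerivAt_phase hW hcal ht
  have hd' : ∀ t ∈ Ioo 0 (ℓ - τ), HasDerivAt Φ' (phaseField W lam (Φ' t)) t := fun t ht =>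
    hL'.hasDerivAt_phase hW hcal ht
  have huniq : ∀ b, t₁ < b → b < ℓ - τ → projCurve Γ b = projCurve Γ (b + τ) := by
    intro b hb1 hb2
    have s1 : ∀ t ∈ Icc (t₁ / 2) b, t ∈ Ioo 0 ℓ := fun t ht =>
      ⟨by linarith [ht.1], by linarith [ht.2]⟩
    have s2 : ∀ t ∈ Icc (t₁ / 2) b, t ∈ Ioo 0 (ℓ - τ) := fun t ht =>
      ⟨by linarith [ht.1], by linarith [ht.2]⟩
    have c1 : ContinuousOn Φ (Icc (t₁ / 2) b) := fun t ht =>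
      (hd t (s1 t ht)).continuousAt.continuousWithinAt
    have c2 : ContinuousOn Φ' (Icc (t₁ / 2) b) := fun t ht =>
      (hd' t (s2 t ht)).continuousAt.continuousWithinAt
    set S := Φ '' Icc (t₁ / 2) b ∪ Φ' '' Icc (t₁ / 2) b with hS
    have hSc : IsCompact S :=
      (isCompact_Icc.image_of_continuousOn c1).union (isCompact_Icc.image_of_continuousOn c2)
    have hSne : ∀ z ∈ S, W z.1 ≠ 0 := by
      rintro z (⟨t, ht, rfl⟩ | ⟨t, ht, rfl⟩)
      · rw [Ne, hW.zeroSet]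
        push Not
        exact hL.off t (s1 t ht)
      · rw [Ne, hW.zeroSet]
        push Not
        exact hL'.off t (s2 t ht)
    obtain ⟨K, hK⟩ := LocallyLipschitzOn.exists_lipschitzOnWith_of_compact (f := phaseField W lam)
      hSc fun z hz => by
        obtain ⟨K, t, ht, hK⟩ :=
          (contDiffAt_phaseField hC2 lam (hSne z hz)).exists_lipschitzOnWith
        exact ⟨K, t, mem_nhdsWithin_of_mem_nhds ht, hK⟩
    have hEq := ODE_solution_unique_of_mem_Icc_right (v := fun _ => phaseField W lam)
      (s := fun _ => S) (fun _ _ => hK) c1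
      (fun t ht => (hd t (s1 t (Ico_subset_Icc_self ht))).hasDerivWithinAt)
      (fun t ht => Or.inl (mem_image_of_mem _ (Ico_subset_Icc_self ht))) c2
      (fun t ht => (hd' t (s2 t (Ico_subset_Icc_self ht))).hasDerivWithinAt)
      (fun t ht => Or.inr (mem_image_of_mem _ (Ico_subset_Icc_self ht))) hstart
    have h3 := hEq (right_mem_Icc.2 (by linarith : t₁ / 2 ≤ b))
    have h4 : projCurve Γ b = projCurve Γ' b := congrArg Prod.fst h3
    rw [h4, p2 b hb1]
  have hc := hL.lip.continuousOn hW
  have m1 : ℓ - τ ∈ Icc 0 ℓ := ⟨by linarith, by linarith⟩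
  have l1 : Tendsto (projCurve Γ) (𝓝[<] (ℓ - τ)) (𝓝 (projCurve Γ (ℓ - τ))) :=
    (hc (ℓ - τ) m1).mono_left
      (nhdsWithin_le_of_mem (mem_of_superset (Icc_mem_nhdsLT (by linarith : (0 : ℝ) < ℓ - τ))
        (Icc_subset_Icc le_rfl m1.2)))
  have l2 : Tendsto (fun b => projCurve Γ (b + τ)) (𝓝[<] (ℓ - τ)) (𝓝 (projCurve Γ ℓ)) := by
    refine (hc ℓ (right_mem_Icc.2 hL.pos.le)).tendsto.comp ?_
    refine tendsto_nhdsWithin_of_tendsto_nhds_of_eventually_within _ ?_ ?_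
    · have : Tendsto (fun b : ℝ => b + τ) (𝓝 (ℓ - τ)) (𝓝 (ℓ - τ + τ)) :=
        (continuous_id.add continuous_const).tendsto _
      rw [sub_add_cancel] at this
      exact tendsto_nhdsWithin_of_tendsto_nhds this
    · filter_upwards [Ioo_mem_nhdsLT (by linarith : (0 : ℝ) < ℓ - τ)] with b hb
      exact ⟨by linarith [hb.1], by linarith [hb.2]⟩
  have h5 : projCurve Γ (ℓ - τ) = projCurve Γ ℓ := by
    refine tendsto_nhds_unique l1 (l2.congr' ?_)
    filter_upwards [Ioo_mem_nhdsLT (by linarith : t₁ < ℓ - τ)] with b hb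
    exact (huniq b hb.1 hb.2).symm
  have h6 := hL.off (ℓ - τ) ⟨by linarith, by linarith⟩
  rw [h5, hL.terminus] at h6
  rcases hw with h | h
  · exact h6.1 h
  · exact h6.2 h

end CalLoop

end

noncomputable section

/-! ### Perturbed rotations return -/

/-- If `g` is maximal at `m`, and `θ` is an increasing coordinate which varies at least by `L` on
both sides of `m`, then `g` takes equal values at two points at `θ`-distance `L`. -/
theorem exists_eq_of_shift {θ g : ℝ → ℝ} {a b m L : ℝ} (hL : 0 ≤ L) (hm : m ∈ Icc a b)
    (hθ : ContinuousOn θ (Icc a b)) (hmono : StrictMonoOn θ (Icc a b))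
    (hg : ContinuousOn g (Icc a b)) (hmax : ∀ t ∈ Icc a b, g t ≤ g m) (ha : θ a ≤ θ m - L)
    (hb : θ m + L ≤ θ b) :
    ∃ t₁ ∈ Icc a b, ∃ t₂ ∈ Icc a b, θ t₂ = θ t₁ + L ∧ g t₁ = g t₂ := by
  have hab : a ≤ b := hm.1.trans hm.2
  set κ : ℝ → ℝ := fun x => max a (min b x) with hκ
  have hκc : Continuous κ := by fun_prop
  have hκm : ∀ x, κ x ∈ Icc a b := fun x =>
    ⟨le_max_left _ _, max_le hab (min_le_left _ _)⟩
  have hκid : ∀ x ∈ Icc a b, κ x = x := fun x hx => by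
    simp [hκ, min_eq_right hx.2, max_eq_right hx.1]
  set Θ : ℝ → ℝ := fun x => θ (κ x) + (x - κ x) with hΘ
  have hΘc : Continuous Θ := by
    have : Continuous fun x => θ (κ x) := hθ.comp_continuous hκc hκm
    exact this.add (continuous_id.sub hκc)
  have hκlip : ∀ x y, x ≤ y → κ x ≤ κ y ∧ κ y - κ x ≤ y - x := by
    intro x y hxy
    refine ⟨max_le_max le_rfl (min_le_min le_rfl hxy), ?_⟩
    simp only [hκ]
    rcases max_cases a (min b x) with h | h <;> rcases max_cases a (min b y) with h' | h' <;>
      rcases min_cases b x with k | k <;> rcases min_cases b y with k' | k' <;> linarith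
  have hΘm : StrictMono Θ := by
    intro x y hxy
    obtain ⟨h1, h2⟩ := hκlip x y hxy.le
    simp only [hΘ]
    rcases h1.eq_or_lt with h | h
    · rw [h]
      linarith
    · have := hmono (hκm x) (hκm y) h
      linarith
  have htop : Tendsto Θ atTop atTop := by
    refine tendsto_atTop_mono' _ (f₁ := fun x => θ b + (x - b)) ?_ ?_
    · filter_upwards [eventually_ge_atTop b] with x hx
      simp [hΘ, hκ, min_eq_left hx, max_eq_right hab]
    · exact tendsto_atTop_add_const_left _ _ (tendsto_atTop_add_const_right _ _ tendsto_id)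
  have hbot : Tendsto Θ atBot atBot := by
    refine tendsto_atBot_mono' _ (f₁ := fun x => θ a + (x - a)) ?_ ?_
    · filter_upwards [eventually_le_atBot a] with x hx
      simp [hΘ, hκ, min_eq_right (hx.trans hab), max_eq_left hx]
    · exact tendsto_atBot_add_const_left _ _ (tendsto_atBot_add_const_right _ _ tendsto_id)
  have hsurj := hΘc.surjective htop hbot
  set E := StrictMono.orderIsoOfSurjective Θ hΘm hsurj with hE
  have hEΘ : ∀ u, Θ (E.symm u) = u := fun u => E.apply_symm_apply u
  have hΘθ : ∀ x ∈ Icc a b, Θ x = θ x := fun x hx => by simp [hΘ, hκid x hx]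
  have hmem : ∀ u, θ a ≤ u → u ≤ θ b → E.symm u ∈ Icc a b := by
    intro u h1 h2
    constructor
    · rw [← hΘm.le_iff_le, hEΘ, hΘθ a (left_mem_Icc.2 hab)]
      exact h1
    · rw [← hΘm.le_iff_le, hEΘ, hΘθ b (right_mem_Icc.2 hab)]
      exact h2
  have hval : ∀ u, θ a ≤ u → u ≤ θ b → θ (E.symm u) = u := fun u h1 h2 => by
    rw [← hΘθ _ (hmem u h1 h2), hEΘ]
  have hEm : E.symm (θ m) = m := by
    apply hΘm.injective
    rw [hEΘ, hΘθ m hm]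
  have hEc : Continuous E.symm := E.symm.continuous
  set h : ℝ → ℝ := fun u => g (E.symm (u + L)) - g (E.symm u) with hh
  have hhc : ContinuousOn h (Icc (θ m - L) (θ m)) := by
    refine ContinuousOn.sub (hg.comp (by fun_prop) ?_) (hg.comp hEc.continuousOn ?_)
    · intro u hu
      exact hmem _ (by linarith [hu.1]) (by linarith [hu.2])
    · intro u hu
      exact hmem _ (by linarith [hu.1]) (by linarith [hu.2])
  have h0 : h (θ m) ≤ 0 := by
    simp only [hh, hEm]
    have := hmax _ (hmem (θ m + L) (by linarith) (by linarith))
    linarith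
  have h1 : 0 ≤ h (θ m - L) := by
    simp only [hh, sub_add_cancel, hEm]
    have := hmax _ (hmem (θ m - L) (by linarith) (by linarith))
    linarith
  obtain ⟨u, hu, hu0⟩ := intermediate_value_Icc' (by linarith : θ m - L ≤ θ m) hhc ⟨h0, h1⟩
  have r1 : θ a ≤ u := by linarith [hu.1]
  have r2 : u ≤ θ b := by linarith [hu.2]
  have r3 : θ a ≤ u + L := by linarith [hu.1]
  have r4 : u + L ≤ θ b := by linarith [hu.2]
  refine ⟨E.symm u, hmem u r1 r2, E.symm (u + L), hmem _ r3 r4, ?_, ?_⟩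
  · rw [hval _ r1 r2, hval _ r3 r4]
  · simp only [hh] at hu0
    linarith

/-- A weighted Gronwall inequality on both sides of `m`. -/
theorem le_mul_exp_of_abs_deriv_le {N N' s ω : ℝ → ℝ} {a b m L : ℝ} (hm : m ∈ Ioo a b)
    (hN : ∀ t ∈ Ioo a b, HasDerivAt N (N' t) t) (hs : ∀ t ∈ Ioo a b, HasDerivAt s (ω t) t)
    (hsm : s m = 0) (hL : 0 ≤ L) (hN0 : 0 ≤ N m)
    (hle : ∀ t ∈ Ioo a b, |N' t| ≤ ω t * (L * N t)) {t : ℝ} (ht : t ∈ Ioo a b) :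
    N t ≤ N m * Real.exp (L * |s t|) := by
  rcases le_total m t with h | h
  · suffices N t ≤ N m * Real.exp (L * s t) by
      refine this.trans ?_
      gcongr
      exact le_abs_self _
    have hsub : Icc m t ⊆ Ioo a b := fun x hx => ⟨hm.1.trans_le hx.1, hx.2.trans_lt ht.2⟩
    have hd : ∀ x ∈ Ioo a b, HasDerivAt (fun x => N x * Real.exp (-(L * s x)))
        ((N' x - ω x * (L * N x)) * Real.exp (-(L * s x))) x := by
      intro x hx
      have := (hN x hx).mul (((hs x hx).const_mul L).neg.exp)
      convert! this using 1
      simp only [Pi.neg_apply]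
      ring
    have hanti : AntitoneOn (fun x => N x * Real.exp (-(L * s x))) (Icc m t) := by
      refine antitoneOn_of_deriv_nonpos (convex_Icc m t)
        (fun x hx => (hd x (hsub hx)).continuousAt.continuousWithinAt)
        (fun x hx => (hd x (hsub (interior_subset hx))).differentiableAt.differentiableWithinAt) ?_
      intro x hx
      have hx' := hsub (interior_subset hx)
      rw [(hd x hx').deriv]
      have := (le_abs_self _).trans (hle x hx')
      exact mul_nonpos_of_nonpos_of_nonneg (by linarith) (Real.exp_pos _).le
    have := hanti (left_mem_Icc.2 h) (right_mem_Icc.2 h) h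
    simp only [hsm, mul_zero, neg_zero, Real.exp_zero, mul_one] at this
    rw [Real.exp_neg, ← div_eq_mul_inv, div_le_iff₀ (Real.exp_pos _)] at this
    exact this
  · suffices N t ≤ N m * Real.exp (-(L * s t)) by
      refine this.trans ?_
      rw [← mul_neg]
      gcongr
      exact neg_le_abs _
    have hsub : Icc t m ⊆ Ioo a b := fun x hx => ⟨ht.1.trans_le hx.1, hx.2.trans_lt hm.2⟩
    have hd : ∀ x ∈ Ioo a b, HasDerivAt (fun x => N x * Real.exp (L * s x))
        ((N' x + ω x * (L * N x)) * Real.exp (L * s x)) x := by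
      intro x hx
      have := (hN x hx).mul (((hs x hx).const_mul L).exp)
      convert! this using 1
      ring
    have hmono : MonotoneOn (fun x => N x * Real.exp (L * s x)) (Icc t m) := by
      refine monotoneOn_of_deriv_nonneg (convex_Icc t m)
        (fun x hx => (hd x (hsub hx)).continuousAt.continuousWithinAt)
        (fun x hx => (hd x (hsub (interior_subset hx))).differentiableAt.differentiableWithinAt) ?_
      intro x hx
      have hx' := hsub (interior_subset hx)
      rw [(hd x hx').deriv]
      have := (neg_le_abs _).trans (hle x hx')
      exact mul_nonneg (by linarith) (Real.exp_pos _).le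
    have := hmono (left_mem_Icc.2 h) (right_mem_Icc.2 h) h
    simp only [hsm, mul_zero, Real.exp_zero, mul_one] at this
    rw [Real.exp_neg, ← div_eq_mul_inv, le_div_iff₀ (Real.exp_pos _)]
    exact this

end

noncomputable section

/-- A curve in the complex plane which, near its point of largest modulus, moves almost like a
rotation, takes some value twice. -/
theorem exists_return {μ K C₁ C₂ : ℝ} (hμ : 0 < μ) (hK : 0 ≤ K) (hC₂ : 0 ≤ C₂) :
    ∃ ε₀ > 0, ∀ ε, 0 < ε → ε ≤ ε₀ → ∀ (ℓ m : ℝ) (y d d₁ : ℝ → ℂ) (ω : ℝ → ℝ), m ∈ Ioo 0 ℓ →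
      ContinuousOn y (Icc 0 ℓ) → y 0 = 0 → y ℓ = 0 → y m ≠ 0 → (∀ t ∈ Ioo 0 ℓ, ‖y t‖ ≤ ‖y m‖) →
      (∀ t ∈ Ioo 0 ℓ, 0 < ω t ∧ ContinuousAt ω t ∧
        HasDerivAt y (ω t * (d t + Complex.I * μ * y t)) t ∧ HasDerivAt d (ω t * d₁ t) t ∧
        ‖d₁ t‖ ≤ K * ‖d t‖ + C₂ * (ε * ‖y m‖)) → ‖d m‖ ≤ C₁ * (ε * ‖y m‖) →
      ∃ t₁ t₂, 0 < t₁ ∧ t₁ < t₂ ∧ t₂ < ℓ ∧ y t₁ = y t₂ := by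
  have hpi := Real.pi_pos
  set L := 2 * K + C₂ with hLdef
  have hL0 : 0 ≤ L := by positivity
  set S := 4 * Real.pi / μ with hS
  have hS0 : 0 < S := by positivity
  have hμS : μ * S = 4 * Real.pi := by rw [hS]; field_simp
  set C₃ := √((C₁ ^ 2 + 1) * Real.exp (L * S)) with hC₃
  have hC₃p : 0 < C₃ := Real.sqrt_pos.2 (by positivity)
  have hC₃sq : C₃ ^ 2 = (C₁ ^ 2 + 1) * Real.exp (L * S) := Real.sq_sqrt (by positivity)
  refine ⟨min (1 / (2 * C₃ * S)) (μ / (4 * C₃)), by positivity, ?_⟩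
  intro ε hε hεle ℓ m y d d₁ ω hm hyc hy0 hyℓ hym hmax hode hdm
  have hε1 : C₃ * ε * S ≤ 1 / 2 := by
    have := hεle.trans (min_le_left _ _)
    rw [le_div_iff₀ (by positivity)] at this
    linarith
  have hε2 : 2 * (C₃ * ε) < μ := by
    have := hεle.trans (min_le_right _ _)
    rw [le_div_iff₀ (by positivity)] at this
    nlinarith
  set R := ‖y m‖ with hR
  have hR0 : 0 < R := norm_pos_iff.2 hym
  have hωc : ContinuousOn ω (Ioo 0 ℓ) := fun t ht => (hode t ht).2.1.continuousWithinAt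
  have huIcc : ∀ t ∈ Ioo 0 ℓ, uIcc m t ⊆ Ioo 0 ℓ := fun t ht => by
    exact (ordConnected_Ioo.uIcc_subset hm ht)
  set s : ℝ → ℝ := fun t => ∫ u in m..t, ω u with hs
  have hsm : s m = 0 := intervalIntegral.integral_same
  have hsd : ∀ t ∈ Ioo 0 ℓ, HasDerivAt s (ω t) t := fun t ht =>
    intervalIntegral.integral_hasDerivAt_right ((hωc.mono (huIcc t ht)).intervalIntegrable)
      (hωc.stronglyMeasurableAtFilter isOpen_Ioo t ht) (hode t ht).2.1
  have hsc : ContinuousOn s (Ioo 0 ℓ) := fun t ht => (hsd t ht).continuousAt.continuousWithinAt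
  have hsmono : StrictMonoOn s (Ioo 0 ℓ) := by
    refine strictMonoOn_of_deriv_pos (convex_Ioo 0 ℓ) hsc fun t ht => ?_
    rw [interior_Ioo] at ht
    rw [(hsd t ht).deriv]
    exact (hode t ht).1
  have hdbound : ∀ t ∈ Ioo 0 ℓ, |s t| ≤ S → ‖d t‖ ≤ C₃ * (ε * R) := by
    intro t ht hst
    have hN : ∀ t ∈ Ioo 0 ℓ, HasDerivAt (fun t => ‖d t‖ ^ 2 + (ε * R) ^ 2)
        (2 * inner ℝ (d t) (ω t * d₁ t)) t := fun t ht =>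
      ((hode t ht).2.2.2.1.norm_sq).add_const _
    have hgr := le_mul_exp_of_abs_deriv_le (L := L) hm hN hsd hsm hL0 (by positivity) (by
      intro t ht
      obtain ⟨h1, -, -, -, h2⟩ := hode t ht
      rw [abs_mul, abs_two]
      have h3 := abs_real_inner_le_norm (d t) (ω t * d₁ t)
      rw [norm_mul, Complex.norm_real, Real.norm_eq_abs, abs_of_pos h1] at h3
      have h4 : ‖d t‖ * (ω t * ‖d₁ t‖) ≤ ‖d t‖ * (ω t * (K * ‖d t‖ + C₂ * (ε * R))) := by gcongr
      have h5 : 2 * ‖d t‖ * (ε * R) ≤ ‖d t‖ ^ 2 + (ε * R) ^ 2 := two_mul_le_add_sq _ _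
      have h6 : C₂ * (2 * ‖d t‖ * (ε * R)) ≤ C₂ * (‖d t‖ ^ 2 + (ε * R) ^ 2) := by gcongr
      have h7 : 0 ≤ 2 * K * (ε * R) ^ 2 := by positivity
      calc 2 * |inner ℝ (d t) (ω t * d₁ t)| ≤ 2 * (‖d t‖ * (ω t * (K * ‖d t‖ + C₂ * (ε * R)))) := by
            linarith
        _ = ω t * (2 * K * ‖d t‖ ^ 2 + C₂ * (2 * ‖d t‖ * (ε * R))) := by ring
        _ ≤ ω t * (L * (‖d t‖ ^ 2 + (ε * R) ^ 2)) := by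
            gcongr
            rw [hLdef]
            linarith) ht
    refine le_of_sq_le_sq ?_ (by positivity)
    have h1 : ‖d m‖ ^ 2 + (ε * R) ^ 2 ≤ (C₁ ^ 2 + 1) * (ε * R) ^ 2 := by
      have : ‖d m‖ ^ 2 ≤ (C₁ * (ε * R)) ^ 2 := by gcongr
      linarith
    have h2 : Real.exp (L * |s t|) ≤ Real.exp (L * S) := by gcongr
    have h3 : (‖d m‖ ^ 2 + (ε * R) ^ 2) * Real.exp (L * |s t|) ≤
        (C₁ ^ 2 + 1) * (ε * R) ^ 2 * Real.exp (L * S) := by gcongr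
    rw [mul_pow, hC₃sq]
    have h4 : 0 ≤ (ε * R) ^ 2 := by positivity
    linarith
  set v : ℝ → ℂ := fun t => y t / y m * Complex.exp (-(Complex.I * μ * s t)) with hv
  have hEn : ∀ x : ℝ, ‖Complex.exp (-(Complex.I * μ * x))‖ = 1 := by
    intro x
    rw [Complex.norm_exp]
    simp
  set v' : ℝ → ℂ := fun t => ω t * d t / y m * Complex.exp (-(Complex.I * μ * s t)) with hv'
  have hvd : ∀ t ∈ Ioo 0 ℓ, HasDerivAt v (v' t) t := by
    intro t ht
    obtain ⟨-, -, h1, -, -⟩ := hode t ht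
    have h2 : HasDerivAt (fun t => Complex.exp (-(Complex.I * μ * s t)))
        (Complex.exp (-(Complex.I * μ * s t)) * (-(Complex.I * μ * ω t))) t :=
      (((hsd t ht).ofReal_comp.const_mul (Complex.I * μ)).neg).cexp
    have := (h1.div_const (y m)).mul h2
    convert! this using 1
    simp only [hv']
    ring
  have hvn : ∀ t, ‖v t‖ = ‖y t‖ / R := by
    intro t
    simp only [hv]
    rw [norm_mul, hEn, mul_one, norm_div]
  have hv'n : ∀ t ∈ Ioo 0 ℓ, |s t| ≤ S → ‖v' t‖ ≤ C₃ * ε * ω t := by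
    intro t ht hst
    have h0 := (hode t ht).1
    simp only [hv']
    rw [norm_mul, hEn, mul_one, norm_div, norm_mul, Complex.norm_real, Real.norm_eq_abs,
      abs_of_pos h0, div_le_iff₀ hR0]
    have := hdbound t ht hst
    have h1 : ω t * ‖d t‖ ≤ ω t * (C₃ * (ε * R)) := by gcongr
    linarith
  have hvm : v m = 1 := by
    simp only [hv, hsm]
    simp [hym]
  have hsle : ∀ t ∈ Ioo 0 ℓ, ∀ x ∈ uIcc m t, |s x| ≤ |s t| := by
    intro t ht x hx
    have hx' := huIcc t ht hx
    rcases le_total m t with h | h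
    · rw [uIcc_of_le h] at hx
      have h1 := hsmono.monotoneOn hm hx' hx.1
      have h2 := hsmono.monotoneOn hx' ht hx.2
      rw [hsm] at h1
      rw [abs_of_nonneg h1, abs_of_nonneg (h1.trans h2)]
      exact h2
    · rw [uIcc_of_ge h] at hx
      have h1 := hsmono.monotoneOn hx' hm hx.2
      have h2 := hsmono.monotoneOn ht hx' hx.1
      rw [hsm] at h1
      rw [abs_of_nonpos h1, abs_of_nonpos (h2.trans h1)]
      linarith
  have hdc : ContinuousOn d (Ioo 0 ℓ) := fun t ht =>
    (hode t ht).2.2.2.1.continuousAt.continuousWithinAt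
  have hv'c : ContinuousOn v' (Ioo 0 ℓ) := by
    have h1 : ContinuousOn (fun t => (ω t : ℂ)) (Ioo 0 ℓ) :=
      Complex.continuous_ofReal.comp_continuousOn hωc
    have h2 : ContinuousOn (fun t => (s t : ℂ)) (Ioo 0 ℓ) :=
      Complex.continuous_ofReal.comp_continuousOn hsc
    exact ((h1.mul hdc).div_const _).mul
      (Complex.continuous_exp.comp_continuousOn (continuousOn_const.mul h2).neg)
  have hvbound : ∀ t ∈ Ioo 0 ℓ, |s t| ≤ S → ‖v t - 1‖ ≤ 1 / 2 := by
    intro t ht hst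
    have hsub := huIcc t ht
    have e1 : v t - 1 = ∫ x in m..t, v' x := by
      rw [intervalIntegral.integral_eq_sub_of_hasDerivAt (fun x hx => hvd x (hsub hx))
        ((hv'c.mono hsub).intervalIntegrable), hvm]
    have e2 : ‖∫ x in m..t, v' x‖ ≤ |∫ x in m..t, C₃ * ε * ω x| := by
      refine intervalIntegral.norm_integral_le_abs_of_norm_le ?_
        ((hωc.mono hsub).intervalIntegrable.const_mul _)
      refine (ae_restrict_iff' measurableSet_uIoc).2 (Eventually.of_forall fun x hx => ?_)
      have hx' := uIoc_subset_uIcc hx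
      exact hv'n x (hsub hx') ((hsle t ht x hx').trans hst)
    rw [e1]
    refine e2.trans ?_
    rw [intervalIntegral.integral_const_mul, abs_mul, abs_of_pos (by positivity : 0 < C₃ * ε)]
    exact (mul_le_mul_of_nonneg_left hst (by positivity)).trans hε1
  have hvlow : ∀ t ∈ Ioo 0 ℓ, |s t| ≤ S → 1 / 2 ≤ ‖v t‖ := by
    intro t ht hst
    have h1 := hvbound t ht hst
    have h2 := norm_sub_norm_le (1 : ℂ) (v t)
    rw [norm_one, norm_sub_rev] at h2
    linarith
  have hylow : ∀ t ∈ Ioo 0 ℓ, |s t| ≤ S → R / 2 ≤ ‖y t‖ := by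
    intro t ht hst
    have h1 := hvlow t ht hst
    rw [hvn, le_div_iff₀ hR0] at h1
    linarith
  obtain ⟨tb, htb, htbS⟩ : ∃ tb ∈ Ico m ℓ, s tb = S := by
    by_contra hcon
    push Not at hcon
    have hlt : ∀ t ∈ Ico m ℓ, s t ≤ S := by
      intro t ht
      by_contra hgt
      push Not at hgt
      have hsub : Icc m t ⊆ Ioo 0 ℓ := fun x hx => ⟨hm.1.trans_le hx.1, hx.2.trans_lt ht.2⟩
      obtain ⟨x, hx, hxS⟩ := intermediate_value_Icc ht.1 (hsc.mono hsub)
        (show S ∈ Icc (s m) (s t) from ⟨by rw [hsm]; exact hS0.le, hgt.le⟩)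
      exact hcon x ⟨hx.1, hx.2.trans_lt ht.2⟩ hxS
    have hlim : Tendsto (fun t => ‖y t‖) (𝓝[<] ℓ) (𝓝 ‖y ℓ‖) :=
      ((hyc ℓ (right_mem_Icc.2 (hm.1.trans hm.2).le)).mono_left
        (nhdsWithin_le_of_mem (Icc_mem_nhdsLT (hm.1.trans hm.2)))).norm
    have hge : R / 2 ≤ ‖y ℓ‖ := by
      refine ge_of_tendsto hlim ?_
      filter_upwards [Ioo_mem_nhdsLT hm.2] with t ht
      have ht' : t ∈ Ioo 0 ℓ := ⟨hm.1.trans ht.1, ht.2⟩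
      refine hylow t ht' ?_
      have h1 := hsmono.monotoneOn hm ht' ht.1.le
      rw [hsm] at h1
      rw [abs_of_nonneg h1]
      exact hlt t ⟨ht.1.le, ht.2⟩
    rw [hyℓ, norm_zero] at hge
    linarith
  obtain ⟨ta, hta, htaS⟩ : ∃ ta ∈ Ioc 0 m, s ta = -S := by
    by_contra hcon
    push Not at hcon
    have hlt : ∀ t ∈ Ioc 0 m, -S ≤ s t := by
      intro t ht
      by_contra hgt
      push Not at hgt
      have hsub : Icc t m ⊆ Ioo 0 ℓ := fun x hx => ⟨ht.1.trans_le hx.1, hx.2.trans_lt hm.2⟩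
      obtain ⟨x, hx, hxS⟩ := intermediate_value_Icc ht.2 (hsc.mono hsub)
        (show -S ∈ Icc (s t) (s m) from ⟨hgt.le, by rw [hsm]; linarith⟩)
      exact hcon x ⟨ht.1.trans_le hx.1, hx.2⟩ hxS
    have hlim : Tendsto (fun t => ‖y t‖) (𝓝[>] 0) (𝓝 ‖y 0‖) :=
      ((hyc 0 (left_mem_Icc.2 (hm.1.trans hm.2).le)).mono_left
        (nhdsWithin_le_of_mem (Icc_mem_nhdsGT (hm.1.trans hm.2)))).norm
    have hge : R / 2 ≤ ‖y 0‖ := by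
      refine ge_of_tendsto hlim ?_
      filter_upwards [Ioo_mem_nhdsGT hm.1] with t ht
      have ht' : t ∈ Ioo 0 ℓ := ⟨ht.1, ht.2.trans hm.2⟩
      refine hylow t ht' ?_
      have h1 := hsmono.monotoneOn ht' hm ht.2.le
      rw [hsm] at h1
      rw [abs_of_nonpos h1]
      linarith [hlt t ⟨ht.1, ht.2.le⟩]
    rw [hy0, norm_zero] at hge
    linarith
  have hsub : Icc ta tb ⊆ Ioo 0 ℓ := fun x hx => ⟨hta.1.trans_le hx.1, hx.2.trans_lt htb.2⟩
  have hta' : ta ∈ Ioo 0 ℓ := ⟨hta.1, hta.2.trans_lt hm.2⟩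
  have htb' : tb ∈ Ioo 0 ℓ := ⟨hm.1.trans_le htb.1, htb.2⟩
  have hsS : ∀ t ∈ Icc ta tb, |s t| ≤ S := by
    intro t ht
    have h1 := hsmono.monotoneOn hta' (hsub ht) ht.1
    have h2 := hsmono.monotoneOn (hsub ht) htb' ht.2
    rw [abs_le]
    exact ⟨by linarith, by linarith⟩
  have hslit : ∀ t ∈ Icc ta tb, v t ∈ Complex.slitPlane := by
    intro t ht
    left
    have h1 := (Complex.abs_re_le_norm (v t - 1)).trans (hvbound t (hsub ht) (hsS t ht))
    rw [Complex.sub_re, Complex.one_re] at h1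
    linarith [(abs_le.1 h1).1]
  set θ : ℝ → ℝ := fun t => μ * s t + (Complex.log (v t)).im with hθ
  have hθd : ∀ t ∈ Icc ta tb, HasDerivAt θ (μ * ω t + (v' t / v t).im) t := by
    intro t ht
    have h1 := (hvd t (hsub ht)).clog_real (hslit t ht)
    have h2 := Complex.imCLM.hasFDerivAt.comp_hasDerivAt t h1
    exact ((hsd t (hsub ht)).const_mul μ).add h2
  have hθc : ContinuousOn θ (Icc ta tb) := fun t ht => (hθd t ht).continuousAt.continuousWithinAt
  have hθmono : StrictMonoOn θ (Icc ta tb) := by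
    refine strictMonoOn_of_deriv_pos (convex_Icc ta tb) hθc fun t ht => ?_
    have ht' := interior_subset ht
    rw [(hθd t ht').deriv]
    have h0 := (hode t (hsub ht')).1
    have h1 := hvlow t (hsub ht') (hsS t ht')
    have h2 := hv'n t (hsub ht') (hsS t ht')
    have h3 : ‖v' t / v t‖ ≤ 2 * (C₃ * ε) * ω t := by
      rw [norm_div, div_le_iff₀ (by linarith)]
      have h5 : 0 ≤ C₃ * ε * ω t := by positivity
      nlinarith
    have h4 := (abs_le.1 ((Complex.abs_im_le_norm (v' t / v t)).trans h3)).1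
    have h5 : 2 * (C₃ * ε) * ω t < μ * ω t := by gcongr
    linarith
  have hθm : θ m = 0 := by simp [hθ, hsm, hvm]
  have hmm : m ∈ Icc ta tb := ⟨hta.2, htb.1⟩
  have harg : ∀ t, |(Complex.log (v t)).im| ≤ Real.pi := fun t => by
    rw [Complex.log_im]
    exact Complex.abs_arg_le_pi _
  obtain ⟨t₁, h₁, t₂, h₂, hθ12, hg12⟩ := exists_eq_of_shift (θ := θ) (g := fun t => ‖v t‖)
    (L := 2 * Real.pi) (by positivity) hmm hθc hθmono
    (fun t ht => (hvd t (hsub ht)).continuousAt.norm.continuousWithinAt) (by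
      intro t ht
      simp only [hvn]
      have := hmax t (hsub ht)
      gcongr) (by
      rw [hθm]
      simp only [hθ, htaS]
      have := (abs_le.1 (harg ta)).2
      nlinarith) (by
      rw [hθm]
      simp only [hθ, htbS]
      have := (abs_le.1 (harg tb)).1
      nlinarith)
  have hpolar : ∀ t ∈ Icc ta tb, y t = y m * (‖v t‖ * Complex.exp (Complex.I * θ t)) := by
    intro t ht
    have hv0 : v t ≠ 0 := Complex.slitPlane_ne_zero (hslit t ht)
    have e1 : y t = y m * (Complex.exp (Complex.I * μ * s t) * v t) := by
      simp only [hv]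
      have : Complex.exp (Complex.I * μ * s t) * (y t / y m *
          Complex.exp (-(Complex.I * μ * s t))) = y t / y m := by
        rw [mul_left_comm, ← Complex.exp_add, add_neg_cancel, Complex.exp_zero, mul_one]
      rw [this, mul_div_cancel₀ _ hym]
    have e2 : v t = ‖v t‖ * Complex.exp (Complex.I * (Complex.log (v t)).im) := by
      rw [Complex.log_im, mul_comm Complex.I]
      exact (Complex.norm_mul_exp_arg_mul_I (v t)).symm
    rw [e1]
    congr 1
    conv_lhs => rw [e2]
    rw [mul_left_comm, ← Complex.exp_add]
    congr 2
    simp only [hθ]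
    push_cast
    ring
  have hlt : t₁ < t₂ := by
    rw [← hθmono.lt_iff_lt h₁ h₂]
    linarith
  refine ⟨t₁, t₂, (hsub h₁).1, hlt, (hsub h₂).2, ?_⟩
  rw [hpolar t₁ h₁, hpolar t₂ h₂, hθ12]
  have hg12' : ‖v t₁‖ = ‖v t₂‖ := hg12
  rw [hg12']
  congr 2
  push_cast
  rw [mul_add, Complex.exp_add,
    show Complex.I * (2 * (Real.pi : ℂ)) = 2 * Real.pi * Complex.I by ring,
    Complex.exp_two_pi_mul_I, mul_one]

end

noncomputable section

namespace WellFrame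

variable {W : ℝ × ℝ → ℝ} {w : ℝ × ℝ}

/-- A complex coordinate in which the vector field `J B v` is multiplication by an imaginary
number. -/
def toC (D : WellFrame W w) : ℝ × ℝ →L[ℝ] ℂ :=
  LinearMap.toContinuousLinearMap
    { toFun := fun v => ⟨D.b₁₁ * v.1 + D.b₁₂ * v.2, D.freq * v.2⟩
      map_add' := fun u v => by
        apply Complex.ext <;> simp only [Prod.fst_add, Prod.snd_add, Complex.add_re, Complex.add_im]
          <;> ring
      map_smul' := fun c v => by
        apply Complex.ext <;> simp <;> ring }

theorem toC_apply (D : WellFrame W w) (v : ℝ × ℝ) :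
    D.toC v = ⟨D.b₁₁ * v.1 + D.b₁₂ * v.2, D.freq * v.2⟩ := rfl

/-- The square of the matrix `B`, as a map. -/
def sqMap (D : WellFrame W w) (v : ℝ × ℝ) : ℝ × ℝ :=
  (D.b₁₁ * (D.b₁₁ * v.1 + D.b₁₂ * v.2) + D.b₁₂ * (D.b₁₂ * v.1 + D.b₂₂ * v.2),
    D.b₁₂ * (D.b₁₁ * v.1 + D.b₁₂ * v.2) + D.b₂₂ * (D.b₁₂ * v.1 + D.b₂₂ * v.2))

/-- The linearization of the deviation from the vector field `J B v`. -/
def drift (D : WellFrame W w) (v : ℝ × ℝ) : ℝ × ℝ :=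
  D.tr • (-v.2, v.1) - D.rot v

theorem toC_rot (D : WellFrame W w) (v : ℝ × ℝ) :
    D.toC (D.rot v) = Complex.I * D.freq * D.toC v := by
  have := D.freq_sq
  apply Complex.ext
  · simp [toC_apply, rot]
    linear_combination v.2 * this
  · simp [toC_apply, rot]

theorem exists_toC_lower (D : WellFrame W w) : ∃ c > 0, ∀ v, c * ‖v‖ ≤ ‖D.toC v‖ := by
  have hker : LinearMap.ker (D.toC : ℝ × ℝ →ₗ[ℝ] ℂ) = ⊥ := by
    rw [LinearMap.ker_eq_bot']
    intro v hv
    have h0 : D.toC v = 0 := hv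
    rw [toC_apply, Complex.ext_iff] at h0
    obtain ⟨h1, h2⟩ := h0
    simp only [Complex.zero_re, Complex.zero_im] at h1 h2
    have h3 : v.2 = 0 := (mul_eq_zero.1 h2).resolve_left D.freq_pos.ne'
    rw [h3, mul_zero, add_zero] at h1
    exact Prod.ext ((mul_eq_zero.1 h1).resolve_left D.pos.ne') h3
  obtain ⟨K, hK, h⟩ := LinearMap.exists_antilipschitzWith (D.toC : ℝ × ℝ →ₗ[ℝ] ℂ) hker
  have hK' : (0 : ℝ) < K := by exact_mod_cast hK
  refine ⟨(K : ℝ)⁻¹, by positivity, fun v => ?_⟩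
  have := h.le_mul_dist v 0
  rw [dist_zero_right, map_zero, dist_zero_right] at this
  rw [inv_mul_le_iff₀ hK']
  exact this

theorem exists_drift_upper (D : WellFrame W w) : ∃ C ≥ 0, ∀ v, ‖D.drift v‖ ≤ C * ‖v‖ := by
  obtain ⟨C, hC, h⟩ := D.exists_rot_upper
  refine ⟨D.tr + C, add_nonneg D.tr_pos.le hC.le, fun v => ?_⟩
  refine (norm_sub_le _ _).trans ?_
  rw [add_mul]
  refine add_le_add ?_ ((norm_le_enorm2 _).trans (h v))
  rw [norm_smul, Real.norm_eq_abs, abs_of_pos D.tr_pos]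
  have := D.tr_pos
  gcongr
  rw [Prod.norm_def]
  simp only [norm_neg]
  exact max_le (norm_snd_le v) (norm_fst_le v)

/-- The equation for the deviation of the momentum from the vector field `J B q`. -/
theorem toC_deviation (D : WellFrame W w) (q P e : ℝ × ℝ) :
    D.toC (D.sqMap q + e + D.tr • (-P.2, P.1)) - Complex.I * D.freq * D.toC P =
      D.toC (D.drift (P - D.rot q) + e) := by
  rw [← toC_rot, ← map_sub]
  congr 1
  ext
  · simp only [sqMap, drift, rot, tr, Prod.fst_add, Prod.fst_sub, Prod.snd_sub, Prod.smul_fst,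
      smul_eq_mul]
    ring
  · simp only [sqMap, drift, rot, tr, Prod.snd_add, Prod.fst_sub, Prod.snd_sub, Prod.smul_snd,
      smul_eq_mul]
    ring

theorem inner_toC_sqMap_nonneg (D : WellFrame W w) (v : ℝ × ℝ) :
    0 ≤ inner ℝ (D.toC v) (D.toC (D.sqMap v)) := by
  have hf := D.freq_sq
  set β₁ := D.b₁₁ * v.1 + D.b₁₂ * v.2 with h1
  set β₂ := D.b₁₂ * v.1 + D.b₂₂ * v.2 with h2
  have e : inner ℝ (D.toC v) (D.toC (D.sqMap v)) =
      (D.b₁₁ * β₁ + D.b₁₂ * β₂) ^ 2 + D.freq ^ 2 * β₂ ^ 2 := by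
    rw [Complex.inner, toC_apply, toC_apply]
    simp [sqMap, h1, h2]
    linear_combination (v.2 * (D.b₁₂ * β₁ + D.b₂₂ * β₂) - β₂ ^ 2) * hf
  rw [e]
  positivity

theorem inner_toC_rot_rot_nonpos (D : WellFrame W w) (v : ℝ × ℝ) :
    inner ℝ (D.toC v) (D.toC (-(D.rot v).2, (D.rot v).1)) ≤ 0 := by
  have hf := D.freq_sq
  have e : inner ℝ (D.toC v) (D.toC (-(D.rot v).2, (D.rot v).1)) =
      -(D.b₁₁ * ((D.b₁₁ * v.1 + D.b₁₂ * v.2) ^ 2 + (D.b₁₂ * v.1 + D.b₂₂ * v.2) ^ 2)) := by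
    rw [Complex.inner, toC_apply, toC_apply]
    simp [rot]
    linear_combination (-(v.2 * (D.b₁₂ * v.1 + D.b₂₂ * v.2))) * hf
  rw [e]
  have := D.pos
  have : 0 ≤ D.b₁₁ * ((D.b₁₁ * v.1 + D.b₁₂ * v.2) ^ 2 + (D.b₁₂ * v.1 + D.b₂₂ * v.2) ^ 2) := by
    positivity
  linarith

end WellFrame

theorem exists_eq_smul_of_inner_eq_zero {y p : ℂ} (hy : y ≠ 0) (h : inner ℝ y p = 0) :
    ∃ r : ℝ, p = r * (Complex.I * y) := by
  refine ⟨(p / y).im, ?_⟩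
  have hre : (p / y).re = 0 := by
    rw [Complex.inner] at h
    have e : p / y = (starRingEnd ℂ) y * p * ((‖y‖ ^ 2 : ℝ) : ℂ)⁻¹ := by
      rw [div_eq_mul_inv, Complex.inv_def, Complex.normSq_eq_norm_sq]
      push_cast
      ring
    rw [e, ← Complex.ofReal_inv, Complex.re_mul_ofReal]
    simp only [Complex.mul_re, Complex.conj_re, Complex.conj_im] at h ⊢
    have h' : y.re * p.re - -y.im * p.im = 0 := by linarith
    rw [h', zero_mul]
  have e : p / y = (p / y).im * Complex.I := by
    apply Complex.ext <;> simp [hre]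
  calc p = p / y * y := (div_mul_cancel₀ p hy).symm
    _ = _ := by
      conv_lhs => rw [e]
      ring

/-- At an interior maximum of `f` with `f' = 2 ω k` and `ω > 0`, the function `k` is not
increasing. -/
theorem not_pos_of_isMax {f k ω : ℝ → ℝ} {k' a b m : ℝ} (hm : m ∈ Ioo a b)
    (hf : ∀ t ∈ Ioo a b, HasDerivAt f (2 * (ω t * k t)) t) (hω : ∀ t ∈ Ioo a b, 0 < ω t)
    (hmax : ∀ t ∈ Ioo a b, f t ≤ f m) (hk : HasDerivAt k k' m) : k m = 0 ∧ k' ≤ 0 := by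
  have hloc : IsLocalMax f m := by
    filter_upwards [Ioo_mem_nhds hm.1 hm.2] with t ht using hmax t ht
  have h0 : k m = 0 := by
    have := hloc.hasDerivAt_eq_zero (hf m hm)
    have h1 := hω m hm
    by_contra hne
    exact (mul_ne_zero two_ne_zero (mul_ne_zero h1.ne' hne)) this
  refine ⟨h0, ?_⟩
  by_contra hpos
  push Not at hpos
  have hev : ∀ᶠ t in 𝓝[>] m, 0 < k t := by
    have hsl := (hasDerivAt_iff_tendsto_slope.1 hk).eventually_const_lt hpos
    have hsl' : ∀ᶠ t in 𝓝[>] m, 0 < slope k m t :=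
      hsl.filter_mono (nhdsWithin_mono m fun x hx => ne_of_gt hx)
    filter_upwards [hsl', self_mem_nhdsWithin] with t ht htm
    rw [slope_def_field, h0, sub_zero] at ht
    have : 0 < t - m := sub_pos.2 htm
    exact (div_pos_iff_of_pos_right this).1 ht
  obtain ⟨c, hc, hcs⟩ := mem_nhdsGT_iff_exists_Ioo_subset.1 hev
  have hc' : m < c := hc
  set u := min ((m + c) / 2) ((m + b) / 2) with hu
  have hmu : m < u := lt_min (by linarith) (by linarith [hm.2])
  have huc : u < c := (min_le_left _ _).trans_lt (by linarith)
  have hub : u < b := (min_le_right _ _).trans_lt (by linarith [hm.2])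
  have hsub : Icc m u ⊆ Ioo a b := fun x hx => ⟨hm.1.trans_le hx.1, hx.2.trans_lt hub⟩
  have hmono : StrictMonoOn f (Icc m u) := by
    refine strictMonoOn_of_deriv_pos (convex_Icc m u)
      (fun x hx => (hf x (hsub hx)).continuousAt.continuousWithinAt) fun x hx => ?_
    have hx' := hsub (interior_subset hx)
    rw [interior_Icc] at hx
    rw [(hf x hx').deriv]
    have h1 := hω x hx'
    have h2 : 0 < k x := hcs ⟨hx.1, hx.2.trans huc⟩
    positivity
  have h1 := hmono (left_mem_Icc.2 hmu.le) (right_mem_Icc.2 hmu.le) hmu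
  have h2 := hmax u (hsub (right_mem_Icc.2 hmu.le))
  linarith

end

noncomputable section

/-- Small loops at the origin which solve a perturbation of the linearized Hamiltonian equations
intersect themselves. -/
theorem WellFrame.exists_return {W : ℝ × ℝ → ℝ} {w : ℝ × ℝ} (D : WellFrame W w) :
    ∃ ε > 0, ∀ (ℓ : ℝ) (q P e : ℝ → ℝ × ℝ) (ω : ℝ → ℝ), 0 < ℓ → ContinuousOn q (Icc 0 ℓ) →
      q 0 = 0 → q ℓ = 0 → (∀ t ∈ Ioo 0 ℓ, q t ≠ 0 ∧ 0 < ω t ∧ ContinuousAt ω t ∧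
        HasDerivAt q (ω t • P t) t ∧
        HasDerivAt P (ω t • (D.sqMap (q t) + e t + D.tr • (-(P t).2, (P t).1))) t ∧
        ‖e t‖ ≤ ε * ‖q t‖ ∧ |enorm2 (P t) - enorm2 (D.rot (q t))| ≤ ε * ‖q t‖) →
      ∃ t₁ t₂, 0 < t₁ ∧ t₁ < t₂ ∧ t₂ < ℓ ∧ q t₁ = q t₂ := by
  obtain ⟨c, hc, hlow⟩ := D.exists_toC_lower
  obtain ⟨cV, hcV, hrot⟩ := D.exists_rot_lower
  obtain ⟨Cd, hCd, hdrift⟩ := D.exists_drift_upper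
  have hμ := D.freq_pos
  have hinj : ∀ u v, D.toC u = D.toC v → u = v := by
    intro u v h
    have := hlow (u - v)
    rw [map_sub, h, sub_self, norm_zero] at this
    have h0 : ‖u - v‖ ≤ 0 := by
      by_contra hcon
      push Not at hcon
      have : 0 < c * ‖u - v‖ := mul_pos hc hcon
      linarith
    exact sub_eq_zero.1 (norm_le_zero_iff.1 h0)
  set CT := ‖D.toC‖ with hCT
  have hCT0 : 0 ≤ CT := norm_nonneg _
  have hup : ∀ v, ‖D.toC v‖ ≤ CT * ‖v‖ := fun v => D.toC.le_opNorm v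
  set C₂ := CT / c with hC₂
  have hC₂0 : 0 ≤ C₂ := by positivity
  obtain ⟨ε₀, hε₀, hret⟩ := _root_.exists_return (μ := D.freq) (K := CT * Cd / c)
    (C₁ := D.freq / cV) (C₂ := C₂) hμ (by positivity) hC₂0
  set ε := min ε₀ (min (cV / 2) (D.freq ^ 2 / (8 * (C₂ + 1)))) with hε
  have hε0 : 0 < ε := by positivity
  have hεV : ε / cV ≤ 1 / 2 := by
    rw [div_le_iff₀ hcV]
    have : ε ≤ cV / 2 := (min_le_right _ _).trans (min_le_left _ _)
    linarith
  have hεC : C₂ * ε < D.freq ^ 2 / 4 := by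
    have h1 : ε ≤ D.freq ^ 2 / (8 * (C₂ + 1)) := (min_le_right _ _).trans (min_le_right _ _)
    rw [le_div_iff₀ (by positivity)] at h1
    have h2 : 0 < D.freq ^ 2 := by positivity
    nlinarith
  refine ⟨ε, hε0, fun ℓ q P e ω hℓ hqc hq0 hqℓ hode => ?_⟩
  set y : ℝ → ℂ := fun t => D.toC (q t) with hy
  have hyc : ContinuousOn y (Icc 0 ℓ) := D.toC.continuous.comp_continuousOn hqc
  obtain ⟨m, hmI, hmmax⟩ := isCompact_Icc.exists_isMaxOn (nonempty_Icc.2 hℓ.le) hyc.norm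
  have hmax : ∀ t ∈ Icc 0 ℓ, ‖y t‖ ≤ ‖y m‖ := fun t ht => hmmax ht
  have hyne : ∀ t ∈ Ioo 0 ℓ, y t ≠ 0 := fun t ht h0 =>
    (hode t ht).1 (hinj _ _ (by rw [map_zero]; exact h0))
  have hy0 : y 0 = 0 := by simp [hy, hq0]
  have hyℓ : y ℓ = 0 := by simp [hy, hqℓ]
  have hRpos : 0 < ‖y m‖ := by
    have hmid : ℓ / 2 ∈ Ioo 0 ℓ := ⟨by linarith, by linarith⟩
    exact (norm_pos_iff.2 (hyne _ hmid)).trans_le (hmax _ (Ioo_subset_Icc_self hmid))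
  have hym : y m ≠ 0 := norm_pos_iff.1 hRpos
  have hm : m ∈ Ioo 0 ℓ := by
    refine ⟨lt_of_le_of_ne hmI.1 fun h => ?_, lt_of_le_of_ne hmI.2 fun h => ?_⟩
    · rw [← h] at hym
      exact hym hy0
    · rw [h] at hym
      exact hym hyℓ
  set p : ℝ → ℂ := fun t => D.toC (P t) with hp
  have hyd : ∀ t ∈ Ioo 0 ℓ, HasDerivAt y (ω t * p t) t := by
    intro t ht
    have := D.toC.hasFDerivAt.comp_hasDerivAt t (hode t ht).2.2.2.1
    rw [map_smul, Complex.real_smul] at this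
    exact this
  have hpd : ∀ t ∈ Ioo 0 ℓ, HasDerivAt p
      (ω t * D.toC (D.sqMap (q t) + e t + D.tr • (-(P t).2, (P t).1))) t := by
    intro t ht
    have := D.toC.hasFDerivAt.comp_hasDerivAt t (hode t ht).2.2.2.2.1
    rw [map_smul, Complex.real_smul] at this
    exact this
  have hrmul : ∀ (u : ℂ) (x : ℝ) (v : ℂ), inner ℝ u ((x : ℂ) * v) = x * inner ℝ u v := by
    intro u x v
    rw [← Complex.real_smul, real_inner_smul_right]
  have herr : ∀ t ∈ Ioo 0 ℓ, ‖D.toC (e t)‖ ≤ C₂ * (ε * ‖y t‖) := by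
    intro t ht
    have h1 := (hode t ht).2.2.2.2.2.1
    have h2 := hlow (q t)
    calc ‖D.toC (e t)‖ ≤ CT * (ε * ‖q t‖) := (hup _).trans (by gcongr)
      _ = C₂ * (ε * (c * ‖q t‖)) := by rw [hC₂]; field_simp
      _ ≤ C₂ * (ε * ‖y t‖) := by gcongr
  -- the direction of the momentum at the farthest point
  set X := D.sqMap (q m) + e m + D.tr • (-(P m).2, (P m).1) with hX
  have hk : HasDerivAt (fun t => inner ℝ (y t) (p t))
      (ω m * (inner ℝ (y m) (D.toC X) + ‖p m‖ ^ 2)) m := by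
    have := (hyd m hm).inner ℝ (hpd m hm)
    convert! this using 1
    rw [hrmul, real_inner_comm (p m) (ω m * p m), hrmul, real_inner_self_eq_norm_sq]
    ring
  obtain ⟨hk0, hk'⟩ := not_pos_of_isMax (f := fun t => ‖y t‖ ^ 2) hm (fun t ht => by
      have := (hyd t ht).norm_sq
      rw [hrmul] at this
      exact this) (fun t ht => (hode t ht).2.1) (fun t ht => by
      have := hmax t (Ioo_subset_Icc_self ht)
      gcongr) hk
  obtain ⟨r, hr⟩ := exists_eq_smul_of_inner_eq_zero hym hk0
  set σ := r / D.freq with hσ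
  have hrσ : r = σ * D.freq := by rw [hσ]; field_simp
  have hPσ : P m = σ • D.rot (q m) := by
    apply hinj
    rw [map_smul, D.toC_rot, Complex.real_smul]
    change p m = _
    rw [hr, hrσ]
    push_cast
    ring
  have hVpos : 0 < enorm2 (D.rot (q m)) := by
    have h1 := hrot (q m)
    have h2 : 0 < ‖q m‖ := norm_pos_iff.2 (hode m hm).1
    have : 0 < cV * ‖q m‖ := by positivity
    linarith
  have hσ1 : |(|σ|) - 1| ≤ ε / cV := by
    have h1 := (hode m hm).2.2.2.2.2.2
    rw [hPσ, enorm2_smul] at h1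
    have h2 : |σ| * enorm2 (D.rot (q m)) - enorm2 (D.rot (q m)) =
        (|σ| - 1) * enorm2 (D.rot (q m)) := by ring
    rw [h2, abs_mul, abs_of_pos hVpos] at h1
    have h3 : ε * ‖q m‖ ≤ ε / cV * enorm2 (D.rot (q m)) := by
      rw [div_mul_eq_mul_div, le_div_iff₀ hcV]
      have := mul_le_mul_of_nonneg_left (hrot (q m)) hε0.le
      linarith
    exact le_of_mul_le_mul_right (h1.trans h3) hVpos
  have hσhalf : 1 / 2 ≤ |σ| := by linarith [(abs_le.1 hσ1).1]
  have hpn : ‖p m‖ ^ 2 = σ ^ 2 * D.freq ^ 2 * ‖y m‖ ^ 2 := by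
    rw [hr, norm_mul, norm_mul, Complex.norm_I, one_mul, Complex.norm_real, Real.norm_eq_abs,
      mul_pow, sq_abs, hrσ]
    ring
  have hσpos : 0 < σ := by
    by_contra hneg
    push Not at hneg
    have h1 := D.inner_toC_sqMap_nonneg (q m)
    have h2 := D.inner_toC_rot_rot_nonpos (q m)
    have h3 : inner ℝ (y m) (D.toC X) = inner ℝ (y m) (D.toC (D.sqMap (q m))) +
        inner ℝ (y m) (D.toC (e m)) + D.tr * (σ *
          inner ℝ (y m) (D.toC (-(D.rot (q m)).2, (D.rot (q m)).1))) := by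
      have : ((-(P m).2, (P m).1) : ℝ × ℝ) = σ • (-(D.rot (q m)).2, (D.rot (q m)).1) := by
        rw [hPσ]
        simp
      rw [hX, this, map_add, map_add, map_smul, map_smul, inner_add_right, inner_add_right,
        real_inner_smul_right, real_inner_smul_right]
    have h4 : 0 ≤ D.tr * (σ * inner ℝ (y m) (D.toC (-(D.rot (q m)).2, (D.rot (q m)).1))) :=
      mul_nonneg D.tr_pos.le (mul_nonneg_of_nonpos_of_nonpos hneg h2)
    have h5 : -(C₂ * ε * ‖y m‖ ^ 2) ≤ inner ℝ (y m) (D.toC (e m)) := by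
      have := (abs_le.1 (abs_real_inner_le_norm (y m) (D.toC (e m)))).1
      have h6 : ‖y m‖ * ‖D.toC (e m)‖ ≤ ‖y m‖ * (C₂ * (ε * ‖y m‖)) :=
        mul_le_mul_of_nonneg_left (herr m hm) (norm_nonneg _)
      have h7 : ‖y m‖ * (C₂ * (ε * ‖y m‖)) = C₂ * ε * ‖y m‖ ^ 2 := by ring
      linarith
    have h6 : 1 / 4 ≤ σ ^ 2 := by
      rw [← sq_abs]
      nlinarith
    have h7 : D.freq ^ 2 / 4 * ‖y m‖ ^ 2 ≤ ‖p m‖ ^ 2 := by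
      rw [hpn]
      gcongr
      have := mul_le_mul_of_nonneg_right h6 (sq_nonneg D.freq)
      linarith
    have h8 : 0 < (D.freq ^ 2 / 4 - C₂ * ε) * ‖y m‖ ^ 2 :=
      mul_pos (by linarith) (by positivity)
    have h9 : 0 < inner ℝ (y m) (D.toC X) + ‖p m‖ ^ 2 := by
      rw [h3]
      have : 0 ≤ inner ℝ (y m) (D.toC (D.sqMap (q m))) := h1
      rw [sub_mul] at h8
      linarith
    have h10 := mul_pos (hode m hm).2.1 h9
    linarith
  rw [abs_of_pos hσpos] at hσ1
  set d : ℝ → ℂ := fun t => p t - Complex.I * D.freq * y t with hd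
  have hdC : ∀ t, d t = D.toC (P t - D.rot (q t)) := fun t => by
    rw [map_sub, D.toC_rot]
  suffices hout : ∃ t₁ t₂, 0 < t₁ ∧ t₁ < t₂ ∧ t₂ < ℓ ∧ y t₁ = y t₂ by
    obtain ⟨t₁, t₂, h1, h2, h3, h4⟩ := hout
    exact ⟨t₁, t₂, h1, h2, h3, hinj _ _ h4⟩
  refine hret ε hε0 (min_le_left _ _) ℓ m y d
    (fun t => D.toC (D.drift (P t - D.rot (q t)) + e t)) ω hm hyc hy0 hyℓ hym
    (fun t ht => hmax t (Ioo_subset_Icc_self ht)) (fun t ht => ?_) ?_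
  · refine ⟨(hode t ht).2.1, (hode t ht).2.2.1, ?_, ?_, ?_⟩
    · convert hyd t ht using 1
      simp only [hd]
      ring
    · have := (hpd t ht).sub ((hyd t ht).const_mul (Complex.I * D.freq))
      convert! this using 1
      rw [← D.toC_deviation]
      ring
    · rw [map_add]
      refine (norm_add_le _ _).trans (add_le_add ?_ ?_)
      · rw [hdC]
        have h1 := hdrift (P t - D.rot (q t))
        have h2 := hlow (P t - D.rot (q t))
        calc _ ≤ CT * (Cd * ‖P t - D.rot (q t)‖) := (hup _).trans (by gcongr)
          _ = CT * Cd / c * (c * ‖P t - D.rot (q t)‖) := by field_simp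
          _ ≤ _ := by gcongr
      · have := herr t ht
        have h2 := hmax t (Ioo_subset_Icc_self ht)
        refine this.trans ?_
        gcongr
  · have e1 : d m = ((σ - 1) * D.freq : ℝ) * (Complex.I * y m) := by
      simp only [hd]
      rw [hr, hrσ]
      push_cast
      ring
    rw [e1, norm_mul, norm_mul, Complex.norm_I, one_mul, Complex.norm_real, Real.norm_eq_abs,
      abs_mul, abs_of_pos hμ]
    have : |σ - 1| * D.freq * ‖y m‖ ≤ ε / cV * D.freq * ‖y m‖ := by gcongr
    refine this.trans (le_of_eq ?_)
    ring

end

noncomputable section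

variable {W : ℝ × ℝ → ℝ} {pm pp w : ℝ × ℝ}

namespace WellFrame

/-- The quadratic form `|B v|²` of a frame is half the Hessian of `W`. -/
theorem enorm2_rot_sq (hW : TwoWell W pm pp) (hw : w = pm ∨ w = pp) (D : WellFrame W w)
    (v : ℝ × ℝ) : enorm2 (D.rot v) ^ 2 = 1 / 2 * fderiv ℝ (fderiv ℝ W) w v v := by
  set x := 1 / 2 * fderiv ℝ (fderiv ℝ W) w v v with hx
  set g := enorm2 (D.rot v) with hg
  have hg0 : 0 ≤ g := enorm2_nonneg _
  set N := ‖v‖ with hN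
  have hN0 : 0 ≤ N := norm_nonneg _
  set C := N ^ 2 + N * (2 * g + N) + 1 with hC
  have hC0 : 0 < C := by positivity
  have key : ∀ ε, 0 < ε → ε ≤ 1 → |x - g ^ 2| ≤ ε * C := by
    intro ε hε hε1
    obtain ⟨r₁, hr₁, h₁⟩ := hW.taylor_well hw hε
    obtain ⟨r₂, hr₂, h₂⟩ := D.approx_rot hε
    obtain ⟨s, hs, hs₁, hs₂⟩ : ∃ s > 0, s * N < r₁ ∧ s * N < r₂ := by
      refine ⟨min r₁ r₂ / (N + 1), by positivity, ?_, ?_⟩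
      · rw [div_mul_eq_mul_div, div_lt_iff₀ (by positivity)]
        have : min r₁ r₂ ≤ r₁ := min_le_left _ _
        nlinarith
      · rw [div_mul_eq_mul_div, div_lt_iff₀ (by positivity)]
        have : min r₁ r₂ ≤ r₂ := min_le_right _ _
        nlinarith
    have hn : ‖s • v‖ = s * N := by rw [norm_smul, Real.norm_of_nonneg hs.le]
    have hsub : w + s • v - w = s • v := by abel
    have e1 := h₁ (w + s • v) (by rw [hsub, hn]; exact hs₁)
    have e2 := h₂ (w + s • v) (by rw [hsub, hn]; exact hs₂)
    have hrot : D.rot (s • v) = s • D.rot v := by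
      ext <;> simp [rot] <;> ring
    rw [hsub, hn, hrot, enorm2_smul, abs_of_pos hs] at e2
    rw [hsub, hn, ← hW.confFactor_sq] at e1
    have hL : (1 / 2) * fderiv ℝ (fderiv ℝ W) w (s • v) (s • v) = s ^ 2 * x := by
      rw [hx]
      simp only [map_smul, smul_apply, smul_eq_mul]
      ring
    rw [hL] at e1
    have hF := confFactor_nonneg W (w + s • v)
    set F := confFactor W (w + s • v) with hF'
    rw [← hg] at e2
    have e3 : |F ^ 2 - (s * g) ^ 2| ≤ ε * (s * N) * (2 * (s * g) + s * N) := by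
      rw [sq_sub_sq, abs_mul, mul_comm]
      have h3 : |F + s * g| ≤ 2 * (s * g) + s * N := by
        rw [abs_of_nonneg (by positivity)]
        have := (abs_le.1 e2).2
        have h4 : ε * (s * N) ≤ s * N := mul_le_of_le_one_left (by positivity) hε1
        linarith
      gcongr
    have e4 : |s ^ 2 * (x - g ^ 2)| ≤ s ^ 2 * (ε * C) := by
      have h5 : s ^ 2 * (x - g ^ 2) = (F ^ 2 - (s * g) ^ 2) - (F ^ 2 - s ^ 2 * x) := by ring
      rw [h5]
      refine (abs_sub _ _).trans ((add_le_add e3 e1).trans ?_)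
      have h6 : ε * (s * N) * (2 * (s * g) + s * N) + ε * (s * N) ^ 2 =
        s ^ 2 * (ε * (C - 1)) := by rw [hC]; ring
      rw [h6]
      gcongr
      linarith
    rw [abs_mul, abs_of_pos (by positivity : 0 < s ^ 2)] at e4
    exact le_of_mul_le_mul_left e4 (by positivity)
  have h0 : |x - g ^ 2| ≤ 0 := by
    refine le_of_forall_pos_le_add fun η hη => ?_
    have := key (min 1 (η / C)) (by positivity) (min_le_left _ _)
    have h2 : min 1 (η / C) * C ≤ η := by
      calc _ ≤ η / C * C := by gcongr; exact min_le_right _ _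
        _ = η := div_mul_cancel₀ _ hC0.ne'
    linarith
  have := abs_eq_zero.1 (le_antisymm h0 (abs_nonneg _))
  linarith

theorem half_hessian_apply (hW : TwoWell W pm pp) (hw : w = pm ∨ w = pp) (D : WellFrame W w)
    (v : ℝ × ℝ) : (fderiv ℝ (fderiv ℝ W) w v (1, 0) / 2, fderiv ℝ (fderiv ℝ W) w v (0, 1) / 2) =
      D.sqMap v := by
  have hC2 : ContDiff ℝ 2 W := by exact_mod_cast contDiff_infty.1 hW.smooth 2
  have hq := D.enorm2_rot_sq hW hw
  set L := fderiv ℝ (fderiv ℝ W) w with hL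
  have hsymm : ∀ u v, L u v = L v u := by
    have := hC2.contDiffAt.isSymmSndFDerivAt (x := w) (by simp)
    exact fun u v => this u v
  have hpol : ∀ u : ℝ × ℝ, L v u = enorm2 (D.rot (v + u)) ^ 2 - enorm2 (D.rot v) ^ 2
      - enorm2 (D.rot u) ^ 2 := by
    intro u
    rw [hq, hq, hq]
    simp only [map_add, add_apply]
    rw [hsymm u v]
    ring
  rw [hpol, hpol]
  simp only [enorm2_sq, rot, sqMap]
  ext <;> simp <;> ring

/-- Near a well, half the gradient of `W` is approximately `B² (p - w)`. -/
theorem exists_half_grad_approx (hW : TwoWell W pm pp) (hw : w = pm ∨ w = pp) (D : WellFrame W w)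
    {ε : ℝ} (hε : 0 < ε) : ∃ r > 0, ∀ p, ‖p - w‖ < r →
      ‖(fderiv ℝ W p (1, 0) / 2, fderiv ℝ W p (0, 1) / 2) - D.sqMap (p - w)‖ ≤ ε * ‖p - w‖ := by
  have hC2 : ContDiff ℝ 2 W := by exact_mod_cast contDiff_infty.1 hW.smooth 2
  have hd : HasFDerivAt (fderiv ℝ W) (fderiv ℝ (fderiv ℝ W) w) w :=
    ((hC2.fderiv_right (m := 1) (by norm_num)).differentiable one_ne_zero w).hasFDerivAt
  obtain ⟨-, h0, -⟩ := hW.exists_pos_le_of_well hw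
  have ho := (hasFDerivAt_iff_isLittleO.1 hd).def hε
  obtain ⟨r, hr, h⟩ := Metric.eventually_nhds_iff.1 ho
  refine ⟨r, hr, fun p hp => ?_⟩
  have h1 := h (y := p) (by rwa [dist_eq_norm])
  rw [h0, sub_zero] at h1
  set T := fderiv ℝ W p - fderiv ℝ (fderiv ℝ W) w (p - w) with hT
  rw [← D.half_hessian_apply hW hw (p - w)]
  have hb : ∀ u : ℝ × ℝ, ‖u‖ = 1 → |T u| ≤ ε * ‖p - w‖ := by
    intro u hu
    have := T.le_opNorm u
    rw [hu, mul_one, Real.norm_eq_abs] at this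
    exact this.trans h1
  have b1 := hb (1, 0) (by simp [Prod.norm_def])
  have b2 := hb (0, 1) (by simp [Prod.norm_def])
  rw [hT, sub_apply] at b1 b2
  rw [Prod.norm_def, max_le_iff]
  simp only [Prod.fst_sub, Prod.snd_sub, Real.norm_eq_abs, ← sub_div, abs_div, abs_two]
  have := abs_nonneg (fderiv ℝ W p (1, 0) - fderiv ℝ (fderiv ℝ W) w (p - w) (1, 0))
  have := abs_nonneg (fderiv ℝ W p (0, 1) - fderiv ℝ (fderiv ℝ W) w (p - w) (0, 1))
  constructor <;> linarith

/-- If the vertical segments over a well are calibrated near height zero, then there are no short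
calibrated loops based at the well. -/
theorem exists_no_calLoop (hW : TwoWell W pm pp) (hw : w = pm ∨ w = pp) (D : WellFrame W w)
    {v₀ : ℝ} (hv₀ : 0 < v₀) (hv : ∀ h ∈ Icc 0 v₀, D.tr * h ≤ fiberDist W pm pp w h) :
    ∃ ℓ₀ > 0, ∀ (ℓ : ℝ) (Γ : ℝ → ℝ × ℝ × ℝ), 0 < ℓ → ℓ < ℓ₀ → IsCCLip W pm pp 1 0 ℓ Γ →
      projCurve Γ 0 = w → projCurve Γ ℓ = w →
      (∀ t ∈ Ioo 0 ℓ, projCurve Γ t ≠ pm ∧ projCurve Γ t ≠ pp) →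
      fiberDist W pm pp w ((Γ ℓ).2.2 - (Γ 0).2.2) = ℓ → 0 ≤ (Γ ℓ).2.2 - (Γ 0).2.2 → False := by
  have htr := D.tr_pos
  obtain ⟨δ₁, hδ₁, hfib⟩ := D.exists_tr_mul_abs_le hW one_pos
  set δ := min δ₁ (D.tr * v₀ / 2) with hδ
  have hδ0 : 0 < δ := by positivity
  have hcal' : ∀ h, fiberDist W pm pp w h < δ → D.tr * |h| ≤ fiberDist W pm pp w h := by
    intro h hh
    have h1 := hfib h (hh.trans_le (min_le_left _ _))
    have h2 : D.tr * |h| ≤ D.tr * v₀ := by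
      have := hh.le.trans (min_le_right _ _)
      linarith
    have h3 := hv |h| ⟨abs_nonneg _, le_of_mul_le_mul_left h2 htr⟩
    rwa [fiberDist_abs] at h3
  have hcal : ∀ h, fiberDist W pm pp w h < δ → D.tr * h ≤ fiberDist W pm pp w h :=
    fun h hh => (mul_le_mul_of_nonneg_left (le_abs_self h) htr.le).trans (hcal' h hh)
  obtain ⟨ε, hε, hret⟩ := D.exists_return
  obtain ⟨r₁, hr₁, hgrad⟩ := D.exists_half_grad_approx hW hw hε
  obtain ⟨r₂, hr₂, happ⟩ := D.approx_rot hε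
  obtain ⟨δ₂, hδ₂, hclose⟩ := hW.exists_proj_close w (r := min r₁ r₂) (by positivity)
  refine ⟨min (δ / 4) δ₂, by positivity, fun ℓ Γ hℓ hℓ₀ hlip h0 h1 hoff hfd hpos => ?_⟩
  have hℓδ : 4 * ℓ < δ := by
    have := hℓ₀.trans_le (min_le_left _ _)
    linarith
  have hL : CalLoop W pm pp w D.tr δ ℓ Γ := by
    refine ⟨hℓ, hℓδ, hlip, h0, h1, hoff, ?_⟩
    have a1 := hcal _ (by rw [hfd]; linarith)
    have a2 := D.fiberDist_le hW ((Γ ℓ).2.2 - (Γ 0).2.2)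
    rw [abs_of_nonneg hpos] at a2
    linarith
  have hnear : ∀ t ∈ Ioo 0 ℓ, ‖projCurve Γ t - w‖ < min r₁ r₂ := by
    intro t ht
    refine hclose (Γ 0) (Γ t) ?_ ?_
    · have : proj (Γ 0) = w := h0
      rw [this]
      simpa using hδ₂
    · refine (hlip 0 ⟨le_rfl, hℓ.le⟩ t ⟨ht.1.le, ht.2.le⟩).trans_lt ?_
      rw [sub_zero, abs_of_pos ht.1, one_mul]
      exact ht.2.trans (hℓ₀.trans_le (min_le_right _ _))
  have hcont := hlip.continuousOn hW
  obtain ⟨t₁, t₂, ht₁, ht₁₂, ht₂, heq⟩ := hret ℓ (fun t => projCurve Γ t - w)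
    (fun t => W (projCurve Γ t) • deriv (projCurve Γ) t)
    (fun t => (fderiv ℝ W (projCurve Γ t) (1, 0) / 2, fderiv ℝ W (projCurve Γ t) (0, 1) / 2) -
      D.sqMap (projCurve Γ t - w))
    (fun t => (W (projCurve Γ t))⁻¹) hℓ (hcont.sub continuousOn_const)
    (by simp [h0]) (by simp [h1]) (by
      intro t ht
      have hne := hoff t ht
      have hWpos : 0 < W (projCurve Γ t) :=
        lt_of_le_of_ne (hW.nonneg _) fun h => by
          rcases (hW.zeroSet _).1 h.symm with h | h
          · exact hne.1 h
          · exact hne.2 h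
      have hph := hL.hasDerivAt_phase hW hcal ht
      have hq : HasDerivAt (projCurve Γ) ((W (projCurve Γ t))⁻¹ • W (projCurve Γ t) •
          deriv (projCurve Γ) t) t :=
        (ContinuousLinearMap.fst ℝ (ℝ × ℝ) (ℝ × ℝ)).hasFDerivAt.comp_hasDerivAt t hph
      have hm := (ContinuousLinearMap.snd ℝ (ℝ × ℝ) (ℝ × ℝ)).hasFDerivAt.comp_hasDerivAt t hph
      have hsq := hL.momentum_sq hW hcal ht
      have hn := hnear t ht
      refine ⟨?_, inv_pos.2 hWpos, ?_, ?_, ?_, hgrad _ (hn.trans_le (min_le_left _ _)), ?_⟩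
      · rw [sub_ne_zero]
        rcases hw with rfl | rfl
        · exact hne.1
        · exact hne.2
      · refine ContinuousAt.inv₀ ?_ hWpos.ne'
        exact hW.smooth.continuous.continuousAt.comp hq.continuousAt
      · exact hq.sub_const w
      · convert! hm using 1
        simp only [phaseField, ContinuousLinearMap.coe_snd']
        congr 1
        ext
        · simp
          ring
        · simp
      · have hP : enorm2 (W (projCurve Γ t) • deriv (projCurve Γ) t) =
            confFactor W (projCurve Γ t) := by
          rw [enorm2, confFactor]
          congr 1
          simp only [Prod.smul_fst, Prod.smul_snd, smul_eq_mul]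
          linear_combination W (projCurve Γ t) * hsq
        rw [hP]
        exact happ _ (hn.trans_le (min_le_right _ _)))
  exact hL.proj_ne hW hw hcal ht₁ ht₁₂ ht₂ (sub_left_injective heq)

end WellFrame

end

noncomputable section

variable {W : ℝ × ℝ → ℝ} {pm pp w : ℝ × ℝ}

theorem IsCCLip.ccDist_eq (hW : TwoWell W pm pp) {Γ : ℝ → ℝ × ℝ × ℝ}
    (h : IsCCLip W pm pp (ccDist W pm pp (Γ 0) (Γ 1)) 0 1 Γ) {s t : ℝ} (hs : 0 ≤ s) (hst : s ≤ t)
    (ht : t ≤ 1) : ccDist W pm pp (Γ s) (Γ t) = ccDist W pm pp (Γ 0) (Γ 1) * (t - s) := by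
  set d := ccDist W pm pp (Γ 0) (Γ 1) with hd
  have h1 := h 0 ⟨le_rfl, zero_le_one⟩ s ⟨hs, hst.trans ht⟩
  have h2 := h s ⟨hs, hst.trans ht⟩ t ⟨hs.trans hst, ht⟩
  have h3 := h t ⟨hs.trans hst, ht⟩ 1 ⟨zero_le_one, le_rfl⟩
  rw [abs_of_nonneg (by linarith)] at h1 h2 h3
  have h4 := ccDist_triangle hW (Γ 0) (Γ s) (Γ 1)
  have h5 := ccDist_triangle hW (Γ s) (Γ t) (Γ 1)
  rw [← hd] at h4
  linarith

theorem IsMinGeodesic.isCCLip (hW : TwoWell W pm pp) {P Q : ℝ × ℝ × ℝ} {Γ : ℝ → ℝ × ℝ × ℝ}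
    (h : IsMinGeodesic (confFactor W) pm pp P Q Γ) :
    IsCCLip W pm pp (ccDist W pm pp P Q) 0 1 Γ := by
  obtain ⟨-, -, -, Γs, hΓs, hE, hu⟩ := h
  refine IsCCLip.of_le fun s t hs hst ht => ?_
  set d := ccDist W pm pp P Q with hd
  have hd0 : 0 ≤ d := ccDist_nonneg _ _
  have key : ∀ η > 0, ccDist W pm pp (Γ s) (Γ t) ≤ d * (t - s) + 3 * η := by
    intro η hη
    have hlt : dCC (confFactor W) pm pp P Q < ENNReal.ofReal (d + η) := by
      rw [← ofReal_ccDist hW]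
      exact (ENNReal.ofReal_lt_ofReal_iff (by linarith)).2 (by linarith)
    obtain ⟨N, hN⟩ := hu (ENNReal.ofReal η) (ENNReal.ofReal_pos.2 hη)
    obtain ⟨j, hjE, hjN⟩ := ((hE.eventually_lt_const hlt).and (eventually_ge_atTop N)).exists
    obtain ⟨⟨hc, -, -, hA⟩, hsp⟩ := hΓs j
    have hclose : ∀ u ∈ Icc (0 : ℝ) 1, ccDist W pm pp (Γs j u) (Γ u) ≤ η := fun u hu' =>
      ENNReal.toReal_le_of_le_ofReal hη.le (hN j hjN u hu').le
    have hmid : ccDist W pm pp (Γs j s) (Γs j t) ≤ (d + η) * (t - s) := by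
      refine ENNReal.toReal_le_of_le_ofReal (mul_nonneg (add_nonneg (ccDist_nonneg _ _) hη.le)
        (by linarith)) ?_
      refine (dCC_le_degLen (hc.restrict hs hst ht) (hA s t hs hst ht)).trans ?_
      rw [degLen_eq_lintegral, ← Measure.restrict_congr_set Ioo_ae_eq_Icc]
      calc _ ≤ ∫⁻ _ in Ioo s t, ENNReal.ofReal (d + η) := by
            refine setLIntegral_mono_ae' measurableSet_Ioo ?_
            filter_upwards [hsp] with u hu hmem
            exact (hu ⟨hs.trans_lt hmem.1, hmem.2.trans_le ht⟩).le.trans hjE.le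
        _ = ENNReal.ofReal (d + η) * ENNReal.ofReal (t - s) := by
            rw [setLIntegral_const, Real.volume_Ioo]
        _ = _ := (ENNReal.ofReal_mul' (by linarith)).symm
    have h1 := hclose s ⟨hs, hst.trans ht⟩
    have h2 := hclose t ⟨hs.trans hst, ht⟩
    have h3 := ccDist_triangle hW (Γ s) (Γs j s) (Γ t)
    have h4 := ccDist_triangle hW (Γs j s) (Γs j t) (Γ t)
    rw [ccDist_comm (Γ s) (Γs j s)] at h3
    have h5 : η * (t - s) ≤ η := mul_le_of_le_one_right hη.le (by linarith)
    linarith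
  refine le_of_forall_pos_le_add fun ε hε => ?_
  have := key (ε / 3) (by positivity)
  linarith

/-- A geodesic that spends no time interval over the wells spends almost no time there. -/
theorem volume_well_eq_zero (hW : TwoWell W pm pp) (hw : w = pm ∨ w = pp) {d : ℝ} (hd : 0 < d)
    {Γ : ℝ → ℝ × ℝ × ℝ}
    (hΓ : ∀ s t, 0 ≤ s → s ≤ t → t ≤ 1 → ccDist W pm pp (Γ s) (Γ t) = d * (t - s))
    (hc : ContinuousOn (projCurve Γ) (Icc 0 1))
    (hintv : ∀ s t : ℝ, 0 ≤ s → s < t → t ≤ 1 →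
      ∃ u ∈ Icc s t, projCurve Γ u ≠ pm ∧ projCurve Γ u ≠ pp) :
    volume {t | t ∈ Icc (0 : ℝ) 1 ∧ projCurve Γ t = w} = 0 := by
  by_contra hK
  obtain ⟨D⟩ := hW.nonempty_wellFrame hw
  obtain ⟨v₀, hv₀, hv⟩ := D.exists_tr_mul_le_fiberDist hW hd hΓ hc hK
  obtain ⟨ℓ₀, hℓ₀, hno⟩ := D.exists_no_calLoop hW hw hv₀ hv
  obtain ⟨δ, hδ, hnear⟩ := hW.exists_proj_close w (r := ‖pm - pp‖)
    (norm_pos_iff.2 (sub_ne_zero.2 hW.wells_ne))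
  set K := {t | t ∈ Icc (0 : ℝ) 1 ∧ projCurve Γ t = w} with hKdef
  have hKcl : IsClosed K := hc.preimage_isClosed_of_isClosed isClosed_Icc isClosed_singleton
  have hKinf : K.Infinite := fun hfin => hK (hfin.measure_zero _)
  set η := min ℓ₀ δ / d with hη
  have hη0 : 0 < η := by positivity
  obtain ⟨s', hs'K, e', he'K, hse', hlen⟩ : ∃ s' ∈ K, ∃ e' ∈ K, s' < e' ∧ e' - s' < η := by
    obtain ⟨x, -, hx⟩ := hKinf.exists_accPt_of_subset_isCompact isCompact_Icc
      (fun t ht => ht.1 : K ⊆ Icc 0 1)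
    have hxK : x ∈ K := hKcl.closure_subset hx.clusterPt.mem_closure
    obtain ⟨y, hy, hyK⟩ := ((accPt_iff_frequently.1 hx).and_eventually
      (Metric.ball_mem_nhds x hη0)).exists
    rw [Real.dist_eq, abs_lt] at hyK
    rcases lt_or_gt_of_ne hy.1 with h | h
    · exact ⟨y, hy.2, x, hxK, h, by linarith⟩
    · exact ⟨x, hxK, y, hy.2, h, by linarith⟩
  obtain ⟨m, hm, hm1, hm2⟩ := hintv s' e' hs'K.1.1 hse' he'K.1.2
  have hmw : projCurve Γ m ≠ w := by
    rcases hw with rfl | rfl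
    · exact hm1
    · exact hm2
  obtain ⟨s, ⟨hsK, hsI⟩, hsmax⟩ := ((isCompact_Icc (a := s') (b := m)).inter_left hKcl).exists_isGreatest
    ⟨s', hs'K, le_rfl, hm.1⟩
  obtain ⟨e, ⟨heK, heI⟩, hemin⟩ := ((isCompact_Icc (a := m) (b := e')).inter_left hKcl).exists_isLeast
    ⟨e', he'K, hm.2, le_rfl⟩
  have hsm : s < m := lt_of_le_of_ne hsI.2 fun h => hmw (h ▸ hsK.2)
  have hme : m < e := lt_of_le_of_ne heI.1 fun h => hmw (h ▸ heK.2)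
  have hse : s < e := hsm.trans hme
  have hlen' : d * (e - s) < min ℓ₀ δ := by
    have h1 : e - s < η := by linarith [hsI.1, heI.2]
    rw [hη, lt_div_iff₀ hd] at h1
    linarith
  have hoff : ∀ t ∈ Ioo s e, projCurve Γ t ≠ pm ∧ projCurve Γ t ≠ pp := by
    intro t ht
    have ht01 : t ∈ Icc (0 : ℝ) 1 := ⟨hsK.1.1.trans ht.1.le, ht.2.le.trans heK.1.2⟩
    have hne : projCurve Γ t ≠ w := by
      intro h
      rcases le_total t m with h' | h'
      · exact not_le.2 ht.1 (hsmax ⟨⟨ht01, h⟩, hsI.1.trans ht.1.le, h'⟩)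
      · exact not_le.2 ht.2 (hemin ⟨⟨ht01, h⟩, h', ht.2.le.trans heI.2⟩)
    have hn : ‖projCurve Γ t - w‖ < ‖pm - pp‖ := by
      refine hnear (Γ s) (Γ t) ?_ ?_
      · have : proj (Γ s) = w := hsK.2
        rw [this]
        simpa using hδ
      · rw [hΓ s t hsK.1.1 ht.1.le ht01.2]
        have : d * (t - s) ≤ d * (e - s) := by gcongr; exact ht.2.le
        exact this.trans_lt (hlen'.trans_le (min_le_right _ _))
    rcases hw with rfl | rfl
    · refine ⟨hne, fun h => ?_⟩
      rw [h, norm_sub_rev] at hn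
      exact lt_irrefl _ hn
    · refine ⟨fun h => ?_, hne⟩
      rw [h] at hn
      exact lt_irrefl _ hn
  have hfd : fiberDist W pm pp w ((Γ e).2.2 - (Γ s).2.2) = d * (e - s) := by
    rw [← ccDist_eq_fiberDist (P := Γ s) (Q := Γ e) hsK.2 heK.2, hΓ s e hsK.1.1 hse.le heK.1.2]
  have hlip : IsCCLip W pm pp d s e Γ := IsCCLip.of_le fun x y hx hxy hy =>
    (hΓ x y (hsK.1.1.trans hx) hxy (hy.trans heK.1.2)).le
  have hℓ : 0 < d * (e - s) := mul_pos hd (sub_pos.2 hse)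
  have hdiv : ∀ t, 0 ≤ t → t ≤ d * (e - s) → 0 ≤ t / d ∧ t / d ≤ e - s := fun t h0 h1 =>
    ⟨by positivity, by rw [div_le_iff₀ hd]; linarith⟩
  have hdiv' : ∀ t, 0 < t → t < d * (e - s) → 0 < t / d ∧ t / d < e - s := fun t h0 h1 =>
    ⟨by positivity, by rw [div_lt_iff₀ hd]; linarith⟩
  have hend : d * (e - s) / d = e - s := mul_div_cancel_left₀ _ hd.ne'
  rcases le_total 0 ((Γ e).2.2 - (Γ s).2.2) with hz | hz
  · refine hno (d * (e - s)) (fun t => Γ (s + t / d)) hℓ (hlen'.trans_le (min_le_left _ _))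
      (IsCCLip.of_le fun x y hx hxy hy => ?_) ?_ ?_ (fun t ht => ?_) ?_ ?_
    · have h1 := hdiv x hx (hxy.trans hy)
      have h2 := hdiv y (hx.trans hxy) hy
      have h3 : x / d ≤ y / d := by gcongr
      refine (hlip _ ⟨by linarith, by linarith⟩ _ ⟨by linarith, by linarith⟩).trans_eq ?_
      rw [abs_of_nonneg (by linarith)]
      field_simp
      ring
    · simpa [projCurve] using hsK.2
    · simp only [projCurve, hend, add_sub_cancel]
      exact heK.2
    · have h1 := hdiv' t ht.1 ht.2
      exact hoff (s + t / d) ⟨by linarith, by linarith⟩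
    · simpa [hend] using hfd
    · simpa [hend] using hz
  · refine hno (d * (e - s)) (fun t => Γ (e - t / d)) hℓ (hlen'.trans_le (min_le_left _ _))
      (IsCCLip.of_le fun x y hx hxy hy => ?_) ?_ ?_ (fun t ht => ?_) ?_ ?_
    · have h1 := hdiv x hx (hxy.trans hy)
      have h2 := hdiv y (hx.trans hxy) hy
      have h3 : x / d ≤ y / d := by gcongr
      refine (hlip _ ⟨by linarith, by linarith⟩ _ ⟨by linarith, by linarith⟩).trans_eq ?_
      rw [abs_of_nonpos (by linarith)]
      field_simp
      ring
    · simpa [projCurve] using heK.2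
    · simp only [projCurve, hend, sub_sub_cancel]
      exact hsK.2
    · have h1 := hdiv' t ht.1 ht.2
      exact hoff (e - t / d) ⟨by linarith, by linarith⟩
    · simp only [hend, sub_sub_cancel, zero_div, sub_zero]
      rw [← fiberDist_neg, neg_sub]
      exact hfd
    · simp only [hend, sub_sub_cancel, zero_div, sub_zero]
      linarith

theorem ae_off_wells {Γ : ℝ → ℝ × ℝ × ℝ}
    (h : ∀ w, w = pm ∨ w = pp → volume {t | t ∈ Icc (0 : ℝ) 1 ∧ projCurve Γ t = w} = 0) :
    ∀ᵐ t : ℝ, t ∈ Ioo (0 : ℝ) 1 → projCurve Γ t ≠ pm ∧ projCurve Γ t ≠ pp := by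
  filter_upwards [measure_eq_zero_iff_ae_notMem.1 (h pm (Or.inl rfl)),
    measure_eq_zero_iff_ae_notMem.1 (h pp (Or.inr rfl))] with t h1 h2 ht
  exact ⟨fun h => h1 ⟨Ioo_subset_Icc_self ht, h⟩, fun h => h2 ⟨Ioo_subset_Icc_self ht, h⟩⟩

theorem IsMinGeodesic.isConstrainedMin (hW : TwoWell W pm pp) {P Q : ℝ × ℝ × ℝ}
    {Γ : ℝ → ℝ × ℝ × ℝ} (h : IsMinGeodesic (confFactor W) pm pp P Q Γ)
    (hintv : ∀ s t : ℝ, 0 ≤ s → s < t → t ≤ 1 →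
      ∃ u ∈ Icc s t, projCurve Γ u ≠ pm ∧ projCurve Γ u ≠ pp) :
    IsConstrainedMin (confFactor W) pm pp (proj P) (proj Q) (Q.2.2 - P.2.2) 0 1 (projCurve Γ) := by
  have hlip := h.isCCLip hW
  obtain ⟨rfl, rfl, -⟩ := h
  refine hlip.isConstrainedMin hW ?_
  rcases (ccDist_nonneg (W := W) (pm := pm) (pp := pp) (Γ 0) (Γ 1)).eq_or_lt with hd | hd
  · have hconst : ∀ t ∈ Icc (0 : ℝ) 1, projCurve Γ t = projCurve Γ 0 := fun t ht => by
      refine proj_eq_of_ccDist_eq_zero hW (le_antisymm ?_ (ccDist_nonneg _ _))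
      have := hlip 0 ⟨le_rfl, zero_le_one⟩ t ht
      rwa [← hd, zero_mul] at this
    obtain ⟨u, hu, hu'⟩ := hintv 0 1 le_rfl one_pos le_rfl
    refine Eventually.of_forall fun t ht => ?_
    rw [hconst t (Ioo_subset_Icc_self ht), ← hconst u hu]
    exact hu'
  · exact ae_off_wells fun w hw => volume_well_eq_zero hW hw hd
      (fun s t hs hst ht => hlip.ccDist_eq hW hs hst ht) (hlip.continuousOn hW) hintv

/-- Almost minimal curves lift to curves in space of almost minimal constant speed. -/
theorem exists_isCCLip_of_ccDist_lt (hW : TwoWell W pm pp) {P Q : ℝ × ℝ × ℝ} {E : ℝ}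
    (hE : ccDist W pm pp P Q < E) :
    ∃ Γ : ℝ → ℝ × ℝ × ℝ, Γ 0 = P ∧ Γ 1 = Q ∧ IsCCLip W pm pp E 0 1 Γ := by
  obtain ⟨a, b, γ, hγ, ha, hb, hA, hintv⟩ := exists_finCurve_of_ccDist_lt hW hE
  have hab := hγ.1.1
  rw [hasArea_iff] at hA
  set α : ℝ → ℝ := fun t => areaForm pm pp (γ t) (deriv γ t) with hα
  set S : ℝ → ℝ := fun t => ∫ x in a..t, degSpeed W γ x with hS
  set G : ℝ → ℝ × ℝ × ℝ := fun t => ((γ t).1, (γ t).2,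
    P.2.2 + (wellPot pm pp (γ t) - wellPot pm pp (γ a) + ∫ x in a..t, α x)) with hG
  have hsubi : ∀ {f : ℝ → ℝ}, IntervalIntegrable f volume a b → ∀ {x y : ℝ}, a ≤ x → x ≤ y → y ≤ b →
      IntervalIntegrable f volume x y := fun hf x y hx hxy hy => hf.mono_set (by
    rw [uIcc_of_le hab, uIcc_of_le hxy]
    exact Icc_subset_Icc hx hy)
  have hle : ∀ x y, a ≤ x → x ≤ y → y ≤ b → ccDist W pm pp (G x) (G y) ≤ S y - S x := by
    intro x y hx hxy hy
    have hr := hγ.restrict hx hxy hy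
    have e1 := intervalIntegral.integral_add_adjacent_intervals
      (hsubi hγ.2 le_rfl hx (hxy.trans hy)) (hsubi hγ.2 hx hxy hy)
    have e2 := intervalIntegral.integral_add_adjacent_intervals
      (hsubi hA.1 le_rfl hx (hxy.trans hy)) (hsubi hA.1 hx hxy hy)
    have e3 : S y - S x = ∫ u in x..y, degSpeed W γ u := by
      simp only [hS]
      linarith
    rw [e3]
    refine ccDist_le_integral hr.1 ((hasArea_iff _).2 ⟨hsubi hA.1 hx hxy hy, ?_⟩) hr.2
    simp only [hG]
    linarith
  have hSc : ContinuousOn S (Icc a b) := by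
    rw [← uIcc_of_le hab]
    exact intervalIntegral.continuousOn_primitive_interval' hγ.2 left_mem_uIcc
  have hSa : S a = 0 := intervalIntegral.integral_same
  have hSb : 0 ≤ S b := hγ.integral_nonneg
  have hσ : ∀ u : ℝ, ∃ x, (u ∈ Icc (0 : ℝ) 1 → x ∈ Icc a b ∧ S x = u * S b) ∧
      (u = 0 → x = a) ∧ (u = 1 → x = b) := by
    intro u
    by_cases h0 : u = 0
    · exact ⟨a, fun _ => ⟨⟨le_rfl, hab⟩, by rw [h0, hSa, zero_mul]⟩, fun _ => rfl,
        fun h => absurd (h0.symm.trans h) zero_ne_one⟩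
    by_cases h1 : u = 1
    · exact ⟨b, fun _ => ⟨⟨hab, le_rfl⟩, by rw [h1, one_mul]⟩, fun h => absurd h h0, fun _ => rfl⟩
    by_cases hu : u ∈ Icc (0 : ℝ) 1
    · obtain ⟨x, hx, hxS⟩ := intermediate_value_Icc hab hSc (show u * S b ∈ Icc (S a) (S b) by
        rw [hSa]
        exact ⟨mul_nonneg hu.1 hSb, mul_le_of_le_one_left hSb hu.2⟩)
      exact ⟨x, fun _ => ⟨hx, hxS⟩, fun h => absurd h h0, fun h => absurd h h1⟩
    · exact ⟨a, fun h => absurd h hu, fun _ => rfl, fun h => absurd h h1⟩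
  choose σ hσ1 hσ0 hσ2 using hσ
  refine ⟨fun u => G (σ u), ?_, ?_, ?_⟩
  · show G (σ 0) = P
    rw [hσ0 0 rfl]
    have e : γ a = (P.1, P.2.1) := ha
    simp [hG, e]
  · show G (σ 1) = Q
    rw [hσ2 1 rfl]
    have e : γ b = (Q.1, Q.2.1) := hb
    have e2 : wellPot pm pp (γ b) - wellPot pm pp (γ a) + ∫ x in a..b, α x = Q.2.2 - P.2.2 :=
      hA.2.symm
    rw [e] at e2
    simp only [hG, e, e2]
    ext <;> simp
  · refine IsCCLip.of_le fun u v hu huv hv => ?_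
    obtain ⟨x1, x2⟩ := hσ1 u ⟨hu, huv.trans hv⟩
    obtain ⟨y1, y2⟩ := hσ1 v ⟨hu.trans huv, hv⟩
    have hfin : S b * (v - u) ≤ E * (v - u) :=
      mul_le_mul_of_nonneg_right hintv.le (by linarith)
    refine le_trans ?_ hfin
    rcases le_total (σ u) (σ v) with h | h
    · have := hle _ _ x1.1 h y1.2
      rw [x2, y2] at this
      linarith
    · have := hle _ _ y1.1 h x1.2
      rw [x2, y2, ccDist_comm] at this
      have h3 : 0 ≤ (v - u) * S b := mul_nonneg (by linarith) hSb
      linarith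

/-- Any two points are joined by a curve that is Lipschitz with the optimal constant. -/
theorem exists_isCCLip (hW : TwoWell W pm pp) (P Q : ℝ × ℝ × ℝ) :
    ∃ Γ : ℝ → ℝ × ℝ × ℝ, Γ 0 = P ∧ Γ 1 = Q ∧ IsCCLip W pm pp (ccDist W pm pp P Q) 0 1 Γ := by
  set d := ccDist W pm pp P Q with hd
  have hd0 : 0 ≤ d := ccDist_nonneg _ _
  have hpos : ∀ j : ℕ, (0 : ℝ) < 1 / (j + 1) := fun j => by positivity
  have hex : ∀ j : ℕ, ∃ Γ : ℝ → ℝ × ℝ × ℝ, Γ 0 = P ∧ Γ 1 = Q ∧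
      IsCCLip W pm pp (d + 1 / (j + 1)) 0 1 Γ := fun j =>
    exists_isCCLip_of_ccDist_lt hW (by have := hpos j; linarith)
  choose Γs h0 h1 hlip using hex
  obtain ⟨C, hC, R', hbd⟩ := hW.exists_height_bound ‖proj P‖ (d + 2)
  obtain ⟨B, hB⟩ := (isCompact_closedBall (0 : ℝ × ℝ) R').exists_bound_of_continuousOn
    (contDiff_wellPot pm pp).continuous.continuousOn
  set M := max R' (|P.2.2| + |wellPot pm pp (proj P)| + B + C * (d + 2)) with hM
  have hcomp : ∀ t ∈ Icc (0 : ℝ) 1, ∀ j, Γs j t ∈ Metric.closedBall (0 : ℝ × ℝ × ℝ) M := by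
    intro t ht j
    have hdist : ccDist W pm pp P (Γs j t) < d + 2 := by
      have := hlip j 0 ⟨le_rfl, zero_le_one⟩ t ht
      rw [h0, sub_zero, abs_of_nonneg ht.1] at this
      have hj : (1 : ℝ) / (j + 1) ≤ 1 := by
        rw [div_le_one (by positivity)]
        have : (0 : ℝ) ≤ j := j.cast_nonneg
        linarith
      have h2 : (d + 1 / (j + 1)) * t ≤ d + 1 / (j + 1) :=
        mul_le_of_le_one_right (add_nonneg hd0 (hpos j).le) ht.2
      linarith
    obtain ⟨e1, e2⟩ := hbd P (Γs j t) le_rfl hdist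
    have e3 := hB (proj (Γs j t)) (by simpa using e1)
    rw [Real.norm_eq_abs] at e3
    have e4 : C * ccDist W pm pp P (Γs j t) ≤ C * (d + 2) := by gcongr
    have e5 : |(Γs j t).2.2| ≤ |P.2.2| + |wellPot pm pp (proj P)| + B + C * (d + 2) := by
      have i1 := abs_le.1 (e2.trans e4)
      have i2 := abs_le.1 e3
      have i3 := neg_abs_le P.2.2
      have i4 := le_abs_self P.2.2
      have i5 := neg_abs_le (wellPot pm pp (proj P))
      have i6 := le_abs_self (wellPot pm pp (proj P))
      rw [abs_le]
      constructor <;> linarith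
    rw [mem_closedBall_zero_iff]
    have e6 : ‖((Γs j t).1, (Γs j t).2.1)‖ ≤ R' := e1
    rw [Prod.norm_def, max_le_iff] at e6
    rw [Prod.norm_def, Prod.norm_def]
    exact max_le (e6.1.trans (le_max_left _ _))
      (max_le (e6.2.trans (le_max_left _ _)) (e5.trans (le_max_right _ _)))
  set U : Ultrafilter ℕ := hyperfilter ℕ with hU
  have hUtop : (U : Filter ℕ) ≤ atTop := Nat.hyperfilter_le_atTop
  have hlim : ∀ t : ℝ, ∃ x, t ∈ Icc (0 : ℝ) 1 → Tendsto (fun j => Γs j t) U (𝓝 x) := by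
    intro t
    by_cases ht : t ∈ Icc (0 : ℝ) 1
    · obtain ⟨x, -, hx⟩ := (isCompact_closedBall (0 : ℝ × ℝ × ℝ) M).ultrafilter_le_nhds
        (U.map fun j => Γs j t) (by
          rw [le_principal_iff]
          exact mem_map.2 (univ_mem' fun j => hcomp t ht j))
      exact ⟨x, fun _ => hx⟩
    · exact ⟨P, fun h => absurd h ht⟩
  choose Γ hΓ using hlim
  have l0 : Γ 0 = P := by
    refine tendsto_nhds_unique (hΓ 0 ⟨le_rfl, zero_le_one⟩) ?_
    simp only [h0]
    exact tendsto_const_nhds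
  have l1 : Γ 1 = Q := by
    refine tendsto_nhds_unique (hΓ 1 ⟨zero_le_one, le_rfl⟩) ?_
    simp only [h1]
    exact tendsto_const_nhds
  refine ⟨Γ, l0, l1, fun s hs t ht => le_of_forall_pos_le_add fun ε hε => ?_⟩
  have hη : 0 < ε / 3 := by positivity
  have ev1 := (hΓ s hs).eventually (ccDist_lt_of_close hW (Γ s) hη)
  have ev2 := (hΓ t ht).eventually (ccDist_lt_of_close hW (Γ t) hη)
  have ev3 : ∀ᶠ j : ℕ in U, (1 : ℝ) / (j + 1) < ε / 3 :=
    (tendsto_one_div_add_atTop_nhds_zero_nat.mono_left hUtop).eventually_lt_const hη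
  obtain ⟨j, ⟨j1, j2⟩, j3⟩ := ((ev1.and ev2).and ev3).exists
  have k1 := ccDist_triangle hW (Γ s) (Γs j s) (Γ t)
  have k2 := ccDist_triangle hW (Γs j s) (Γs j t) (Γ t)
  rw [ccDist_comm (Γs j t) (Γ t)] at k2
  have k3 := hlip j s hs t ht
  have k4 : 1 / ((j : ℝ) + 1) * |t - s| ≤ 1 / (j + 1) := by
    refine mul_le_of_le_one_right (hpos j).le (abs_le.2 ⟨?_, ?_⟩)
    · linarith [ht.1, hs.2]
    · linarith [ht.2, hs.1]
  linarith

/-- A calibrated vertical segment over a well is length minimizing. -/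
theorem pathLen_vertical_le (hW : TwoWell W pm pp) (D : WellFrame W w) {v : ℝ}
    (hv : D.tr * v ≤ fiberDist W pm pp w v) :
    pathLen (confFactor W) pm pp 0 v (fun u => (w.1, w.2, u)) ≤
      dCC (confFactor W) pm pp (w.1, w.2, 0) (w.1, w.2, v) := by
  refine sSup_le ?_
  rintro x ⟨n, t, hmono, ht0, htn, rfl⟩
  have hstep : ∀ i : Fin n, dCC (confFactor W) pm pp (w.1, w.2, t i.castSucc) (w.1, w.2, t i.succ) ≤
      ENNReal.ofReal (D.tr * (t i.succ - t i.castSucc)) := by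
    intro i
    have hi : 0 ≤ t i.succ - t i.castSucc := sub_nonneg.2 (hmono (Fin.castSucc_lt_succ).le)
    rw [← ofReal_ccDist hW, ccDist_eq_fiberDist (w := w) rfl rfl]
    refine ENNReal.ofReal_le_ofReal ((D.fiberDist_le hW _).trans_eq ?_)
    rw [abs_of_nonneg hi]
  have htel : ∀ (n : ℕ) (t : Fin (n + 1) → ℝ),
      ∑ i : Fin n, (t i.succ - t i.castSucc) = t (Fin.last n) - t 0 := by
    intro n
    induction n with
    | zero => intro t; simp
    | succ n ih =>
      intro t
      rw [Fin.sum_univ_castSucc]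
      have := ih fun i => t i.castSucc
      simp only [Fin.succ_castSucc] at this ⊢
      rw [this]
      simp
  calc _ ≤ ∑ i : Fin n, ENNReal.ofReal (D.tr * (t i.succ - t i.castSucc)) :=
        Finset.sum_le_sum fun i _ => hstep i
    _ = ENNReal.ofReal (∑ i : Fin n, D.tr * (t i.succ - t i.castSucc)) :=
        (ENNReal.ofReal_sum_of_nonneg fun i _ => mul_nonneg D.tr_pos.le
          (sub_nonneg.2 (hmono (Fin.castSucc_lt_succ).le))).symm
    _ = ENNReal.ofReal (D.tr * v) := by rw [← Finset.mul_sum, htel, ht0, htn, sub_zero]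
    _ ≤ ENNReal.ofReal (fiberDist W pm pp w v) := ENNReal.ofReal_le_ofReal hv
    _ = _ := ofReal_ccDist hW _ _

theorem exists_isConstrainedMin (hW : TwoWell W pm pp)
    (h : ∀ w : ℝ × ℝ, (w = pm ∨ w = pp) → ∀ s t : ℝ, s < t →
      dCC (confFactor W) pm pp (w.1, w.2, s) (w.1, w.2, t) <
        pathLen (confFactor W) pm pp s t (fun u => (w.1, w.2, u))) (A : ℝ) :
    ∃ (a b : ℝ) (γ : ℝ → ℝ × ℝ), IsConstrainedMin (confFactor W) pm pp pm pp A a b γ := by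
  obtain ⟨Γ, h0, h1, hlip⟩ := exists_isCCLip hW (pm.1, pm.2, 0) (pp.1, pp.2, A)
  have hd : 0 < ccDist W pm pp (pm.1, pm.2, 0) (pp.1, pp.2, A) := by
    refine lt_of_le_of_ne (ccDist_nonneg _ _) fun h => ?_
    exact hW.wells_ne (proj_eq_of_ccDist_eq_zero hW h.symm).symm
  rw [← h0, ← h1] at hlip hd
  have hmin := hlip.isConstrainedMin hW <| ae_off_wells fun w hw => by
    by_contra hK
    obtain ⟨D⟩ := hW.nonempty_wellFrame hw
    obtain ⟨v₀, hv₀, hv⟩ := D.exists_tr_mul_le_fiberDist hW hd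
      (fun s t hs hst ht => hlip.ccDist_eq hW hs hst ht) (hlip.continuousOn hW) hK
    exact not_le.2 (h w hw 0 v₀ hv₀) (pathLen_vertical_le hW D (hv v₀ ⟨hv₀.le, le_rfl⟩))
  rw [h0, h1, sub_zero] at hmin
  exact ⟨0, 1, projCurve Γ, hmin⟩

end

/-- If a minimizing geodesic `Γ` from `P` to `Q` spends no nondegenerate time interval over the
wells, then its planar projection minimizes `E` subject to the endpoint and area constraints. In
particular, if no nondegenerate vertical segment over either well is length minimizing, then the
isoperimetric problem between the wells has a solution for every constraint `A`. -/
theorem projection_minimizes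
    (W : ℝ × ℝ → ℝ) (pm pp : ℝ × ℝ) (hW : TwoWell W pm pp) :
    (∀ (P Q : ℝ × ℝ × ℝ) (Γ : ℝ → ℝ × ℝ × ℝ), IsMinGeodesic (confFactor W) pm pp P Q Γ →
      (¬ ∃ s t : ℝ, s < t ∧
          Set.Icc s t ⊆ { u | u ∈ Set.Icc (0 : ℝ) 1 ∧ (projCurve Γ u = pm ∨ projCurve Γ u = pp) }) →
      IsConstrainedMin (confFactor W) pm pp (proj P) (proj Q) (Q.2.2 - P.2.2) 0 1 (projCurve Γ)) ∧
    ((∀ w : ℝ × ℝ, (w = pm ∨ w = pp) → ∀ s t : ℝ, s < t →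
        dCC (confFactor W) pm pp (w.1, w.2, s) (w.1, w.2, t) <
          pathLen (confFactor W) pm pp s t (fun u => (w.1, w.2, u))) →
      ∀ A : ℝ, ∃ (a b : ℝ) (γ : ℝ → ℝ × ℝ),
        IsConstrainedMin (confFactor W) pm pp pm pp A a b γ) := by
  refine ⟨fun P Q Γ hΓ hK => hΓ.isConstrainedMin hW fun s t hs hst ht => ?_,
    exists_isConstrainedMin hW⟩
  by_contra hno
  push Not at hno
  refine hK ⟨s, t, hst, fun u hu => ⟨⟨hs.trans hu.1, hu.2.trans ht⟩, ?_⟩⟩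
  by_cases h : projCurve Γ u = pm
  · exact Or.inl h
  · exact Or.inr (hno u hu h)
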